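/- Suppose m ≠ n and m, n ≥ 1. Then there exists a Σ1 provability predicate PR_T(x) of T such that PL(PR_T) = N⁺A_{m,n}. -/

import Mathlib

namespace PLN

/-! ### Modal formulas and the logics N⁺A_{m,n} -/

/-- Formulas of modal propositional logic. -/
inductive MFml : Type
  | var : ℕ → MFml
  | bot : MFml
  | neg : MFml → MFml
  | and : MFml → MFml → MFml
  | or : MFml → MFml → MFml
  | imp : MFml → MFml → MFml
  | box : MFml → MFml
  deriving DecidableEq

/-- `boxIter n A` is `□ⁿ A`, where `□⁰ A = A` and `□^(k+1) A = □ (□ᵏ A)`. -/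
def boxIter : ℕ → MFml → MFml
  | 0, A => A
  | k + 1, A => .box (boxIter k A)

/-- Evaluation of a modal formula under a valuation of its "propositional atoms"
(propositional variables, and boxed formulas); used to define propositional tautologies
in the modal language. -/
def MFml.evalTC (v : MFml → Prop) : MFml → Prop
  | .bot => False
  | .neg A => ¬ A.evalTC v
  | .and A B => A.evalTC v ∧ B.evalTC v
  | .or A B => A.evalTC v ∨ B.evalTC v
  | .imp A B => A.evalTC v → B.evalTC v
  | A => v A

/-- Propositional tautologies in the modal language. -/
def MTaut (A : MFml) : Prop := ∀ v, A.evalTC v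

/-- Provability in the logic `N⁺A_{m,n}`: the pure logic of necessitation `N`
(propositional tautologies, modus ponens, necessitation) together with the axiom scheme
`□ⁿA → □ᵐA` and the rule `Ros□` (from `¬□A` infer `¬□□A`). -/
inductive NAProves (m n : ℕ) : MFml → Prop
  | taut {A} : MTaut A → NAProves m n A
  | acc (A) : NAProves m n (.imp (boxIter n A) (boxIter m A))
  | mp {A B} : NAProves m n (.imp A B) → NAProves m n A → NAProves m n B
  | nec {A} : NAProves m n A → NAProves m n (.box A)
  | ros {A} : NAProves m n (.neg (.box A)) → NAProves m n (.neg (.box (.box A)))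

/-- `IsSub B A` : `B` is a subformula of `A`. -/
inductive IsSub : MFml → MFml → Prop
  | refl (A) : IsSub A A
  | neg {B A} : IsSub B A → IsSub B (.neg A)
  | andL {B A C} : IsSub B A → IsSub B (.and A C)
  | andR {B A C} : IsSub B C → IsSub B (.and A C)
  | orL {B A C} : IsSub B A → IsSub B (.or A C)
  | orR {B A C} : IsSub B C → IsSub B (.or A C)
  | impL {B A C} : IsSub B A → IsSub B (.imp A C)
  | impR {B A C} : IsSub B C → IsSub B (.imp A C)
  | box {B A} : IsSub B A → IsSub B (.box A)

/-! ### N-frames and N-models -/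

/-- An N-model on a set `W` of worlds: an N-frame (a binary relation `≺_B` on `W`
for each modal formula `B`) together with a valuation of propositional variables. -/
structure NModel (W : Type) where
  rel : MFml → W → W → Prop
  val : W → ℕ → Prop

/-- The forcing relation of an N-model:
`x ⊩ □B` iff every `y` with `x ≺_B y` satisfies `y ⊩ B`. -/
def NModel.Forces {W : Type} (M : NModel W) : W → MFml → Prop
  | x, .var p => M.val x p
  | _, .bot => False
  | x, .neg A => ¬ NModel.Forces M x A
  | x, .and A B => NModel.Forces M x A ∧ NModel.Forces M x B
  | x, .or A B => NModel.Forces M x A ∨ NModel.Forces M x B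
  | x, .imp A B => NModel.Forces M x A → NModel.Forces M x B
  | x, .box A => ∀ y, M.rel A x y → NModel.Forces M y A

/-- The relations `≺_B^k` : `x ≺_B^0 y` iff `x = y`, and
`x ≺_B^(k+1) y` iff `∃ w, x ≺_{□ᵏB} w` and `w ≺_B^k y`. -/
def NModel.relIter {W : Type} (M : NModel W) (B : MFml) : ℕ → W → W → Prop
  | 0, x, y => x = y
  | k + 1, x, y => ∃ w, M.rel (boxIter k B) x w ∧ NModel.relIter M B k w y

/-- `(m,n)`-accessibility of (the frame of) an N-model. -/
def NModel.Accessible {W : Type} (M : NModel W) (m n : ℕ) : Prop :=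
  ∀ (B : MFml) (x y : W), NModel.relIter M B m x y → NModel.relIter M B n x y

/-! ### The language of first-order arithmetic -/

/-- Terms of the language of arithmetic, with de Bruijn variables. -/
inductive ATerm : Type
  | var : ℕ → ATerm
  | zero : ATerm
  | succ : ATerm → ATerm
  | add : ATerm → ATerm → ATerm
  | mul : ATerm → ATerm → ATerm
  deriving DecidableEq

/-- Formulas of the language of arithmetic (with `≤` primitive), de Bruijn variables. -/
inductive AFml : Type
  | eq : ATerm → ATerm → AFml
  | le : ATerm → ATerm → AFml
  | neg : AFml → AFml
  | and : AFml → AFml → AFml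
  | or : AFml → AFml → AFml
  | imp : AFml → AFml → AFml
  | all : AFml → AFml
  | ex : AFml → AFml
  deriving DecidableEq

/-- Lift (shift up by one) the variables `≥ c` of a term. -/
def ATerm.lift (c : ℕ) : ATerm → ATerm
  | .var n => .var (if n < c then n else n + 1)
  | .zero => .zero
  | .succ t => .succ (t.lift c)
  | .add t s => .add (t.lift c) (s.lift c)
  | .mul t s => .mul (t.lift c) (s.lift c)

/-- Simultaneous substitution in terms. -/
def ATerm.substAll (σ : ℕ → ATerm) : ATerm → ATerm
  | .var n => σ n
  | .zero => .zero
  | .succ t => .succ (t.substAll σ)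
  | .add t s => .add (t.substAll σ) (s.substAll σ)
  | .mul t s => .mul (t.substAll σ) (s.substAll σ)

/-- Pushing a substitution under a binder. -/
def liftSub (σ : ℕ → ATerm) : ℕ → ATerm
  | 0 => .var 0
  | n + 1 => (σ n).lift 0

/-- Lift (shift up by one) the free variables `≥ c` of a formula. -/
def AFml.lift (c : ℕ) : AFml → AFml
  | .eq t s => .eq (t.lift c) (s.lift c)
  | .le t s => .le (t.lift c) (s.lift c)
  | .neg φ => .neg (φ.lift c)
  | .and φ ψ => .and (φ.lift c) (ψ.lift c)
  | .or φ ψ => .or (φ.lift c) (ψ.lift c)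
  | .imp φ ψ => .imp (φ.lift c) (ψ.lift c)
  | .all φ => .all (φ.lift (c + 1))
  | .ex φ => .ex (φ.lift (c + 1))

/-- Simultaneous (capture-avoiding) substitution in formulas. -/
def AFml.substAll (σ : ℕ → ATerm) : AFml → AFml
  | .eq t s => .eq (t.substAll σ) (s.substAll σ)
  | .le t s => .le (t.substAll σ) (s.substAll σ)
  | .neg φ => .neg (φ.substAll σ)
  | .and φ ψ => .and (φ.substAll σ) (ψ.substAll σ)
  | .or φ ψ => .or (φ.substAll σ) (ψ.substAll σ)
  | .imp φ ψ => .imp (φ.substAll σ) (ψ.substAll σ)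
  | .all φ => .all (φ.substAll (liftSub σ))
  | .ex φ => .ex (φ.substAll (liftSub σ))

def subst0Env (t : ATerm) : ℕ → ATerm
  | 0 => t
  | n + 1 => .var n

def subst2Env (t s : ATerm) : ℕ → ATerm
  | 0 => t
  | 1 => s
  | n + 2 => .var n

/-- Substitute the term `t` for the free variable `0` (decrementing other variables). -/
def AFml.subst0 (φ : AFml) (t : ATerm) : AFml := φ.substAll (subst0Env t)

/-- Substitute the terms `t`, `s` for the free variables `0`, `1` simultaneously. -/
def AFml.subst2 (φ : AFml) (t s : ATerm) : AFml := φ.substAll (subst2Env t s)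

/-- Substitute `S(var 0)` for `var 0`, leaving all other free variables unchanged. -/
def succSubst (φ : AFml) : AFml :=
  φ.substAll fun n => if n = 0 then .succ (.var 0) else .var n

/-- All variables of a term are `< c`. -/
def ATerm.FreeLt (c : ℕ) : ATerm → Prop
  | .var n => n < c
  | .zero => True
  | .succ t => t.FreeLt c
  | .add t s => t.FreeLt c ∧ s.FreeLt c
  | .mul t s => t.FreeLt c ∧ s.FreeLt c

/-- All free variables of a formula are `< c`; `FreeLt 0 φ` says that `φ` is a sentence. -/
def AFml.FreeLt (c : ℕ) : AFml → Prop
  | .eq t s => t.FreeLt c ∧ s.FreeLt c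
  | .le t s => t.FreeLt c ∧ s.FreeLt c
  | .neg φ => φ.FreeLt c
  | .and φ ψ => φ.FreeLt c ∧ ψ.FreeLt c
  | .or φ ψ => φ.FreeLt c ∧ ψ.FreeLt c
  | .imp φ ψ => φ.FreeLt c ∧ ψ.FreeLt c
  | .all φ => φ.FreeLt (c + 1)
  | .ex φ => φ.FreeLt (c + 1)

/-- The numeral `n̄`. -/
def numeral : ℕ → ATerm
  | 0 => .zero
  | n + 1 => .succ (numeral n)

/-- A Gödel numbering of terms. -/
def ATerm.code : ATerm → ℕ
  | .var n => Nat.pair 0 n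
  | .zero => Nat.pair 1 0
  | .succ t => Nat.pair 2 t.code
  | .add t s => Nat.pair 3 (Nat.pair t.code s.code)
  | .mul t s => Nat.pair 4 (Nat.pair t.code s.code)

/-- A Gödel numbering of formulas. -/
def AFml.code : AFml → ℕ
  | .eq t s => Nat.pair 0 (Nat.pair t.code s.code)
  | .le t s => Nat.pair 1 (Nat.pair t.code s.code)
  | .neg φ => Nat.pair 2 φ.code
  | .and φ ψ => Nat.pair 3 (Nat.pair φ.code ψ.code)
  | .or φ ψ => Nat.pair 4 (Nat.pair φ.code ψ.code)
  | .imp φ ψ => Nat.pair 5 (Nat.pair φ.code ψ.code)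
  | .all φ => Nat.pair 6 φ.code
  | .ex φ => Nat.pair 7 φ.code

/-- `⌜φ⌝`, the numeral of the Gödel number of `φ`. -/
def gnum (φ : AFml) : ATerm := numeral φ.code

/-- For a formula `P(x)` (with free variable `var 0`), `P.appNum φ` is `P(⌜φ⌝)`. -/
def AFml.appNum (P φ : AFml) : AFml := P.subst0 (gnum φ)

/-- Iterated application of a predicate: `iterPred P k φ = P(⌜P(⌜⋯P(⌜φ⌝)⋯⌝)⌝)` (`k` times). -/
def iterPred (P : AFml) : ℕ → AFml → AFml
  | 0, φ => φ
  | k + 1, φ => P.appNum (iterPred P k φ)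

/-! ### Satisfaction in the standard model -/

def ATerm.val (ρ : ℕ → ℕ) : ATerm → ℕ
  | .var n => ρ n
  | .zero => 0
  | .succ t => t.val ρ + 1
  | .add t s => t.val ρ + s.val ρ
  | .mul t s => t.val ρ * s.val ρ

def consEnv (a : ℕ) (ρ : ℕ → ℕ) : ℕ → ℕ
  | 0 => a
  | n + 1 => ρ n

/-- Satisfaction in the standard model `ℕ` under an environment `ρ`. -/
def AFml.Sat (ρ : ℕ → ℕ) : AFml → Prop
  | .eq t s => t.val ρ = s.val ρ
  | .le t s => t.val ρ ≤ s.val ρ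
  | .neg φ => ¬ φ.Sat ρ
  | .and φ ψ => φ.Sat ρ ∧ ψ.Sat ρ
  | .or φ ψ => φ.Sat ρ ∨ ψ.Sat ρ
  | .imp φ ψ => φ.Sat ρ → ψ.Sat ρ
  | .all φ => ∀ a, φ.Sat (consEnv a ρ)
  | .ex φ => ∃ a, φ.Sat (consEnv a ρ)

/-- `ℕ ⊨ φ`. -/
def TrueN (φ : AFml) : Prop := φ.Sat fun _ => 0

/-! ### The arithmetical hierarchy: Δ₀, Σ₁, Π₁ -/

/-- `Δ₀` formulas: every quantifier is bounded. -/
inductive IsDelta0 : AFml → Prop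
  | eq (t s : ATerm) : IsDelta0 (.eq t s)
  | le (t s : ATerm) : IsDelta0 (.le t s)
  | neg {φ} : IsDelta0 φ → IsDelta0 (.neg φ)
  | and {φ ψ} : IsDelta0 φ → IsDelta0 ψ → IsDelta0 (.and φ ψ)
  | or {φ ψ} : IsDelta0 φ → IsDelta0 ψ → IsDelta0 (.or φ ψ)
  | imp {φ ψ} : IsDelta0 φ → IsDelta0 ψ → IsDelta0 (.imp φ ψ)
  | ball {φ : AFml} (t : ATerm) : IsDelta0 φ → IsDelta0 (.all (.imp (.le (.var 0) (ATerm.lift 0 t)) φ))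
  | bex {φ : AFml} (t : ATerm) : IsDelta0 φ → IsDelta0 (.ex (.and (.le (.var 0) (ATerm.lift 0 t)) φ))

mutual
  /-- `Σ₁` formulas. -/
  inductive IsSigma1 : AFml → Prop
    | delta0 {φ} : IsDelta0 φ → IsSigma1 φ
    | and {φ ψ} : IsSigma1 φ → IsSigma1 ψ → IsSigma1 (.and φ ψ)
    | or {φ ψ} : IsSigma1 φ → IsSigma1 ψ → IsSigma1 (.or φ ψ)
    | ex {φ} : IsSigma1 φ → IsSigma1 (.ex φ)
    | negPi {φ} : IsPi1 φ → IsSigma1 (.neg φ)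
    | impPiSigma {φ ψ} : IsPi1 φ → IsSigma1 ψ → IsSigma1 (.imp φ ψ)
  /-- `Π₁` formulas. -/
  inductive IsPi1 : AFml → Prop
    | delta0 {φ} : IsDelta0 φ → IsPi1 φ
    | and {φ ψ} : IsPi1 φ → IsPi1 ψ → IsPi1 (.and φ ψ)
    | or {φ ψ} : IsPi1 φ → IsPi1 ψ → IsPi1 (.or φ ψ)
    | all {φ} : IsPi1 φ → IsPi1 (.all φ)
    | negSigma {φ} : IsSigma1 φ → IsPi1 (.neg φ)
    | impSigmaPi {φ ψ} : IsSigma1 φ → IsPi1 ψ → IsPi1 (.imp φ ψ)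
end

/-! ### A Hilbert-style proof system for first-order arithmetic -/

/-- Evaluation of an arithmetical formula under a valuation of its "propositionally atomic"
subformulas (atomic or quantified formulas); used for propositional tautologies and
tautological consequence. -/
def AFml.evalProp (v : AFml → Prop) : AFml → Prop
  | .neg φ => ¬ φ.evalProp v
  | .and φ ψ => φ.evalProp v ∧ ψ.evalProp v
  | .or φ ψ => φ.evalProp v ∨ ψ.evalProp v
  | .imp φ ψ => φ.evalProp v → ψ.evalProp v
  | φ => v φ

/-- Propositional tautologies in the language of arithmetic. -/
def ATaut (φ : AFml) : Prop := ∀ v, φ.evalProp v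

/-- `φ` is a tautological consequence of the set `X` of formulas. -/
def TC (X : Set AFml) (φ : AFml) : Prop :=
  ∀ v : AFml → Prop, (∀ ψ ∈ X, ψ.evalProp v) → φ.evalProp v

def iffF (φ ψ : AFml) : AFml := .and (.imp φ ψ) (.imp ψ φ)

/-- Hilbert-style provability from the set of axioms `Γ` in classical first-order
logic with equality. -/
inductive Proves (Γ : Set AFml) : AFml → Prop
  | ax {φ} : φ ∈ Γ → Proves Γ φ
  | taut {φ} : ATaut φ → Proves Γ φ
  | mp {φ ψ} : Proves Γ (.imp φ ψ) → Proves Γ φ → Proves Γ ψ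
  | allE (φ : AFml) (t : ATerm) : Proves Γ (.imp (.all φ) (φ.subst0 t))
  | exI (φ : AFml) (t : ATerm) : Proves Γ (.imp (φ.subst0 t) (.ex φ))
  | allImp (φ ψ : AFml) : Proves Γ (.imp (.all (.imp φ ψ)) (.imp (.all φ) (.all ψ)))
  | vacAll (φ : AFml) : Proves Γ (.imp φ (.all (AFml.lift 0 φ)))
  | exDef (φ : AFml) : Proves Γ (iffF (.ex φ) (.neg (.all (.neg φ))))
  | gen {φ} : Proves Γ φ → Proves Γ (.all φ)
  | eqRefl (t : ATerm) : Proves Γ (.eq t t)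
  | eqSubst (φ : AFml) (t s : ATerm) : Proves Γ (.imp (.eq t s) (.imp (φ.subst0 t) (φ.subst0 s)))

/-! ### Peano arithmetic -/

/-- The axioms of Peano arithmetic. -/
inductive PAax : AFml → Prop
  | succNeZero : PAax (.all (.neg (.eq (.succ (.var 0)) .zero)))
  | succInj :
      PAax (.all (.all (.imp (.eq (.succ (.var 1)) (.succ (.var 0))) (.eq (.var 1) (.var 0)))))
  | addZero : PAax (.all (.eq (.add (.var 0) .zero) (.var 0)))
  | addSucc :
      PAax (.all (.all (.eq (.add (.var 1) (.succ (.var 0))) (.succ (.add (.var 1) (.var 0))))))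
  | mulZero : PAax (.all (.eq (.mul (.var 0) .zero) .zero))
  | mulSucc :
      PAax (.all (.all (.eq (.mul (.var 1) (.succ (.var 0)))
        (.add (.mul (.var 1) (.var 0)) (.var 1)))))
  | leDef :
      PAax (.all (.all (iffF (.le (.var 1) (.var 0))
        (.ex (.eq (.add (.var 0) (.var 2)) (.var 1))))))
  | ind (φ : AFml) :
      PAax (.imp (.and (φ.subst0 .zero) (.all (.imp φ (succSubst φ)))) (.all φ))

/-- Peano arithmetic, as a set of axioms. -/
def PA : Set AFml := {φ | PAax φ}

/-- The sentence `0 = 1`. -/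
def botFml : AFml := .eq .zero (.succ .zero)

/-- `t < s`, as the formula `S(t) ≤ s`. -/
def ltF (t s : ATerm) : AFml := .le (.succ t) s

/-- `Δ₁(PA)` formulas: `Σ₁` formulas which are `PA`-provably equivalent to a `Π₁` formula. -/
def IsDelta1PA (φ : AFml) : Prop :=
  IsSigma1 φ ∧ ∃ ψ, IsPi1 ψ ∧ Proves PA (iffF φ ψ)

/-! ### Theories, provability predicates, arithmetical interpretations -/

/-- `Tax` is primitive recursively axiomatized (via the Gödel numbering). -/
def PrAxiomatized (Tax : Set AFml) : Prop :=
  ∃ p : ℕ → Bool, Primrec p ∧ ∀ φ : AFml, φ ∈ Tax ↔ p φ.code = true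

/-- `Σ₁`-soundness: every `T`-provable `Σ₁` sentence is true in `ℕ`. -/
def Sigma1Sound (Tax : Set AFml) : Prop :=
  ∀ φ : AFml, IsSigma1 φ → φ.FreeLt 0 → Proves Tax φ → TrueN φ

/-- `P` is a provability predicate of `T`: a formula `P(x)` with at most the free
variable `x` such that for every formula `φ`, `T ⊢ φ` iff `PA ⊢ P(⌜φ⌝)`. -/
def IsProvPred (Tax : Set AFml) (P : AFml) : Prop :=
  P.FreeLt 1 ∧ ∀ φ : AFml, Proves Tax φ ↔ Proves PA (P.appNum φ)

/-- `f` is an arithmetical interpretation based on the predicate `P`. -/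
def IsInterp (P : AFml) (f : MFml → AFml) : Prop :=
  (∀ i, (f (.var i)).FreeLt 0) ∧
  f .bot = botFml ∧
  (∀ A, f (.neg A) = .neg (f A)) ∧
  (∀ A B, f (.and A B) = .and (f A) (f B)) ∧
  (∀ A B, f (.or A B) = .or (f A) (f B)) ∧
  (∀ A B, f (.imp A B) = .imp (f A) (f B)) ∧
  (∀ A, f (.box A) = P.appNum (f A))

/-- The provability logic of the predicate `P` (relative to the theory `Tax`). -/
def PL (Tax : Set AFml) (P : AFml) : Set MFml :=
  {A | ∀ f : MFml → AFml, IsInterp P f → Proves Tax (f A)}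

/-- The formulas with a `T`-proof of code `≤ s` (relative to a proof enumeration `prf`). -/
def PTset (prf : ℕ → Option AFml) (s : ℕ) : Set AFml :=
  {φ | ∃ y ≤ s, prf y = some φ}



/-! ### Substitution calculus -/

def scons {α : Type} (a : α) (ρ : ℕ → α) : ℕ → α
  | 0 => a
  | n + 1 => ρ n

@[simp] theorem scons_zero {α : Type} (a : α) (ρ : ℕ → α) : scons a ρ 0 = a := rfl
@[simp] theorem scons_succ {α : Type} (a : α) (ρ : ℕ → α) (n : ℕ) :
    scons a ρ (n + 1) = ρ n := rfl

theorem consEnv_eq (a : ℕ) (ρ : ℕ → ℕ) : consEnv a ρ = scons a ρ := by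
  funext n; cases n <;> rfl

theorem ATerm.substAll_comp (σ τ : ℕ → ATerm) (t : ATerm) :
    (t.substAll σ).substAll τ = t.substAll (fun n => (σ n).substAll τ) := by
  induction t <;> simp_all [ATerm.substAll]

theorem ATerm.lift_eq (c : ℕ) (t : ATerm) :
    t.lift c = t.substAll (fun n => .var (if n < c then n else n + 1)) := by
  induction t <;> simp_all [ATerm.substAll, ATerm.lift]

theorem ATerm.lift0_eq (t : ATerm) :
    t.lift 0 = t.substAll (fun n => .var (n + 1)) := by
  rw [ATerm.lift_eq]; simp

theorem liftSub_comp (σ τ : ℕ → ATerm) (n : ℕ) :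
    (liftSub σ n).substAll (liftSub τ) = liftSub (fun n => (σ n).substAll τ) n := by
  cases n with
  | zero => rfl
  | succ n =>
    simp only [liftSub, ATerm.lift0_eq, ATerm.substAll_comp]
    congr 1
    funext k
    simp [ATerm.substAll, liftSub, ATerm.lift0_eq]

theorem AFml.substAll_comp (φ : AFml) (σ τ : ℕ → ATerm) :
    (φ.substAll σ).substAll τ = φ.substAll (fun n => (σ n).substAll τ) := by
  induction φ generalizing σ τ <;>
    simp_all [AFml.substAll, ATerm.substAll_comp, liftSub_comp] <;> rfl

theorem liftSub_var (f : ℕ → ℕ) : liftSub (fun n => .var (f n)) =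
    fun n => .var (scons 0 (fun k => f k + 1) n) := by
  funext n
  cases n <;> simp [liftSub, ATerm.lift]

theorem AFml.lift_eq (φ : AFml) (c : ℕ) :
    φ.lift c = φ.substAll (fun n => .var (if n < c then n else n + 1)) := by
  have key : ∀ c : ℕ, liftSub (fun n => .var (if n < c then n else n + 1)) =
      fun n => ATerm.var (if n < c + 1 then n else n + 1) := by
    intro c
    rw [liftSub_var]
    funext n
    cases n with
    | zero => simp
    | succ n => simp; split_ifs <;> rfl
  induction φ generalizing c <;> simp_all [AFml.substAll, AFml.lift, ATerm.lift_eq]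

theorem AFml.lift0_eq (φ : AFml) :
    φ.lift 0 = φ.substAll (fun n => .var (n + 1)) := by
  rw [AFml.lift_eq]; simp

theorem ATerm.substAll_congr {c : ℕ} {t : ATerm} (h : t.FreeLt c) {σ τ : ℕ → ATerm}
    (hst : ∀ n < c, σ n = τ n) : t.substAll σ = t.substAll τ := by
  induction t <;> simp_all [ATerm.substAll, ATerm.FreeLt]

theorem AFml.substAll_congr {φ : AFml} {c : ℕ} (h : φ.FreeLt c) {σ τ : ℕ → ATerm}
    (hst : ∀ n < c, σ n = τ n) : φ.substAll σ = φ.substAll τ := by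
  induction φ generalizing c σ τ with
  | eq t s => simp [AFml.substAll, ATerm.substAll_congr h.1 hst, ATerm.substAll_congr h.2 hst]
  | le t s => simp [AFml.substAll, ATerm.substAll_congr h.1 hst, ATerm.substAll_congr h.2 hst]
  | neg φ ih => simp [AFml.substAll, ih h hst]
  | and φ ψ ih1 ih2 => simp [AFml.substAll, ih1 h.1 hst, ih2 h.2 hst]
  | or φ ψ ih1 ih2 => simp [AFml.substAll, ih1 h.1 hst, ih2 h.2 hst]
  | imp φ ψ ih1 ih2 => simp [AFml.substAll, ih1 h.1 hst, ih2 h.2 hst]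
  | all φ ih =>
    simp only [AFml.substAll, AFml.all.injEq]
    apply ih h
    intro n hn
    cases n with
    | zero => rfl
    | succ n => simp [liftSub, hst n (by omega)]
  | ex φ ih =>
    simp only [AFml.substAll, AFml.ex.injEq]
    apply ih h
    intro n hn
    cases n with
    | zero => rfl
    | succ n => simp [liftSub, hst n (by omega)]

theorem ATerm.substAll_var (t : ATerm) : t.substAll .var = t := by
  induction t <;> simp_all [ATerm.substAll]

theorem liftSub_id : liftSub ATerm.var = ATerm.var := by
  funext n; cases n <;> simp [liftSub, ATerm.lift]

theorem AFml.substAll_var (φ : AFml) : φ.substAll .var = φ := by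
  induction φ <;> simp_all [AFml.substAll, ATerm.substAll_var, liftSub_id]

theorem AFml.substAll_closed {φ : AFml} (h : φ.FreeLt 0) (σ : ℕ → ATerm) :
    φ.substAll σ = φ := by
  conv_rhs => rw [← AFml.substAll_var φ]
  exact AFml.substAll_congr h (by simp)

theorem ATerm.FreeLt.mono {t : ATerm} {c d : ℕ} (h : t.FreeLt c) (hcd : c ≤ d) : t.FreeLt d := by
  induction t <;> simp_all [ATerm.FreeLt] <;> omega

theorem AFml.FreeLt.mono {φ : AFml} {c d : ℕ} (h : φ.FreeLt c) (hcd : c ≤ d) : φ.FreeLt d := by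
  induction φ generalizing c d with
  | eq t s => exact ⟨h.1.mono hcd, h.2.mono hcd⟩
  | le t s => exact ⟨h.1.mono hcd, h.2.mono hcd⟩
  | neg φ ih => exact ih (c := c) h hcd
  | and φ ψ ih1 ih2 => exact ⟨ih1 h.1 hcd, ih2 h.2 hcd⟩
  | or φ ψ ih1 ih2 => exact ⟨ih1 h.1 hcd, ih2 h.2 hcd⟩
  | imp φ ψ ih1 ih2 => exact ⟨ih1 h.1 hcd, ih2 h.2 hcd⟩
  | all φ ih => exact ih (c := c + 1) h (by omega)
  | ex φ ih => exact ih (c := c + 1) h (by omega)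

theorem ATerm.exists_freeLt (t : ATerm) : ∃ c, t.FreeLt c := by
  induction t with
  | var n => exact ⟨n + 1, by simp [ATerm.FreeLt]⟩
  | zero => exact ⟨0, trivial⟩
  | succ t ih => exact ih
  | add t s ih1 ih2 =>
    obtain ⟨a, ha⟩ := ih1; obtain ⟨b, hb⟩ := ih2
    exact ⟨max a b, ha.mono (le_max_left _ _), hb.mono (le_max_right _ _)⟩
  | mul t s ih1 ih2 =>
    obtain ⟨a, ha⟩ := ih1; obtain ⟨b, hb⟩ := ih2
    exact ⟨max a b, ha.mono (le_max_left _ _), hb.mono (le_max_right _ _)⟩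

theorem AFml.exists_freeLt (φ : AFml) : ∃ c, φ.FreeLt c := by
  have two : ∀ φ ψ : AFml, (∃ c, φ.FreeLt c) → (∃ c, ψ.FreeLt c) →
      ∃ c, φ.FreeLt c ∧ ψ.FreeLt c := by
    rintro φ ψ ⟨a, ha⟩ ⟨b, hb⟩
    exact ⟨max a b, ha.mono (le_max_left _ _), hb.mono (le_max_right _ _)⟩
  have twot : ∀ t s : ATerm, ∃ c, t.FreeLt c ∧ s.FreeLt c := by
    intro t s
    obtain ⟨a, ha⟩ := t.exists_freeLt; obtain ⟨b, hb⟩ := s.exists_freeLt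
    exact ⟨max a b, ha.mono (le_max_left _ _), hb.mono (le_max_right _ _)⟩
  induction φ with
  | eq t s => exact twot t s
  | le t s => exact twot t s
  | neg φ ih => exact ih
  | and φ ψ ih1 ih2 => exact two _ _ ih1 ih2
  | or φ ψ ih1 ih2 => exact two _ _ ih1 ih2
  | imp φ ψ ih1 ih2 => exact two _ _ ih1 ih2
  | all φ ih => obtain ⟨c, hc⟩ := ih; exact ⟨c, hc.mono (d := c + 1) (by omega)⟩
  | ex φ ih => obtain ⟨c, hc⟩ := ih; exact ⟨c, hc.mono (d := c + 1) (by omega)⟩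

theorem ATerm.FreeLt.substAll {t : ATerm} {c d : ℕ} (h : t.FreeLt c) {σ : ℕ → ATerm}
    (hs : ∀ n < c, (σ n).FreeLt d) : (t.substAll σ).FreeLt d := by
  induction t <;> simp_all [ATerm.substAll, ATerm.FreeLt]

theorem ATerm.FreeLt.lift0 {t : ATerm} {c : ℕ} (h : t.FreeLt c) : (t.lift 0).FreeLt (c + 1) := by
  rw [ATerm.lift0_eq]
  exact h.substAll (fun n hn => by simpa [ATerm.FreeLt] using hn)

theorem liftSub_freeLt {c d : ℕ} {σ : ℕ → ATerm}
    (hs : ∀ n < c, (σ n).FreeLt d) : ∀ n < c + 1, (liftSub σ n).FreeLt (d + 1) := by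
  intro n hn
  cases n with
  | zero => simp [liftSub, ATerm.FreeLt]
  | succ n => exact (hs n (by omega)).lift0

theorem AFml.FreeLt.substAll {φ : AFml} {c d : ℕ} (h : φ.FreeLt c) {σ : ℕ → ATerm}
    (hs : ∀ n < c, (σ n).FreeLt d) : (φ.substAll σ).FreeLt d := by
  induction φ generalizing c d σ with
  | eq t s => exact ⟨h.1.substAll hs, h.2.substAll hs⟩
  | le t s => exact ⟨h.1.substAll hs, h.2.substAll hs⟩
  | neg φ ih => exact ih (c := c) h hs
  | and φ ψ ih1 ih2 => exact ⟨ih1 h.1 hs, ih2 h.2 hs⟩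
  | or φ ψ ih1 ih2 => exact ⟨ih1 h.1 hs, ih2 h.2 hs⟩
  | imp φ ψ ih1 ih2 => exact ⟨ih1 h.1 hs, ih2 h.2 hs⟩
  | all φ ih => exact ih (c := c + 1) h (liftSub_freeLt hs)
  | ex φ ih => exact ih (c := c + 1) h (liftSub_freeLt hs)

theorem subst0_liftSub (φ : AFml) (σ : ℕ → ATerm) (t : ATerm) :
    (φ.substAll (liftSub σ)).subst0 t = φ.substAll (scons t σ) := by
  rw [AFml.subst0, AFml.substAll_comp]
  congr 1
  funext n
  cases n with
  | zero => rfl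
  | succ n =>
    simp only [liftSub, ATerm.lift0_eq, ATerm.substAll_comp, scons_succ]
    exact ATerm.substAll_var _

theorem ATerm.lift0_subst0 (t s : ATerm) : (t.lift 0).substAll (subst0Env s) = t := by
  rw [ATerm.lift0_eq, ATerm.substAll_comp]
  exact ATerm.substAll_var _

theorem numeral_freeLt (k c : ℕ) : (numeral k).FreeLt c := by
  induction k with
  | zero => trivial
  | succ k ih => exact ih

theorem numeral_substAll (k : ℕ) (σ : ℕ → ATerm) : (numeral k).substAll σ = numeral k := by
  induction k with
  | zero => rfl
  | succ k ih => simp [numeral, ATerm.substAll, ih]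

theorem numeral_lift (k c : ℕ) : (numeral k).lift c = numeral k := by
  rw [ATerm.lift_eq, numeral_substAll]

/-! ### Structures, satisfaction, soundness -/

structure Str (M : Type) where
  zero : M
  succ : M → M
  add : M → M → M
  mul : M → M → M
  le : M → M → Prop

variable {M : Type}

def Str.tval (S : Str M) (ρ : ℕ → M) : ATerm → M
  | .var n => ρ n
  | .zero => S.zero
  | .succ t => S.succ (S.tval ρ t)
  | .add t s => S.add (S.tval ρ t) (S.tval ρ s)
  | .mul t s => S.mul (S.tval ρ t) (S.tval ρ s)

def Str.sat (S : Str M) : (ℕ → M) → AFml → Prop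
  | ρ, .eq t s => S.tval ρ t = S.tval ρ s
  | ρ, .le t s => S.le (S.tval ρ t) (S.tval ρ s)
  | ρ, .neg φ => ¬ S.sat ρ φ
  | ρ, .and φ ψ => S.sat ρ φ ∧ S.sat ρ ψ
  | ρ, .or φ ψ => S.sat ρ φ ∨ S.sat ρ ψ
  | ρ, .imp φ ψ => S.sat ρ φ → S.sat ρ ψ
  | ρ, .all φ => ∀ a, S.sat (scons a ρ) φ
  | ρ, .ex φ => ∃ a, S.sat (scons a ρ) φ

def strN : Str ℕ := ⟨0, Nat.succ, (· + ·), (· * ·), (· ≤ ·)⟩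

theorem strN_tval (ρ : ℕ → ℕ) (t : ATerm) : strN.tval ρ t = t.val ρ := by
  induction t <;> simp_all [Str.tval, ATerm.val, strN]

theorem strN_sat (ρ : ℕ → ℕ) (φ : AFml) : strN.sat ρ φ ↔ φ.Sat ρ := by
  induction φ generalizing ρ <;>
    simp_all [Str.sat, AFml.Sat, strN_tval, consEnv_eq]
  rfl

theorem Str.tval_substAll (S : Str M) (ρ : ℕ → M) (σ : ℕ → ATerm) (t : ATerm) :
    S.tval ρ (t.substAll σ) = S.tval (fun n => S.tval ρ (σ n)) t := by
  induction t <;> simp_all [Str.tval, ATerm.substAll]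

theorem Str.tval_lift0 (S : Str M) (ρ : ℕ → M) (a : M) (t : ATerm) :
    S.tval (scons a ρ) (t.lift 0) = S.tval ρ t := by
  rw [ATerm.lift0_eq, S.tval_substAll]; rfl

theorem Str.scons_tval (S : Str M) (ρ : ℕ → M) (a : M) (σ : ℕ → ATerm) :
    (fun n => S.tval (scons a ρ) (liftSub σ n)) = scons a (fun n => S.tval ρ (σ n)) := by
  funext n
  cases n with
  | zero => rfl
  | succ n => simp [liftSub, S.tval_lift0]

theorem Str.sat_substAll (S : Str M) (φ : AFml) (ρ : ℕ → M) (σ : ℕ → ATerm) :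
    S.sat ρ (φ.substAll σ) ↔ S.sat (fun n => S.tval ρ (σ n)) φ := by
  induction φ generalizing ρ σ <;>
    simp_all [Str.sat, AFml.substAll, Str.tval_substAll, Str.scons_tval]

theorem Str.sat_subst0 (S : Str M) (φ : AFml) (ρ : ℕ → M) (t : ATerm) :
    S.sat ρ (φ.subst0 t) ↔ S.sat (scons (S.tval ρ t) ρ) φ := by
  rw [AFml.subst0, S.sat_substAll]
  have : (fun n => S.tval ρ (subst0Env t n)) = scons (S.tval ρ t) ρ := by
    funext n; cases n <;> rfl
  rw [this]

theorem Str.sat_lift0 (S : Str M) (φ : AFml) (ρ : ℕ → M) (a : M) :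
    S.sat (scons a ρ) (φ.lift 0) ↔ S.sat ρ φ := by
  rw [AFml.lift0_eq, S.sat_substAll]; rfl

theorem Str.tval_congr (S : Str M) {t : ATerm} {c : ℕ} (h : t.FreeLt c) {ρ ρ' : ℕ → M}
    (hr : ∀ n < c, ρ n = ρ' n) : S.tval ρ t = S.tval ρ' t := by
  induction t <;> simp_all [Str.tval, ATerm.FreeLt]

theorem scons_congr {c : ℕ} {ρ ρ' : ℕ → M} (a : M)
    (hr : ∀ n < c, ρ n = ρ' n) : ∀ n < c + 1, scons a ρ n = scons a ρ' n := by
  intro n hn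
  cases n with
  | zero => rfl
  | succ n => exact hr n (by omega)

theorem Str.sat_congr (S : Str M) {φ : AFml} {c : ℕ} (h : φ.FreeLt c) {ρ ρ' : ℕ → M}
    (hr : ∀ n < c, ρ n = ρ' n) : S.sat ρ φ ↔ S.sat ρ' φ := by
  induction φ generalizing c ρ ρ' with
  | eq t s => simp [Str.sat, S.tval_congr h.1 hr, S.tval_congr h.2 hr]
  | le t s => simp [Str.sat, S.tval_congr h.1 hr, S.tval_congr h.2 hr]
  | neg φ ih => simp [Str.sat, ih h hr]
  | and φ ψ ih1 ih2 => simp [Str.sat, ih1 h.1 hr, ih2 h.2 hr]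
  | or φ ψ ih1 ih2 => simp [Str.sat, ih1 h.1 hr, ih2 h.2 hr]
  | imp φ ψ ih1 ih2 => simp [Str.sat, ih1 h.1 hr, ih2 h.2 hr]
  | all φ ih => exact forall_congr' fun a => ih h (scons_congr a hr)
  | ex φ ih => exact exists_congr fun a => ih h (scons_congr a hr)

theorem Str.evalProp_sat (S : Str M) (ρ : ℕ → M) (φ : AFml) :
    φ.evalProp (S.sat ρ) ↔ S.sat ρ φ := by
  induction φ <;> simp_all [Str.sat, AFml.evalProp]

theorem Proves.sound {Γ : Set AFml} {φ : AFml} (h : Proves Γ φ) (S : Str M)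
    (hS : ∀ ψ ∈ Γ, ∀ ρ, S.sat ρ ψ) : ∀ ρ, S.sat ρ φ := by
  induction h with
  | ax h => exact hS _ h
  | taut h => intro ρ; exact (S.evalProp_sat ρ _).1 (h _)
  | mp _ _ ih1 ih2 => intro ρ; exact ih1 ρ (ih2 ρ)
  | allE φ t => intro ρ h; rw [S.sat_subst0]; exact h _
  | exI φ t => intro ρ h; rw [S.sat_subst0] at h; exact ⟨_, h⟩
  | allImp φ ψ => intro ρ h1 h2 a; exact h1 a (h2 a)
  | vacAll φ => intro ρ h a; rw [S.sat_lift0]; exact h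
  | exDef φ =>
    intro ρ
    simp only [iffF, Str.sat, not_forall, not_not, imp_self, and_self]
  | gen _ ih => intro ρ a; exact ih _
  | eqRefl t => intro ρ; rfl
  | eqSubst φ t s =>
    intro ρ h1 h2
    rw [S.sat_subst0] at *
    have h1 : S.tval ρ t = S.tval ρ s := h1
    rwa [← h1]



/-! ### Codes are injective -/

theorem ATerm.code_injective : Function.Injective ATerm.code := by
  intro t
  induction t with
  | var n => intro s h; cases s <;> simp_all [ATerm.code, Nat.pair_eq_pair]
  | zero => intro s h; cases s <;> simp_all [ATerm.code, Nat.pair_eq_pair]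
  | succ t ih => intro s h; cases s <;> simp [ATerm.code, Nat.pair_eq_pair] at h ⊢; exact ih h
  | add t s ih1 ih2 =>
    intro s h
    cases s <;> simp [ATerm.code, Nat.pair_eq_pair] at h ⊢
    exact ⟨ih1 h.1, ih2 h.2⟩
  | mul t s ih1 ih2 =>
    intro s h
    cases s <;> simp [ATerm.code, Nat.pair_eq_pair] at h ⊢
    exact ⟨ih1 h.1, ih2 h.2⟩

theorem AFml.code_injective : Function.Injective AFml.code := by
  intro t
  induction t with
  | eq t s =>
    intro s h
    cases s <;> simp [AFml.code, Nat.pair_eq_pair] at h ⊢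
    exact ⟨ATerm.code_injective h.1, ATerm.code_injective h.2⟩
  | le t s =>
    intro s h
    cases s <;> simp [AFml.code, Nat.pair_eq_pair] at h ⊢
    exact ⟨ATerm.code_injective h.1, ATerm.code_injective h.2⟩
  | neg t ih => intro s h; cases s <;> simp [AFml.code, Nat.pair_eq_pair] at h ⊢; exact ih h
  | all t ih => intro s h; cases s <;> simp [AFml.code, Nat.pair_eq_pair] at h ⊢; exact ih h
  | ex t ih => intro s h; cases s <;> simp [AFml.code, Nat.pair_eq_pair] at h ⊢; exact ih h
  | and t s ih1 ih2 =>
    intro s h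
    cases s <;> simp [AFml.code, Nat.pair_eq_pair] at h ⊢
    exact ⟨ih1 h.1, ih2 h.2⟩
  | or t s ih1 ih2 =>
    intro s h
    cases s <;> simp [AFml.code, Nat.pair_eq_pair] at h ⊢
    exact ⟨ih1 h.1, ih2 h.2⟩
  | imp t s ih1 ih2 =>
    intro s h
    cases s <;> simp [AFml.code, Nat.pair_eq_pair] at h ⊢
    exact ⟨ih1 h.1, ih2 h.2⟩

/-! ### Derived rules -/

variable {Γ : Set AFml}

theorem Proves.tc1 {a b : AFml} (h : Proves Γ a)
    (ht : ∀ v, a.evalProp v → b.evalProp v) : Proves Γ b :=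
  .mp (.taut (φ := .imp a b) ht) h

theorem Proves.tc2 {a b c : AFml} (ha : Proves Γ a) (hb : Proves Γ b)
    (ht : ∀ v, a.evalProp v → b.evalProp v → c.evalProp v) : Proves Γ c :=
  .mp (.mp (.taut (φ := .imp a (.imp b c)) ht) ha) hb

theorem Proves.tc3 {a b c d : AFml} (ha : Proves Γ a) (hb : Proves Γ b) (hc : Proves Γ c)
    (ht : ∀ v, a.evalProp v → b.evalProp v → c.evalProp v → d.evalProp v) : Proves Γ d :=
  .mp (.mp (.mp (.taut (φ := .imp a (.imp b (.imp c d))) ht) ha) hb) hc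

theorem Proves.subst0 {φ : AFml} (h : Proves Γ φ) (t : ATerm) : Proves Γ (φ.subst0 t) :=
  .mp (.allE φ t) (.gen h)

def ATerm.shift (k : ℕ) (t : ATerm) : ATerm := t.substAll (fun n => .var (n + k))

theorem Proves.substAll {φ : AFml} (h : Proves Γ φ) (σ : ℕ → ATerm) :
    Proves Γ (φ.substAll σ) := by
  obtain ⟨N, hN⟩ := φ.exists_freeLt
  have key : ∀ k, k ≤ N → Proves Γ (φ.substAll
      (fun n => if n < k then (σ n).shift (N - k) else .var (n - k))) := by
    intro k
    induction k with
    | zero =>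
      intro _
      have : (fun n => if n < 0 then (σ n).shift (N - 0) else .var (n - 0)) = ATerm.var := by
        funext n; simp
      rw [this, AFml.substAll_var]; exact h
    | succ k ih =>
      intro hk
      have h1 := (ih (by omega)).subst0 ((σ k).shift (N - (k + 1)))
      rw [AFml.subst0, AFml.substAll_comp] at h1
      convert h1 using 2
      funext n
      rcases lt_trichotomy n k with hn | hn | hn
      · rw [if_pos (by omega), if_pos hn]
        simp only [ATerm.shift, ATerm.substAll_comp]
        congr 1
        funext j
        simp only [ATerm.substAll]
        rw [show j + (N - k) = (j + (N - (k + 1))) + 1 by omega]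
        rfl
      · subst hn
        simp [ATerm.substAll, subst0Env]
      · rw [if_neg (by omega), if_neg (by omega)]
        simp only [ATerm.substAll]
        rw [show n - k = (n - (k + 1)) + 1 by omega]
        rfl
  have h1 := key N le_rfl
  rwa [AFml.substAll_congr hN (τ := σ)] at h1
  intro n hn
  simp only [hn, if_true, Nat.sub_self, ATerm.shift]
  exact ATerm.substAll_var _

/-! ### Completeness -/

def Con (Γ : Set AFml) (θ : AFml) : Prop := ¬ Proves Γ (.neg θ)

theorem con_henkin {θ χ : AFml} {c : ℕ} (hθ : θ.FreeLt c) (hχ : (AFml.ex χ).FreeLt c)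
    (h : Con Γ (.and θ (.ex χ))) : Con Γ (.and (.and θ (.ex χ)) (χ.subst0 (.var c))) := by
  intro hp
  apply h
  have h1 : Proves Γ (.imp (.and θ (.ex χ)) (.neg (χ.subst0 (.var c)))) :=
    hp.tc1 (fun v => by simp only [AFml.evalProp]; tauto)
  have h2 := h1.substAll (fun n => if n = c then .var 0 else .var (n + 1))
  have e1 : ((AFml.and θ (.ex χ)).substAll (fun n => if n = c then .var 0 else .var (n + 1)))
      = (AFml.and θ (.ex χ)).lift 0 := by
    rw [AFml.lift0_eq]
    refine AFml.substAll_congr (φ := .and θ (.ex χ)) (c := c) ⟨hθ, hχ⟩ ?_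
    intro n hn
    rw [if_neg (by omega)]
  have e2 : ((χ.subst0 (.var c)).substAll (fun n => if n = c then .var 0 else .var (n + 1)))
      = χ := by
    rw [AFml.subst0, AFml.substAll_comp]
    conv_rhs => rw [← χ.substAll_var]
    refine AFml.substAll_congr (c := c + 1) hχ ?_
    intro n hn
    cases n with
    | zero => simp [subst0Env, ATerm.substAll]
    | succ n =>
      simp only [subst0Env, ATerm.substAll]
      rw [if_neg (by omega)]
  have h3 : Proves Γ (.imp ((AFml.and θ (.ex χ)).lift 0) (.neg χ)) := by
    rw [← e1]
    have : ((AFml.and θ (.ex χ)).imp (.neg (χ.subst0 (.var c)))).substAll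
      (fun n => if n = c then .var 0 else .var (n + 1)) = .imp ((AFml.and θ (.ex χ)).substAll
      (fun n => if n = c then .var 0 else .var (n + 1))) (.neg χ) := by
      rw [show AFml.neg χ = AFml.neg ((χ.subst0 (.var c)).substAll
        (fun n => if n = c then .var 0 else .var (n + 1))) by rw [e2]]
      rfl
    rwa [this] at h2
  have h4 := Proves.mp (Proves.allImp _ _) h3.gen
  have h5 := Proves.vacAll (Γ := Γ) (AFml.and θ (.ex χ))
  refine Proves.tc3 h4 h5 (Proves.exDef χ) (fun v => ?_)
  simp only [AFml.evalProp, iffF]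
  tauto

open Classical in
noncomputable def enumF (k : ℕ) : AFml :=
  if h : ∃ φ : AFml, φ.code = k then h.choose else botFml

theorem enumF_code (φ : AFml) : enumF φ.code = φ := by
  have h : ∃ ψ : AFml, ψ.code = φ.code := ⟨φ, rfl⟩
  rw [enumF, dif_pos h]
  exact AFml.code_injective h.choose_spec

noncomputable def freshOf (φ : AFml) : ℕ := φ.exists_freeLt.choose

theorem freshOf_spec (φ : AFml) : φ.FreeLt (freshOf φ) := φ.exists_freeLt.choose_spec

open Classical in
noncomputable def henStep (Γ : Set AFml) (θ ψ : AFml) : AFml :=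
  if Con Γ (.and θ ψ) then
    match ψ with
    | .ex χ => .and (.and θ (.ex χ)) (χ.subst0 (.var (freshOf (.and θ (.ex χ)))))
    | ψ => .and θ ψ
  else θ

noncomputable def henSeq (Γ : Set AFml) (θ₀ : AFml) : ℕ → AFml
  | 0 => θ₀
  | k + 1 => henStep Γ (henSeq Γ θ₀ k) (enumF k)

theorem henStep_con {θ ψ : AFml} (h : Con Γ θ) : Con Γ (henStep Γ θ ψ) := by
  unfold henStep
  split_ifs with h1
  · split
    · have h2 := freshOf_spec (.and θ (.ex ‹AFml›))
      exact con_henkin h2.1 h2.2 h1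
    · exact h1
  · exact h

theorem henStep_imp (Γ : Set AFml) (θ ψ : AFml) : Proves Γ (.imp (henStep Γ θ ψ) θ) := by
  apply Proves.taut
  intro v
  unfold henStep
  split_ifs with h1
  · split <;> simp only [AFml.evalProp] <;> tauto
  · simp only [AFml.evalProp]; tauto

theorem henStep_pos {θ ψ : AFml} (h : Con Γ (.and θ ψ)) :
    Proves Γ (.imp (henStep Γ θ ψ) ψ) := by
  apply Proves.taut
  intro v
  unfold henStep
  rw [if_pos h]
  split <;> simp only [AFml.evalProp] <;> tauto

theorem henStep_ex {θ χ : AFml} (h : Con Γ (.and θ (.ex χ))) :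
    ∃ c, Proves Γ (.imp (henStep Γ θ (.ex χ)) (χ.subst0 (.var c))) := by
  refine ⟨freshOf (.and θ (.ex χ)), Proves.taut (fun v => ?_)⟩
  unfold henStep
  rw [if_pos h]
  simp only [AFml.evalProp]; tauto

theorem henSeq_con {θ : AFml} (h : Con Γ θ) (k : ℕ) : Con Γ (henSeq Γ θ k) := by
  induction k with
  | zero => exact h
  | succ k ih => exact henStep_con ih

theorem henSeq_imp (θ : AFml) (k j : ℕ) :
    Proves Γ (.imp (henSeq Γ θ (k + j)) (henSeq Γ θ k)) := by
  induction j with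
  | zero => exact .taut (fun v => by simp only [AFml.evalProp]; tauto)
  | succ j ih =>
    exact Proves.tc2 ih (henStep_imp Γ (henSeq Γ θ (k + j)) (enumF (k + j)))
      (fun v => by simp only [AFml.evalProp]; exact fun a b c => a (b c))

def Hen (Γ : Set AFml) (θ : AFml) : Set AFml := {ψ | ∃ k, Proves Γ (.imp (henSeq Γ θ k) ψ)}

theorem Hen.mono {θ ψ : AFml} {k j : ℕ} (h : Proves Γ (.imp (henSeq Γ θ k) ψ)) (hk : k ≤ j) :
    Proves Γ (.imp (henSeq Γ θ j) ψ) := by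
  obtain ⟨i, rfl⟩ := Nat.exists_eq_add_of_le hk
  exact Proves.tc2 (henSeq_imp θ k i) h (fun v => by simp only [AFml.evalProp]; tauto)

theorem Hen.of {θ ψ : AFml} (h : Proves Γ ψ) : ψ ∈ Hen Γ θ :=
  ⟨0, h.tc1 (fun v => by simp only [AFml.evalProp]; tauto)⟩

theorem Hen.mp {θ a b : AFml} (h1 : AFml.imp a b ∈ Hen Γ θ) (h2 : a ∈ Hen Γ θ) :
    b ∈ Hen Γ θ := by
  obtain ⟨k, hk⟩ := h1; obtain ⟨j, hj⟩ := h2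
  exact ⟨max k j, Proves.tc2 (Hen.mono hk (le_max_left _ _)) (Hen.mono hj (le_max_right _ _))
    (fun v => by simp only [AFml.evalProp]; tauto)⟩

theorem Hen.mp' {θ a b : AFml} (h1 : Proves Γ (.imp a b)) (h2 : a ∈ Hen Γ θ) :
    b ∈ Hen Γ θ := Hen.mp (Hen.of h1) h2

theorem Hen.not_both {θ a : AFml} (hθ : Con Γ θ) (h2 : a ∈ Hen Γ θ) (h1 : AFml.neg a ∈ Hen Γ θ) :
    False := by
  obtain ⟨k, hk⟩ := h1; obtain ⟨j, hj⟩ := h2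
  apply henSeq_con hθ (max k j)
  exact Proves.tc2 (Hen.mono hk (le_max_left _ _)) (Hen.mono hj (le_max_right _ _))
    (fun v => by simp only [AFml.evalProp]; tauto)

theorem Hen.complete (θ a : AFml) : a ∈ Hen Γ θ ∨ AFml.neg a ∈ Hen Γ θ := by
  by_cases h : Con Γ (.and (henSeq Γ θ a.code) a)
  · left
    refine ⟨a.code + 1, ?_⟩
    rw [henSeq, enumF_code]
    exact henStep_pos h
  · right
    refine ⟨a.code, ?_⟩
    have h := not_not.1 h
    exact h.tc1 (fun v => by simp only [AFml.evalProp]; tauto)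

theorem Hen.neg_iff {θ : AFml} (hθ : Con Γ θ) (a : AFml) :
    AFml.neg a ∈ Hen Γ θ ↔ a ∉ Hen Γ θ :=
  ⟨fun h1 h2 => Hen.not_both hθ h2 h1, fun h => (Hen.complete θ a).resolve_left h⟩

theorem Hen.henkin {θ χ : AFml} (hθ : Con Γ θ) (h : AFml.ex χ ∈ Hen Γ θ) :
    ∃ c, χ.subst0 (.var c) ∈ Hen Γ θ := by
  have hc : Con Γ (.and (henSeq Γ θ (AFml.ex χ).code) (.ex χ)) := by
    intro hp
    refine Hen.not_both hθ h ⟨(AFml.ex χ).code, ?_⟩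
    exact hp.tc1 (fun v => by simp only [AFml.evalProp]; tauto)
  obtain ⟨c, h1⟩ := henStep_ex hc
  refine ⟨c, (AFml.ex χ).code + 1, ?_⟩
  rw [henSeq, enumF_code]
  exact h1

section model
variable {θ : AFml}

theorem Hen.eq_symm {t s : ATerm} (h : AFml.eq t s ∈ Hen Γ θ) : AFml.eq s t ∈ Hen Γ θ := by
  have h1 := Proves.eqSubst (Γ := Γ) (.eq (.var 0) (t.lift 0)) t s
  simp only [AFml.subst0, AFml.substAll, ATerm.lift0_subst0] at h1
  exact Hen.mp (Hen.mp' h1 h) (Hen.of (.eqRefl t))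

theorem Hen.eq_trans {t s r : ATerm} (h : AFml.eq t s ∈ Hen Γ θ) (h' : AFml.eq s r ∈ Hen Γ θ) :
    AFml.eq t r ∈ Hen Γ θ := by
  have h1 := Proves.eqSubst (Γ := Γ) (.eq (t.lift 0) (.var 0)) s r
  simp only [AFml.subst0, AFml.substAll, ATerm.lift0_subst0] at h1
  exact Hen.mp (Hen.mp' h1 h') h

/-- A term context, given by substituting into variable 0, respects equality. -/
theorem Hen.eq_ctx {t s : ATerm} (u : ATerm) (h : AFml.eq t s ∈ Hen Γ θ) :
    AFml.eq (u.substAll (subst0Env t)) (u.substAll (subst0Env s)) ∈ Hen Γ θ := by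
  have h1 := Proves.eqSubst (Γ := Γ) (.eq ((u.substAll (subst0Env t)).lift 0) u) t s
  simp only [AFml.subst0, AFml.substAll, ATerm.lift0_subst0] at h1
  exact Hen.mp (Hen.mp' h1 h) (Hen.of (.eqRefl _))

theorem Hen.le_ctx {t s t' s' : ATerm} (h : AFml.eq t s ∈ Hen Γ θ) (h' : AFml.eq t' s' ∈ Hen Γ θ)
    (hl : AFml.le t t' ∈ Hen Γ θ) : AFml.le s s' ∈ Hen Γ θ := by
  have h1 := Proves.eqSubst (Γ := Γ) (.le (.var 0) (t'.lift 0)) t s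
  simp only [AFml.subst0, AFml.substAll, ATerm.lift0_subst0] at h1
  have h2 := Proves.eqSubst (Γ := Γ) (.le (s.lift 0) (.var 0)) t' s'
  simp only [AFml.subst0, AFml.substAll, ATerm.lift0_subst0] at h2
  exact Hen.mp (Hen.mp' h2 h') (Hen.mp (Hen.mp' h1 h) hl)

def henSetoid (Γ : Set AFml) (θ : AFml) : Setoid ATerm where
  r t s := AFml.eq t s ∈ Hen Γ θ
  iseqv := ⟨fun t => Hen.of (.eqRefl t), Hen.eq_symm, Hen.eq_trans⟩

def HenM (Γ : Set AFml) (θ : AFml) : Type := Quotient (henSetoid Γ θ)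

theorem Hen.add_congr {a b c d : ATerm} (h : AFml.eq a b ∈ Hen Γ θ) (h' : AFml.eq c d ∈ Hen Γ θ) :
    AFml.eq (.add a c) (.add b d) ∈ Hen Γ θ := by
  have h1 := Hen.eq_ctx (.add (.var 0) (c.lift 0)) h
  have h2 := Hen.eq_ctx (.add (b.lift 0) (.var 0)) h'
  simp only [ATerm.substAll, ATerm.lift0_subst0] at h1 h2
  exact Hen.eq_trans h1 h2

theorem Hen.mul_congr {a b c d : ATerm} (h : AFml.eq a b ∈ Hen Γ θ) (h' : AFml.eq c d ∈ Hen Γ θ) :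
    AFml.eq (.mul a c) (.mul b d) ∈ Hen Γ θ := by
  have h1 := Hen.eq_ctx (.mul (.var 0) (c.lift 0)) h
  have h2 := Hen.eq_ctx (.mul (b.lift 0) (.var 0)) h'
  simp only [ATerm.substAll, ATerm.lift0_subst0] at h1 h2
  exact Hen.eq_trans h1 h2

def henStr (Γ : Set AFml) (θ : AFml) : Str (HenM Γ θ) where
  zero := Quotient.mk (henSetoid Γ θ) .zero
  succ := Quotient.map (sa := henSetoid Γ θ) (sb := henSetoid Γ θ) ATerm.succ
    (fun _ _ h => Hen.eq_ctx (.succ (.var 0)) h)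
  add := Quotient.map₂ (sa := henSetoid Γ θ) (sb := henSetoid Γ θ) (sc := henSetoid Γ θ)
    ATerm.add (fun _ _ h _ _ h' => Hen.add_congr h h')
  mul := Quotient.map₂ (sa := henSetoid Γ θ) (sb := henSetoid Γ θ) (sc := henSetoid Γ θ)
    ATerm.mul (fun _ _ h _ _ h' => Hen.mul_congr h h')
  le := Quotient.lift₂ (s₁ := henSetoid Γ θ) (s₂ := henSetoid Γ θ)
    (fun t s => AFml.le t s ∈ Hen Γ θ) (fun _ _ _ _ h h' => propext
      ⟨Hen.le_ctx h h', Hen.le_ctx (Hen.eq_symm h) (Hen.eq_symm h')⟩)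

def hmk (Γ : Set AFml) (θ : AFml) (t : ATerm) : HenM Γ θ := Quotient.mk (henSetoid Γ θ) t

theorem hen_tval (σ : ℕ → ATerm) (t : ATerm) :
    (henStr Γ θ).tval (fun n => hmk Γ θ (σ n)) t = hmk Γ θ (t.substAll σ) := by
  induction t with
  | var n => rfl
  | zero => rfl
  | succ t ih => simp only [Str.tval, ih]; rfl
  | add t s ih1 ih2 => simp only [Str.tval, ih1, ih2]; rfl
  | mul t s ih1 ih2 => simp only [Str.tval, ih1, ih2]; rfl

theorem hmk_scons (σ : ℕ → ATerm) (t : ATerm) :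
    scons (hmk Γ θ t) (fun n => hmk Γ θ (σ n)) = fun n => hmk Γ θ (scons t σ n) := by
  funext n; cases n <;> rfl

theorem hmk_surj (a : HenM Γ θ) : ∃ t, hmk Γ θ t = a := Quotient.exists_rep a

theorem hen_sat (hθ : Con Γ θ) (φ : AFml) (σ : ℕ → ATerm) :
    (henStr Γ θ).sat (fun n => hmk Γ θ (σ n)) φ ↔ φ.substAll σ ∈ Hen Γ θ := by
  have hn := Hen.neg_iff hθ
  induction φ generalizing σ with
  | eq t s =>
    simp only [Str.sat, hen_tval, AFml.substAll]
    exact Quotient.eq (r := henSetoid Γ θ)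
  | le t s =>
    simp only [Str.sat, hen_tval, AFml.substAll]
    exact Iff.rfl
  | neg φ ih => simp only [Str.sat, ih, AFml.substAll, hn]
  | and φ ψ ih1 ih2 =>
    simp only [Str.sat, ih1, ih2, AFml.substAll]
    constructor
    · rintro ⟨h1, h2⟩
      exact Hen.mp (Hen.mp' (.taut (fun v => by simp only [AFml.evalProp]; exact fun a b => ⟨a, b⟩)) h1) h2
    · intro h
      exact ⟨Hen.mp' (.taut (fun v => by simp only [AFml.evalProp]; tauto)) h,
        Hen.mp' (.taut (fun v => by simp only [AFml.evalProp]; tauto)) h⟩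
  | or φ ψ ih1 ih2 =>
    simp only [Str.sat, ih1, ih2, AFml.substAll]
    constructor
    · rintro (h1 | h1)
      · exact Hen.mp' (.taut (fun v => by simp only [AFml.evalProp]; tauto)) h1
      · exact Hen.mp' (.taut (fun v => by simp only [AFml.evalProp]; tauto)) h1
    · intro h
      by_contra hc
      push Not at hc
      have h1 := (hn _).2 hc.1
      refine hc.2 (Hen.mp (Hen.mp' (.taut (fun v => ?_)) h) h1)
      simp only [AFml.evalProp]; tauto
  | imp φ ψ ih1 ih2 =>
    simp only [Str.sat, ih1, ih2, AFml.substAll]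
    constructor
    · intro h
      by_cases h1 : φ.substAll σ ∈ Hen Γ θ
      · exact Hen.mp' (.taut (fun v => by simp only [AFml.evalProp]; tauto)) (h h1)
      · exact Hen.mp' (.taut (fun v => by simp only [AFml.evalProp]; tauto)) ((hn _).2 h1)
    · exact fun h h1 => Hen.mp h h1
  | all φ ih' =>
    have ih : ∀ σ : ℕ → ATerm, (henStr Γ θ).sat (fun n => hmk Γ θ (σ n)) φ ↔
      φ.substAll σ ∈ Hen Γ θ := fun σ => ih' σ
    simp only [Str.sat, AFml.substAll]
    constructor
    · intro h
      by_contra hc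
      have h1 := (hn _).2 hc
      have h2 : AFml.ex (.neg (φ.substAll (liftSub σ))) ∈ Hen Γ θ := by
        refine Hen.mp' ?_ h1
        have h3 : Proves Γ (.imp (.all (.neg (.neg (φ.substAll (liftSub σ)))))
            (.all (φ.substAll (liftSub σ)))) :=
          .mp (.allImp _ _) (.gen (.taut (fun v => by simp only [AFml.evalProp]; tauto)))
        exact Proves.tc2 h3 (.exDef (.neg (φ.substAll (liftSub σ))))
          (fun v => by simp only [AFml.evalProp, iffF]; tauto)
      obtain ⟨c, h3⟩ := Hen.henkin hθ h2
      have h4 : AFml.neg ((φ.substAll (liftSub σ)).subst0 (.var c)) ∈ Hen Γ θ := h3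
      rw [hn, subst0_liftSub, ← ih (scons (.var c) σ), ← hmk_scons] at h4
      exact h4 (h _)
    · intro h a
      obtain ⟨t, rfl⟩ := hmk_surj a
      rw [hmk_scons, ih (scons t σ), ← subst0_liftSub]
      exact Hen.mp' (.allE _ _) h
  | ex φ ih' =>
    have ih : ∀ σ : ℕ → ATerm, (henStr Γ θ).sat (fun n => hmk Γ θ (σ n)) φ ↔
      φ.substAll σ ∈ Hen Γ θ := fun σ => ih' σ
    simp only [Str.sat, AFml.substAll]
    constructor
    · rintro ⟨a, h⟩
      obtain ⟨t, rfl⟩ := hmk_surj a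
      rw [hmk_scons, ih (scons t σ), ← subst0_liftSub] at h
      exact Hen.mp' (.exI _ _) h
    · intro h
      obtain ⟨c, h3⟩ := Hen.henkin hθ h
      refine ⟨hmk Γ θ (.var c), ?_⟩
      rw [hmk_scons, ih (scons (.var c) σ), ← subst0_liftSub]
      exact h3

end model

/-- Completeness theorem. -/
theorem completeness {φ : AFml}
    (h : ∀ (M : Type) (S : Str M), (∀ ψ ∈ Γ, ∀ ρ, S.sat ρ ψ) → ∀ ρ, S.sat ρ φ) :
    Proves Γ φ := by
  by_contra hc
  have hθ : Con Γ (.neg φ) := fun h => hc (h.tc1 (fun v => by simp only [AFml.evalProp]; tauto))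
  have h1 := h _ (henStr Γ (.neg φ)) (fun ψ hψ ρ => by
    have : ∃ σ : ℕ → ATerm, ρ = fun n => hmk Γ (.neg φ) (σ n) := by
      choose σ hσ using fun n => hmk_surj (ρ n)
      exact ⟨σ, funext fun n => (hσ n).symm⟩
    obtain ⟨σ, rfl⟩ := this
    rw [hen_sat hθ]
    exact Hen.of ((Proves.ax hψ).substAll σ)) (fun n => hmk Γ (.neg φ) (.var n))
  rw [hen_sat hθ, AFml.substAll_var] at h1
  exact Hen.not_both hθ h1 ⟨0, .taut (fun v => by simp only [henSeq, AFml.evalProp]; tauto)⟩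

theorem Proves.mono {Γ Γ' : Set AFml} (h : Γ ⊆ Γ') {φ : AFml} (hp : Proves Γ φ) :
    Proves Γ' φ := by
  induction hp with
  | ax h1 => exact .ax (h h1)
  | taut h1 => exact .taut h1
  | mp _ _ ih1 ih2 => exact .mp ih1 ih2
  | allE φ t => exact .allE φ t
  | exI φ t => exact .exI φ t
  | allImp φ ψ => exact .allImp φ ψ
  | vacAll φ => exact .vacAll φ
  | exDef φ => exact .exDef φ
  | gen _ ih => exact .gen ih
  | eqRefl t => exact .eqRefl t
  | eqSubst φ t s => exact .eqSubst φ t s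



variable {M : Type}

/-! ### Models of PA -/

def Str.num (S : Str M) : ℕ → M
  | 0 => S.zero
  | k + 1 => S.succ (S.num k)

theorem Str.tval_numeral (S : Str M) (ρ : ℕ → M) (k : ℕ) : S.tval ρ (numeral k) = S.num k := by
  induction k with
  | zero => rfl
  | succ k ih => simp [numeral, Str.tval, Str.num, ih]

def Str.IsPA (S : Str M) : Prop := ∀ ψ ∈ PA, ∀ ρ, S.sat ρ ψ

theorem strN_num (k : ℕ) : strN.num k = k := by
  induction k with
  | zero => rfl
  | succ k ih => simp only [Str.num, ih]; rfl

theorem Str.sat_succSubst (S : Str M) (φ : AFml) (ρ : ℕ → M) (a : M) :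
    S.sat (scons a ρ) (succSubst φ) ↔ S.sat (scons (S.succ a) ρ) φ := by
  rw [succSubst, S.sat_substAll]
  have : (fun n => S.tval (scons a ρ) (if n = 0 then .succ (.var 0) else .var n)) =
      scons (S.succ a) ρ := by
    funext n; cases n <;> simp [Str.tval]
  rw [this]

theorem strN_isPA : strN.IsPA := by
  intro ψ hψ ρ
  have hψ : PAax ψ := hψ
  cases hψ with
  | succNeZero => intro a; simp [Str.sat, Str.tval, strN]
  | succInj => intro a b; simp [Str.sat, Str.tval, strN]
  | addZero => intro a; simp [Str.sat, Str.tval, strN]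
  | addSucc => intro a b; simp [Str.sat, Str.tval, strN]; omega
  | mulZero => intro a; simp [Str.sat, Str.tval, strN]
  | mulSucc => intro a b; simp [Str.sat, Str.tval, strN]; ring
  | leDef =>
    intro a b
    simp only [iffF, Str.sat, Str.tval, strN, scons]
    constructor
    · intro h; exact ⟨b - a, by omega⟩
    · rintro ⟨z, hz⟩; omega
  | ind φ =>
    rintro ⟨h0, h1⟩ a
    rw [strN.sat_subst0] at h0
    induction a with
    | zero => exact h0
    | succ a ih => exact (strN.sat_succSubst φ ρ a).1 (h1 a ih)

theorem num_scons {S : Str M} (_ : S.IsPA) (ρ : ℕ → ℕ) (a : ℕ) :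
    scons (S.num a) (fun n => S.num (ρ n)) = fun n => S.num (scons a ρ n) := by
  funext n; cases n <;> rfl

section pa
variable {S : Str M} (hS : S.IsPA)
include hS

theorem Str.IsPA.succ_ne_zero (a : M) : S.succ a ≠ S.zero :=
  (hS _ PAax.succNeZero (fun _ => S.zero)) a

theorem Str.IsPA.succ_inj {a b : M} (h : S.succ a = S.succ b) : a = b :=
  (hS _ PAax.succInj (fun _ => S.zero)) a b h

theorem Str.IsPA.add_zero (a : M) : S.add a S.zero = a :=
  (hS _ PAax.addZero (fun _ => S.zero)) a

theorem Str.IsPA.add_succ (a b : M) : S.add a (S.succ b) = S.succ (S.add a b) :=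
  (hS _ PAax.addSucc (fun _ => S.zero)) a b

theorem Str.IsPA.mul_zero (a : M) : S.mul a S.zero = S.zero :=
  (hS _ PAax.mulZero (fun _ => S.zero)) a

theorem Str.IsPA.mul_succ (a b : M) : S.mul a (S.succ b) = S.add (S.mul a b) a :=
  (hS _ PAax.mulSucc (fun _ => S.zero)) a b

theorem Str.IsPA.le_iff (a b : M) : S.le a b ↔ ∃ z, S.add z a = b := by
  have := (hS _ PAax.leDef (fun _ => S.zero)) a b
  exact ⟨this.1, this.2⟩

theorem Str.IsPA.zero_or_succ (a : M) : a = S.zero ∨ ∃ b, a = S.succ b := by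
  have h := hS _ (PAax.ind (.or (.eq (.var 0) .zero) (.ex (.eq (.var 1) (.succ (.var 0))))))
    (fun _ => S.zero)
  refine h ⟨?_, ?_⟩ a
  · rw [S.sat_subst0]; left; rfl
  · intro b _
    rw [S.sat_succSubst]
    right
    exact ⟨b, rfl⟩

theorem Str.IsPA.num_inj {j k : ℕ} (h : S.num j = S.num k) : j = k := by
  induction j generalizing k with
  | zero =>
    cases k with
    | zero => rfl
    | succ k => exact absurd h.symm (hS.succ_ne_zero _)
  | succ j ih =>
    cases k with
    | zero => exact absurd h (hS.succ_ne_zero _)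
    | succ k => rw [ih (hS.succ_inj h)]

theorem Str.IsPA.add_num (z : M) (j k : ℕ) :
    S.add z (S.num (j + k)) = S.add (S.add z (S.num j)) (S.num k) := by
  induction k with
  | zero => rw [Nat.add_zero]; exact (hS.add_zero _).symm
  | succ k ih => rw [← Nat.add_assoc]; simp only [Str.num, hS.add_succ, ih]

theorem Str.IsPA.num_add (j k : ℕ) : S.add (S.num j) (S.num k) = S.num (j + k) := by
  induction k with
  | zero => exact hS.add_zero _
  | succ k ih => rw [← Nat.add_assoc]; simp only [Str.num, hS.add_succ, ih]

theorem Str.IsPA.num_mul (j k : ℕ) : S.mul (S.num j) (S.num k) = S.num (j * k) := by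
  induction k with
  | zero => exact hS.mul_zero _
  | succ k ih =>
    rw [Nat.mul_succ, ← hS.num_add (j * k) j, ← ih]; exact hS.mul_succ _ _

theorem Str.IsPA.le_num {x : M} {k : ℕ} (h : S.le x (S.num k)) : ∃ j ≤ k, x = S.num j := by
  rw [hS.le_iff] at h
  obtain ⟨z, hz⟩ := h
  induction k generalizing x with
  | zero =>
    rcases hS.zero_or_succ x with rfl | ⟨y, rfl⟩
    · exact ⟨0, le_rfl, rfl⟩
    · rw [hS.add_succ] at hz; exact absurd hz (hS.succ_ne_zero _)
  | succ k ih =>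
    rcases hS.zero_or_succ x with rfl | ⟨y, rfl⟩
    · exact ⟨0, by omega, rfl⟩
    · rw [hS.add_succ] at hz
      obtain ⟨j, hj, rfl⟩ := ih (hS.succ_inj hz)
      exact ⟨j + 1, by omega, rfl⟩

theorem Str.IsPA.num_le_num {j k : ℕ} : S.le (S.num j) (S.num k) ↔ j ≤ k := by
  constructor
  · intro h
    obtain ⟨i, hi, h⟩ := hS.le_num h
    rwa [hS.num_inj h]
  · intro h
    rw [hS.le_iff]
    exact ⟨S.num (k - j), by rw [hS.num_add]; congr 1; omega⟩

theorem Str.IsPA.succ_add_num (z : M) (k : ℕ) :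
    S.add (S.succ z) (S.num k) = S.add z (S.num (k + 1)) := by
  induction k with
  | zero => simp only [Str.num, hS.add_zero, hS.add_succ]
  | succ k ih =>
    rw [Str.num, hS.add_succ, ih]
    simp only [Str.num, hS.add_succ]

theorem Str.IsPA.le_or_num_le (x : M) (k : ℕ) : S.le x (S.num k) ∨ S.le (S.num k) x := by
  induction k with
  | zero => right; rw [hS.le_iff]; exact ⟨x, hS.add_zero x⟩
  | succ k ih =>
    rcases ih with h | h
    · left
      obtain ⟨j, hj, rfl⟩ := hS.le_num h
      rw [hS.num_le_num]; omega
    · rw [hS.le_iff] at h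
      obtain ⟨z, hz⟩ := h
      rcases hS.zero_or_succ z with rfl | ⟨y, rfl⟩
      · left
        have : x = S.num k := by
          rw [← hz]
          have := hS.num_add 0 k
          rw [Nat.zero_add] at this
          exact this
        rw [this, hS.num_le_num]; omega
      · right
        rw [hS.le_iff]
        exact ⟨y, by rw [← hS.succ_add_num]; exact hz⟩

theorem Str.IsPA.num_le_trans {j k : ℕ} (h : j ≤ k) {x : M} (hx : S.le (S.num k) x) :
    S.le (S.num j) x := by
  rw [hS.le_iff] at *
  obtain ⟨z, hz⟩ := hx
  refine ⟨S.add z (S.num (k - j)), ?_⟩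
  rw [← hS.add_num, ← hz]
  congr 2
  omega

theorem Str.IsPA.tval_num (ρ : ℕ → ℕ) (t : ATerm) :
    S.tval (fun n => S.num (ρ n)) t = S.num (strN.tval ρ t) := by
  induction t with
  | var n => rfl
  | zero => rfl
  | succ t ih => simp only [Str.tval, ih]; rfl
  | add t s ih1 ih2 => simp only [Str.tval, ih1, ih2, hS.num_add]; rfl
  | mul t s ih1 ih2 => simp only [Str.tval, ih1, ih2, hS.num_mul]; rfl

theorem Str.IsPA.delta0_abs {φ : AFml} (h : IsDelta0 φ) (ρ : ℕ → ℕ) :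
    S.sat (fun n => S.num (ρ n)) φ ↔ strN.sat ρ φ := by
  induction h generalizing ρ with
  | eq t s =>
    simp only [Str.sat, hS.tval_num]
    exact ⟨fun h => hS.num_inj h, fun h => by rw [h]⟩
  | le t s => simp only [Str.sat, hS.tval_num, hS.num_le_num]; rfl
  | neg _ ih => simp only [Str.sat, ih]
  | and _ _ ih1 ih2 => simp only [Str.sat, ih1, ih2]
  | or _ _ ih1 ih2 => simp only [Str.sat, ih1, ih2]
  | imp _ _ ih1 ih2 => simp only [Str.sat, ih1, ih2]
  | ball t _ ih =>
    simp only [Str.sat, Str.tval, Str.tval_lift0, scons_zero, hS.tval_num]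
    constructor
    · intro h a ha
      rw [← ih, ← num_scons hS]
      exact h _ (hS.num_le_num.2 ha)
    · intro h a ha
      obtain ⟨j, hj, rfl⟩ := hS.le_num ha
      rw [num_scons hS, ih]
      exact h j hj
  | bex t _ ih =>
    simp only [Str.sat, Str.tval, Str.tval_lift0, scons_zero, hS.tval_num]
    constructor
    · rintro ⟨a, ha, h⟩
      obtain ⟨j, hj, rfl⟩ := hS.le_num ha
      rw [num_scons hS, ih] at h
      exact ⟨j, hj, h⟩
    · rintro ⟨a, ha, h⟩
      rw [← ih, ← num_scons hS] at h
      exact ⟨_, hS.num_le_num.2 ha, h⟩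

end pa

theorem proves_PA_of {φ : AFml} (h : ∀ (M : Type) (S : Str M), S.IsPA → ∀ ρ, S.sat ρ φ) :
    Proves PA φ := completeness h

/-! ### Bounded quantifiers -/

def ballF (t : ATerm) (φ : AFml) : AFml := .all (.imp (.le (.var 0) (t.lift 0)) φ)
def bexF (t : ATerm) (φ : AFml) : AFml := .ex (.and (.le (.var 0) (t.lift 0)) φ)

theorem Str.sat_ballF (S : Str M) (t : ATerm) (φ : AFml) (ρ : ℕ → M) :
    S.sat ρ (ballF t φ) ↔ ∀ a, S.le a (S.tval ρ t) → S.sat (scons a ρ) φ := by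
  simp [ballF, Str.sat, Str.tval, Str.tval_lift0]

theorem Str.sat_bexF (S : Str M) (t : ATerm) (φ : AFml) (ρ : ℕ → M) :
    S.sat ρ (bexF t φ) ↔ ∃ a, S.le a (S.tval ρ t) ∧ S.sat (scons a ρ) φ := by
  simp [bexF, Str.sat, Str.tval, Str.tval_lift0]

theorem ballF_freeLt {t : ATerm} {φ : AFml} {c : ℕ} (ht : t.FreeLt c) (h : φ.FreeLt (c + 1)) :
    (ballF t φ).FreeLt c :=
  ⟨⟨Nat.succ_pos c, ht.lift0⟩, h⟩

theorem bexF_freeLt {t : ATerm} {φ : AFml} {c : ℕ} (ht : t.FreeLt c) (h : φ.FreeLt (c + 1)) :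
    (bexF t φ).FreeLt c :=
  ⟨⟨Nat.succ_pos c, ht.lift0⟩, h⟩

theorem IsDelta0.substAll {φ : AFml} (h : IsDelta0 φ) (σ : ℕ → ATerm) :
    IsDelta0 (φ.substAll σ) := by
  have key : ∀ (t : ATerm) (σ : ℕ → ATerm),
      (t.lift 0).substAll (liftSub σ) = (t.substAll σ).lift 0 := by
    intro t σ
    simp only [ATerm.lift0_eq, ATerm.substAll_comp]
    congr 1
    funext n
    simp [ATerm.substAll, liftSub, ATerm.lift0_eq]
  induction h generalizing σ with
  | eq t s => exact .eq _ _
  | le t s => exact .le _ _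
  | neg _ ih => exact .neg (ih σ)
  | and _ _ ih1 ih2 => exact .and (ih1 σ) (ih2 σ)
  | or _ _ ih1 ih2 => exact .or (ih1 σ) (ih2 σ)
  | imp _ _ ih1 ih2 => exact .imp (ih1 σ) (ih2 σ)
  | ball t _ ih =>
    simp only [AFml.substAll, key]
    exact .ball _ (ih _)
  | bex t _ ih =>
    simp only [AFml.substAll, key]
    exact .bex _ (ih _)



variable {M : Type}

/-! ### The core lemma: self-correcting Σ₁ definitions -/

/-- Coding finite sets by divisibility. -/
theorem exists_set_code (s : ℕ) (F : ℕ → Prop) :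
    ∃ c d : ℕ, ∀ x ≤ s, ((∃ e ≤ c, e * ((x + 1) * d + 1) = c) ↔ F x) := by
  classical
  have hcop : ∀ x ≤ s, ∀ y ≤ s, x ≠ y →
      Nat.Coprime ((x + 1) * (s + 1).factorial + 1) ((y + 1) * (s + 1).factorial + 1) := by
    intro x hx y hy hxy
    wlog hlt : x < y
    · exact (this s F y hy x hx hxy.symm (by omega)).symm
    exact Nat.coprime_mul_succ (Nat.dvd_factorial (by omega) (by omega))
  refine ⟨∏ x ∈ (Finset.range (s + 1)).filter F, ((x + 1) * (s + 1).factorial + 1),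
    (s + 1).factorial, ?_⟩
  intro x hx
  constructor
  · rintro ⟨e, -, he⟩
    by_contra hF
    have h1 : Nat.Coprime ((x + 1) * (s + 1).factorial + 1)
        (∏ x ∈ (Finset.range (s + 1)).filter F, ((x + 1) * (s + 1).factorial + 1)) := by
      apply Nat.Coprime.prod_right
      intro i hi
      simp only [Finset.mem_filter, Finset.mem_range] at hi
      exact hcop x hx i (by omega) (by rintro rfl; exact hF hi.2)
    have h2 := Nat.Coprime.eq_one_of_dvd h1 ⟨e, by rw [← he]; ring⟩
    have := Nat.factorial_pos (s + 1)
    have : 0 < (x + 1) * (s + 1).factorial := by positivity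
    omega
  · intro hF
    obtain ⟨e, he⟩ := Finset.dvd_prod_of_mem (fun x => (x + 1) * (s + 1).factorial + 1)
      (show x ∈ (Finset.range (s + 1)).filter F by
        simp only [Finset.mem_filter, Finset.mem_range]; exact ⟨by omega, hF⟩)
    refine ⟨e, ?_, ?_⟩
    · rw [he]; exact Nat.le_mul_of_pos_left _ (by positivity)
    · rw [he]; ring

/-- Environment from a list. -/
def lenv {α : Type} (z : α) : List α → ℕ → α
  | [] => fun _ => z
  | a :: l => scons a (lenv z l)

theorem lenv_cons {α : Type} (z a : α) (l : List α) : lenv z (a :: l) = scons a (lenv z l) := rfl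

theorem lenv_tval (S : Str M) (ρ : ℕ → M) (z : ATerm) (l : List ATerm) :
    (fun n => S.tval ρ (lenv z l n)) = lenv (S.tval ρ z) (l.map (S.tval ρ)) := by
  induction l with
  | nil => rfl
  | cons a l ih =>
    funext n
    cases n with
    | zero => rfl
    | succ n => exact congrFun ih n

theorem lenv_num (S : Str M) (z : ℕ) (l : List ℕ) :
    (fun n => S.num (lenv z l n)) = lenv (S.num z) (l.map S.num) := by
  induction l with
  | nil => rfl
  | cons a l ih =>
    funext n
    cases n with
    | zero => rfl
    | succ n => exact congrFun ih n

theorem lenv_freeLt {z : ATerm} {l : List ATerm} {d : ℕ} (hz : z.FreeLt d)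
    (hl : ∀ t ∈ l, t.FreeLt d) (n : ℕ) : (lenv z l n).FreeLt d := by
  induction l generalizing n with
  | nil => exact hz
  | cons a l ih =>
    cases n with
    | zero => exact hl a (by simp)
    | succ n => exact ih (fun t ht => hl t (by simp [ht])) n

/-- Membership of `x` in the set coded by `c, d`. -/
def memF (x c d : ATerm) : AFml :=
  bexF c (.eq (.mul (.var 0) (.succ (.mul (.succ (x.lift 0)) (d.lift 0)))) (c.lift 0))

def Str.mem (S : Str M) (x c d : M) : Prop :=
  ∃ e, S.le e c ∧ S.mul e (S.succ (S.mul (S.succ x) d)) = c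

theorem Str.sat_memF (S : Str M) (ρ : ℕ → M) (x c d : ATerm) :
    S.sat ρ (memF x c d) ↔ S.mem (S.tval ρ x) (S.tval ρ c) (S.tval ρ d) := by
  simp [memF, Str.sat_bexF, Str.sat, Str.tval, Str.tval_lift0, Str.mem]

theorem memF_delta0 (x c d : ATerm) : IsDelta0 (memF x c d) := .bex _ (.eq _ _)

theorem memF_freeLt {x c d : ATerm} {k : ℕ} (hx : x.FreeLt k) (hc : c.FreeLt k)
    (hd : d.FreeLt k) : (memF x c d).FreeLt k :=
  bexF_freeLt hc ⟨⟨Nat.succ_pos _, hx.lift0, hd.lift0⟩, hc.lift0⟩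

section core
variable (υ κ η : AFml)

/-- Context: `d = 0, c = 1, v = 2, s = 3, x = 4, q = 5`. -/
def goodF : AFml :=
  .and (ballF (.var 3) (.imp (bexF (.var 4) (υ.substAll (lenv (.var 0) [.var 0, .var 1, .var 7])))
      (memF (.var 0) (.var 2) (.var 1))))
  (.and (ballF (.var 3) (.imp (memF (.var 0) (.var 2) (.var 1))
      (bexF (.var 3) (υ.substAll (lenv (.var 0) [.var 0, .var 1, .var 7])))))
  (.and (ballF (.var 3) (ballF (.var 4) (ballF (.var 5)
      (.imp (κ.substAll (lenv (.var 0) [.var 0, .var 2, .var 1, .var 8]))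
        (.imp (memF (.var 2) (.var 4) (.var 3)) (memF (.var 1) (.var 4) (.var 3)))))))
  (ballF (.var 3) (ballF (.var 4)
      (.imp (η.substAll (lenv (.var 0) [.var 0, .var 1, .var 7]))
        (.neg (memF (.var 1) (.var 3) (.var 2))))))))

def Str.good (S : Str M) (q s v c d : M) : Prop :=
  (∀ a, S.le a s → (∃ w, S.le w s ∧ S.sat (lenv w [w, a, q]) υ) → S.mem a c d) ∧
  (∀ a, S.le a s → S.mem a c d → (∃ w, S.le w v ∧ S.sat (lenv w [w, a, q]) υ)) ∧
  (∀ a, S.le a s → ∀ b, S.le b s → ∀ w, S.le w s → S.sat (lenv w [w, a, b, q]) κ →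
    S.mem a c d → S.mem b c d) ∧
  (∀ a, S.le a s → ∀ w, S.le w s → S.sat (lenv w [w, a, q]) η → ¬ S.mem a c d)

theorem Str.sat_goodF (S : Str M) (ρ : ℕ → M) :
    S.sat ρ (goodF υ κ η) ↔ S.good υ κ η (ρ 5) (ρ 3) (ρ 2) (ρ 1) (ρ 0) := by
  simp only [goodF, Str.sat, Str.sat_ballF, Str.sat_bexF, Str.sat_memF, Str.sat_substAll,
    lenv_tval, List.map, Str.tval, scons, Str.good]

theorem goodF_delta0 (h1 : IsDelta0 υ) (h2 : IsDelta0 κ) (h3 : IsDelta0 η) :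
    IsDelta0 (goodF υ κ η) := by
  refine .and (.ball _ (.imp (.bex _ (h1.substAll _)) (memF_delta0 _ _ _)))
    (.and (.ball _ (.imp (memF_delta0 _ _ _) (.bex _ (h1.substAll _))))
    (.and (.ball _ (.ball _ (.ball _ (.imp (h2.substAll _)
      (.imp (memF_delta0 _ _ _) (memF_delta0 _ _ _))))))
    (.ball _ (.ball _ (.imp (h3.substAll _) (.neg (memF_delta0 _ _ _)))))))

theorem goodF_freeLt (h1 : υ.FreeLt 3) (h2 : κ.FreeLt 4) (h3 : η.FreeLt 3) :
    (goodF υ κ η).FreeLt 6 := by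
  have hv : ∀ i k, i < k → (ATerm.var i).FreeLt k := fun i k h => h
  refine ⟨ballF_freeLt (hv _ _ (by omega)) ⟨bexF_freeLt (hv _ _ (by omega))
      (h1.substAll fun n _ => lenv_freeLt (hv _ _ (by omega)) (by simp [ATerm.FreeLt]) n),
      memF_freeLt (hv _ _ (by omega)) (hv _ _ (by omega)) (hv _ _ (by omega))⟩,
    ballF_freeLt (hv _ _ (by omega)) ⟨
      memF_freeLt (hv _ _ (by omega)) (hv _ _ (by omega)) (hv _ _ (by omega)),
      bexF_freeLt (hv _ _ (by omega))
      (h1.substAll fun n _ => lenv_freeLt (hv _ _ (by omega)) (by simp [ATerm.FreeLt]) n)⟩,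
    ballF_freeLt (hv _ _ (by omega)) (ballF_freeLt (hv _ _ (by omega))
      (ballF_freeLt (hv _ _ (by omega)) ⟨
      (h2.substAll fun n _ => lenv_freeLt (hv _ _ (by omega)) (by simp [ATerm.FreeLt]) n),
      memF_freeLt (hv _ _ (by omega)) (hv _ _ (by omega)) (hv _ _ (by omega)),
      memF_freeLt (hv _ _ (by omega)) (hv _ _ (by omega)) (hv _ _ (by omega))⟩)),
    ballF_freeLt (hv _ _ (by omega)) (ballF_freeLt (hv _ _ (by omega)) ⟨
      (h3.substAll fun n _ => lenv_freeLt (hv _ _ (by omega)) (by simp [ATerm.FreeLt]) n),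
      memF_freeLt (hv _ _ (by omega)) (hv _ _ (by omega)) (hv _ _ (by omega))⟩)⟩

/-- Body of `Q`; context `v = 0, s = 1, x = 2, q = 3`. -/
def bodyF : AFml :=
  .and (.and (.le (.var 2) (.var 1))
    (bexF (.var 0) (bexF (.var 1) (.and (goodF υ κ η) (memF (.var 4) (.var 1) (.var 0))))))
  (ballF (.var 0) (.imp (.le (.succ (.var 0)) (.var 1))
    (.neg (bexF (.var 0) (bexF (.var 1) ((goodF υ κ η).substAll
      (lenv (.var 0) [.var 0, .var 1, .var 2, .var 4, .var 5, .var 6])))))))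

def Str.body (S : Str M) (q x s v : M) : Prop :=
  (S.le x s ∧ ∃ c, S.le c v ∧ ∃ d, S.le d v ∧ S.good υ κ η q s v c d ∧ S.mem x c d) ∧
  ∀ v', S.le v' v → S.le (S.succ v') v →
    ¬ ∃ c, S.le c v' ∧ ∃ d, S.le d v' ∧ S.good υ κ η q s v' c d

theorem Str.sat_bodyF (S : Str M) (ρ : ℕ → M) :
    S.sat ρ (bodyF υ κ η) ↔ S.body υ κ η (ρ 3) (ρ 2) (ρ 1) (ρ 0) := by
  simp only [bodyF, Str.sat, Str.sat_ballF, Str.sat_bexF, Str.sat_memF, Str.sat_substAll,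
    Str.sat_goodF, lenv_tval, List.map, Str.tval, scons, Str.body, lenv]

def coreF : AFml := .ex (.ex (bodyF υ κ η))

theorem Str.sat_coreF (S : Str M) (ρ : ℕ → M) :
    S.sat ρ (coreF υ κ η) ↔ ∃ s v, S.body υ κ η (ρ 1) (ρ 0) s v := by
  simp only [coreF, Str.sat, Str.sat_bodyF, scons]

theorem bodyF_delta0 (h1 : IsDelta0 υ) (h2 : IsDelta0 κ) (h3 : IsDelta0 η) :
    IsDelta0 (bodyF υ κ η) := by
  have hg := goodF_delta0 υ κ η h1 h2 h3
  exact .and (.and (.le _ _) (.bex _ (.bex _ (.and hg (memF_delta0 _ _ _)))))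
    (.ball _ (.imp (.le _ _) (.neg (.bex _ (.bex _ (hg.substAll _))))))

theorem bodyF_freeLt (h1 : υ.FreeLt 3) (h2 : κ.FreeLt 4) (h3 : η.FreeLt 3) :
    (bodyF υ κ η).FreeLt 4 := by
  have hv : ∀ i k, i < k → (ATerm.var i).FreeLt k := fun i k h => h
  have hg := goodF_freeLt υ κ η h1 h2 h3
  refine ⟨⟨⟨hv _ _ (by omega), hv _ _ (by omega)⟩, bexF_freeLt (hv _ _ (by omega))
    (bexF_freeLt (hv _ _ (by omega)) ⟨hg, memF_freeLt (hv _ _ (by omega)) (hv _ _ (by omega))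
      (hv _ _ (by omega))⟩)⟩, ballF_freeLt (hv _ _ (by omega)) ⟨⟨hv 0 _ (by omega),
      hv _ _ (by omega)⟩, ?_⟩⟩
  exact bexF_freeLt (hv _ _ (by omega)) (bexF_freeLt (hv _ _ (by omega)) (hg.substAll
    fun n _ => lenv_freeLt (hv _ _ (by omega)) (by simp [ATerm.FreeLt]) n))

theorem core_sat_iff {υ κ η : AFml} (h1 : IsDelta0 υ) (h2 : IsDelta0 κ) (h3 : IsDelta0 η)
    {S : Str M} (hS : S.IsPA) (q x s v : ℕ) :
    S.body υ κ η (S.num q) (S.num x) (S.num s) (S.num v) ↔ strN.body υ κ η q x s v := by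
  have h := hS.delta0_abs (bodyF_delta0 υ κ η h1 h2 h3) (lenv 0 [v, s, x, q])
  rw [Str.sat_bodyF, Str.sat_bodyF] at h
  exact h

theorem core_good_iff {υ κ η : AFml} (h1 : IsDelta0 υ) (h2 : IsDelta0 κ) (h3 : IsDelta0 η)
    {S : Str M} (hS : S.IsPA) (q s v c d : ℕ) :
    S.good υ κ η (S.num q) (S.num s) (S.num v) (S.num c) (S.num d)
      ↔ strN.good υ κ η q s v c d := by
  have h := hS.delta0_abs (goodF_delta0 υ κ η h1 h2 h3) (lenv 0 [d, c, v, s, 0, q])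
  rw [Str.sat_goodF, Str.sat_goodF] at h
  exact h

theorem core_lemma (h1 : IsDelta0 υ) (h2 : IsDelta0 κ) (h3 : IsDelta0 η)
    (f1 : υ.FreeLt 3) (f2 : κ.FreeLt 4) (f3 : η.FreeLt 3) (q : ℕ)
    (U : ℕ → Prop) (hU : ∀ a, U a ↔ ∃ w, strN.sat (lenv 0 [w, a, q]) υ)
    (K : ℕ → ℕ → Prop) (hK : ∀ a b, K a b ↔ ∃ w, strN.sat (lenv 0 [w, a, b, q]) κ)
    (E : ℕ → Prop) (hE : ∀ a, E a ↔ ∃ w, strN.sat (lenv 0 [w, a, q]) η)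
    (hcl : ∀ a b, K a b → U a → U b) (hdis : ∀ a, E a → ¬ U a) :
    (∀ (x : ℕ) (ρ : ℕ → ℕ), strN.sat (scons x (scons q ρ)) (coreF υ κ η) → U x) ∧
    ∀ (M : Type) (S : Str M), S.IsPA → ∀ ρ : ℕ → M,
      (∀ x, U x → S.sat (scons (S.num x) (scons (S.num q) ρ)) (coreF υ κ η)) ∧
      (∀ a b, K a b → S.sat (scons (S.num a) (scons (S.num q) ρ)) (coreF υ κ η) →
        S.sat (scons (S.num b) (scons (S.num q) ρ)) (coreF υ κ η)) ∧
      (∀ a, E a → ¬ S.sat (scons (S.num a) (scons (S.num q) ρ)) (coreF υ κ η)) := by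
  -- tails of environments do not matter
  have t3 : ∀ {M : Type} (S : Str M) (φ : AFml) (z z' w a q : M), φ.FreeLt 3 →
      (S.sat (lenv z [w, a, q]) φ ↔ S.sat (lenv z' [w, a, q]) φ) := by
    intro M S φ z z' w a q hf
    refine S.sat_congr hf ?_
    intro n hn
    interval_cases n <;> rfl
  have t4 : ∀ {M : Type} (S : Str M) (φ : AFml) (z z' w a b q : M), φ.FreeLt 4 →
      (S.sat (lenv z [w, a, b, q]) φ ↔ S.sat (lenv z' [w, a, b, q]) φ) := by
    intro M S φ z z' w a b q hf
    refine S.sat_congr hf ?_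
    intro n hn
    interval_cases n <;> rfl
  have hU' : ∀ a w, strN.sat (lenv w [w, a, q]) υ → U a := fun a w h =>
    (hU a).2 ⟨w, (t3 _ _ _ _ _ _ _ f1).1 h⟩
  -- existence of good codes
  have hex : ∀ s, ∃ v c d, c ≤ v ∧ d ≤ v ∧ strN.good υ κ η q s v c d := by
    intro s
    obtain ⟨c, d, hcd⟩ := exists_set_code s U
    have hcd' : ∀ x ≤ s, (strN.mem x c d ↔ U x) := hcd
    have hw : ∃ B, ∀ a ≤ s, U a → ∃ w ≤ B, strN.sat (lenv w [w, a, q]) υ := by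
      clear hcd hcd'
      induction s with
      | zero =>
        by_cases h0 : U 0
        · obtain ⟨w, hw⟩ := (hU 0).1 h0
          refine ⟨w, fun a ha _ => ⟨w, le_rfl, ?_⟩⟩
          obtain rfl : a = 0 := by omega
          exact (t3 _ _ _ _ _ _ _ f1).1 hw
        · refine ⟨0, fun a ha h => ?_⟩
          obtain rfl : a = 0 := by omega
          exact absurd h h0
      | succ s ih =>
        obtain ⟨B, hB⟩ := ih
        by_cases h0 : U (s + 1)
        · obtain ⟨w, hw⟩ := (hU (s + 1)).1 h0
          refine ⟨max B w, fun a ha h => ?_⟩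
          rcases Nat.lt_or_ge s a with h' | h'
          · obtain rfl : a = s + 1 := by omega
            exact ⟨w, le_max_right _ _, (t3 _ _ _ _ _ _ _ f1).1 hw⟩
          · obtain ⟨w', hw', h''⟩ := hB a h' h
            exact ⟨w', le_trans hw' (le_max_left _ _), h''⟩
        · refine ⟨B, fun a ha h => ?_⟩
          rcases Nat.lt_or_ge s a with h' | h'
          · obtain rfl : a = s + 1 := by omega
            exact absurd h h0
          · exact hB a h' h
    obtain ⟨B, hB⟩ := hw
    refine ⟨max B (max c d), c, d, by omega, by omega, ?_, ?_, ?_, ?_⟩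
    · rintro a ha ⟨w, hw, h⟩
      exact (hcd' a ha).2 (hU' _ _ h)
    · intro a ha h
      obtain ⟨w, hw, h'⟩ := hB a ha ((hcd' a ha).1 h)
      exact ⟨w, le_trans hw (le_max_left _ _), h'⟩
    · intro a ha b hb w hw h hm
      rw [hcd' b hb]
      rw [hcd' a ha] at hm
      exact hcl a b ((hK a b).2 ⟨w, (t4 _ _ _ _ _ _ _ _ f2).1 h⟩) hm
    · intro a ha w hw h hm
      rw [hcd' a ha] at hm
      exact hdis a ((hE a).2 ⟨w, (t3 _ _ _ _ _ _ _ f3).1 h⟩) hm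
  have hsound : ∀ x s v, strN.body υ κ η q x s v → U x := by
    rintro x s v ⟨⟨hx, c, hc, d, hd, hg, hm⟩, -⟩
    obtain ⟨w, -, hw⟩ := hg.2.1 x hx hm
    exact hU' _ _ hw
  have hcompl : ∀ x, U x → ∃ s v, strN.body υ κ η q x s v := by
    intro x hx
    obtain ⟨w, hw⟩ := (hU x).1 hx
    classical
    have hv : ∃ v, ∃ c d, c ≤ v ∧ d ≤ v ∧ strN.good υ κ η q (max x w) v c d := hex _
    obtain ⟨c, d, hc, hd, hg⟩ := Nat.find_spec hv
    refine ⟨max x w, Nat.find hv, ⟨le_max_left _ _, c, hc, d, hd, hg, ?_⟩, ?_⟩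
    · exact hg.1 x (le_max_left _ _) ⟨w, le_max_right _ _, (t3 _ _ _ _ _ _ _ f1).1 hw⟩
    · rintro v' _ hv' ⟨c', hc', d', hd', hg'⟩
      exact Nat.find_min hv (m := v') hv' ⟨c', d', hc', hd', hg'⟩
  refine ⟨?_, ?_⟩
  · intro x ρ h
    rw [Str.sat_coreF] at h
    obtain ⟨s, v, h⟩ := h
    exact hsound x s v h
  · intro M S hS ρ
    have hpos : ∀ x, U x → S.sat (scons (S.num x) (scons (S.num q) ρ)) (coreF υ κ η) := by
      intro x hx
      rw [Str.sat_coreF]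
      obtain ⟨s, v, h⟩ := hcompl x hx
      exact ⟨_, _, (core_sat_iff h1 h2 h3 hS q x s v).2 h⟩
    -- either `s` is above a given standard bound, or everything is standard
    have hdich : ∀ (x N : ℕ) (s v : M), S.body υ κ η (S.num q) (S.num x) s v →
        S.le (S.num N) s ∨ U x := by
      intro x N s v hb
      rcases hS.le_or_num_le s N with h | h
      · right
        obtain ⟨j, -, rfl⟩ := hS.le_num h
        obtain ⟨v0, c0, d0, hc0, hd0, hg0⟩ := hex j
        rcases hS.le_or_num_le v (v0 + 1) with h' | h'
        · obtain ⟨i, -, rfl⟩ := hS.le_num h'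
          exact hsound x j i ((core_sat_iff h1 h2 h3 hS q x j i).1 hb)
        · exfalso
          refine hb.2 (S.num v0) (hS.num_le_trans (by omega) h') h' ?_
          exact ⟨S.num c0, hS.num_le_num.2 hc0, S.num d0, hS.num_le_num.2 hd0,
            (core_good_iff h1 h2 h3 hS q j v0 c0 d0).2 hg0⟩
      · exact Or.inl h
    refine ⟨hpos, ?_, ?_⟩
    · intro a b hKab hsat
      rw [Str.sat_coreF] at hsat
      obtain ⟨s, v, hb⟩ := hsat
      obtain ⟨w, hw⟩ := (hK a b).1 hKab
      rcases hdich a (max (max a b) w) s v hb with h | h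
      · rw [Str.sat_coreF]
        obtain ⟨⟨hx, c, hc, d, hd, hg, hm⟩, hmin⟩ := hb
        have hbs : S.le (S.num b) s := hS.num_le_trans (by omega) h
        refine ⟨s, v, ⟨hbs, c, hc, d, hd, hg, ?_⟩, hmin⟩
        refine hg.2.2.1 (S.num a) hx (S.num b) hbs (S.num w) (hS.num_le_trans (by omega) h) ?_ hm
        have := (hS.delta0_abs h2 (lenv w [w, a, b, q])).2 ((t4 _ _ _ _ _ _ _ _ f2).1 hw)
        rw [lenv_num] at this
        exact this
      · exact hpos b (hcl a b hKab h)
    · intro a hEa hsat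
      rw [Str.sat_coreF] at hsat
      obtain ⟨s, v, hb⟩ := hsat
      obtain ⟨w, hw⟩ := (hE a).1 hEa
      rcases hdich a (max a w) s v hb with h | h
      · obtain ⟨⟨hx, c, hc, d, hd, hg, hm⟩, hmin⟩ := hb
        refine hg.2.2.2 (S.num a) hx (S.num w) (hS.num_le_trans (by omega) h) ?_ hm
        have := (hS.delta0_abs h3 (lenv w [w, a, q])).2 ((t3 _ _ _ _ _ _ _ f3).1 hw)
        rw [lenv_num] at this
        exact this
      · exact hdis a hEa h

end core



/-! ### Σ₁-definability of primitive recursive functions -/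

def D0 (k : ℕ) (R : (ℕ → ℕ) → Prop) : Prop :=
  ∃ δ, IsDelta0 δ ∧ δ.FreeLt k ∧ ∀ ρ, R ρ ↔ strN.sat ρ δ

def S1 (k : ℕ) (R : (ℕ → ℕ) → Prop) : Prop :=
  ∃ δ, IsDelta0 δ ∧ δ.FreeLt (k + 1) ∧ ∀ ρ, R ρ ↔ ∃ w, strN.sat (scons w ρ) δ

theorem S1.congr {k : ℕ} {R R' : (ℕ → ℕ) → Prop} (h : S1 k R) (hR : ∀ ρ, R' ρ ↔ R ρ) :
    S1 k R' := by
  obtain ⟨δ, h1, h2, h3⟩ := h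
  exact ⟨δ, h1, h2, fun ρ => (hR ρ).trans (h3 ρ)⟩

theorem D0.congr {k : ℕ} {R R' : (ℕ → ℕ) → Prop} (h : D0 k R) (hR : ∀ ρ, R' ρ ↔ R ρ) :
    D0 k R' := by
  obtain ⟨δ, h1, h2, h3⟩ := h
  exact ⟨δ, h1, h2, fun ρ => (hR ρ).trans (h3 ρ)⟩

theorem D0.s1 {k : ℕ} {R : (ℕ → ℕ) → Prop} (h : D0 k R) : S1 k R := by
  obtain ⟨δ, h1, h2, h3⟩ := h
  refine ⟨δ.substAll (fun n => .var (n + 1)), h1.substAll _,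
    h2.substAll (fun n hn => by simpa [ATerm.FreeLt] using hn), fun ρ => ?_⟩
  rw [h3]
  simp only [Str.sat_substAll, Str.tval, scons_succ]
  exact ⟨fun h => ⟨0, h⟩, fun ⟨_, h⟩ => h⟩

theorem D0.and {k : ℕ} {R R' : (ℕ → ℕ) → Prop} (h : D0 k R) (h' : D0 k R') :
    D0 k (fun ρ => R ρ ∧ R' ρ) := by
  obtain ⟨δ, h1, h2, h3⟩ := h
  obtain ⟨δ', h1', h2', h3'⟩ := h'
  exact ⟨.and δ δ', .and h1 h1', ⟨h2, h2'⟩, fun ρ => by simp only [Str.sat, h3, h3']⟩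

theorem D0.or {k : ℕ} {R R' : (ℕ → ℕ) → Prop} (h : D0 k R) (h' : D0 k R') :
    D0 k (fun ρ => R ρ ∨ R' ρ) := by
  obtain ⟨δ, h1, h2, h3⟩ := h
  obtain ⟨δ', h1', h2', h3'⟩ := h'
  exact ⟨.or δ δ', .or h1 h1', ⟨h2, h2'⟩, fun ρ => by simp only [Str.sat, h3, h3']⟩

theorem D0.eq {k : ℕ} (t s : ATerm) (ht : t.FreeLt k) (hs : s.FreeLt k) :
    D0 k (fun ρ => strN.tval ρ t = strN.tval ρ s) :=
  ⟨.eq t s, .eq _ _, ⟨ht, hs⟩, fun _ => Iff.rfl⟩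

theorem D0.le {k : ℕ} (t s : ATerm) (ht : t.FreeLt k) (hs : s.FreeLt k) :
    D0 k (fun ρ => strN.tval ρ t ≤ strN.tval ρ s) :=
  ⟨.le t s, .le _ _, ⟨ht, hs⟩, fun _ => Iff.rfl⟩

theorem D0.bex {k : ℕ} (t : ATerm) (ht : t.FreeLt k) {R : (ℕ → ℕ) → Prop} (h : D0 (k + 1) R) :
    D0 k (fun ρ => ∃ a ≤ strN.tval ρ t, R (scons a ρ)) := by
  obtain ⟨δ, h1, h2, h3⟩ := h
  refine ⟨bexF t δ, .bex _ h1, bexF_freeLt ht h2, fun ρ => ?_⟩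
  simp only [Str.sat_bexF, h3]
  rfl

theorem S1.and {k : ℕ} {R R' : (ℕ → ℕ) → Prop} (h : S1 k R) (h' : S1 k R') :
    S1 k (fun ρ => R ρ ∧ R' ρ) := by
  obtain ⟨δ, h1, h2, h3⟩ := h
  obtain ⟨δ', h1', h2', h3'⟩ := h'
  have hfr : ∀ n < k + 1, (scons (ATerm.var 0) (fun n => ATerm.var (n + 2)) n).FreeLt (k + 2) := by
    intro n hn
    cases n with
    | zero => simp [ATerm.FreeLt]
    | succ n => simp [ATerm.FreeLt]; omega
  refine ⟨.and (bexF (.var 0) (δ.substAll (scons (.var 0) (fun n => .var (n + 2)))))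
    (bexF (.var 0) (δ'.substAll (scons (.var 0) (fun n => .var (n + 2))))),
    .and (.bex _ (h1.substAll _)) (.bex _ (h1'.substAll _)),
    ⟨bexF_freeLt (Nat.succ_pos k) (h2.substAll hfr),
      bexF_freeLt (Nat.succ_pos k) (h2'.substAll hfr)⟩, fun ρ => ?_⟩
  have henv : ∀ a w : ℕ, (fun n => strN.tval (scons a (scons w ρ))
      (scons (ATerm.var 0) (fun n => ATerm.var (n + 2)) n)) = scons a ρ := by
    intro a w; funext n; cases n <;> rfl
  simp only [Str.sat, Str.sat_bexF, Str.sat_substAll, henv, h3, h3', Str.tval, scons_zero]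
  constructor
  · rintro ⟨⟨w, hw⟩, ⟨w', hw'⟩⟩
    exact ⟨max w w', ⟨w, le_max_left _ _, hw⟩, ⟨w', le_max_right _ _, hw'⟩⟩
  · rintro ⟨W, ⟨w, -, hw⟩, ⟨w', -, hw'⟩⟩
    exact ⟨⟨w, hw⟩, ⟨w', hw'⟩⟩

theorem S1.ex {k : ℕ} {R : (ℕ → ℕ) → Prop} (h : S1 (k + 1) R) :
    S1 k (fun ρ => ∃ a, R (scons a ρ)) := by
  obtain ⟨δ, h1, h2, h3⟩ := h
  have hfr : ∀ n < k + 1 + 1, (scons (ATerm.var 0) (scons (ATerm.var 1)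
      (fun n => ATerm.var (n + 3))) n).FreeLt (k + 3) := by
    intro n hn
    rcases n with _ | _ | n
    · simp [ATerm.FreeLt]
    · simp [ATerm.FreeLt]
    · simp [ATerm.FreeLt]; omega
  refine ⟨bexF (.var 0) (bexF (.var 1) (δ.substAll (scons (.var 0) (scons (.var 1)
    (fun n => .var (n + 3)))))), .bex _ (.bex _ (h1.substAll _)),
    bexF_freeLt (Nat.succ_pos k) (bexF_freeLt (show 1 < k + 1 + 1 by omega) (h2.substAll hfr)),
    fun ρ => ?_⟩
  have henv : ∀ w' a w : ℕ, (fun n => strN.tval (scons w' (scons a (scons w ρ)))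
      (scons (ATerm.var 0) (scons (ATerm.var 1) (fun n => ATerm.var (n + 3))) n)) =
      scons w' (scons a ρ) := by
    intro w' a w; funext n; rcases n with _ | _ | n <;> rfl
  simp only [Str.sat_bexF, Str.sat_substAll, henv, h3]
  constructor
  · rintro ⟨a, w, hw⟩
    exact ⟨max a w, a, le_max_left _ _, w, le_max_right _ _, hw⟩
  · rintro ⟨_, a, -, w, -, hw⟩
    exact ⟨a, w, hw⟩

theorem S1.ball {k : ℕ} (t : ATerm) (ht : t.FreeLt k) {R : (ℕ → ℕ) → Prop} (h : S1 (k + 1) R) :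
    S1 k (fun ρ => ∀ a ≤ strN.tval ρ t, R (scons a ρ)) := by
  obtain ⟨δ, h1, h2, h3⟩ := h
  have hfr : ∀ n < k + 1 + 1, (scons (ATerm.var 0) (scons (ATerm.var 1)
      (fun n => ATerm.var (n + 3))) n).FreeLt (k + 3) := by
    intro n hn
    rcases n with _ | _ | n
    · simp [ATerm.FreeLt]
    · simp [ATerm.FreeLt]
    · simp [ATerm.FreeLt]; omega
  refine ⟨ballF (t.lift 0) (bexF (.var 1) (δ.substAll (scons (.var 0) (scons (.var 1)
    (fun n => .var (n + 3)))))), .ball _ (.bex _ (h1.substAll _)),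
    ballF_freeLt ht.lift0 (bexF_freeLt (show 1 < k + 1 + 1 by omega) (h2.substAll hfr)),
    fun ρ => ?_⟩
  have henv : ∀ w' a w : ℕ, (fun n => strN.tval (scons w' (scons a (scons w ρ)))
      (scons (ATerm.var 0) (scons (ATerm.var 1) (fun n => ATerm.var (n + 3))) n)) =
      scons w' (scons a ρ) := by
    intro w' a w; funext n; rcases n with _ | _ | n <;> rfl
  simp only [Str.sat_bexF, Str.sat_ballF, Str.sat_substAll, henv, h3, Str.tval_lift0]
  have key : ∀ N, (∀ a ≤ N, ∃ w, strN.sat (scons w (scons a ρ)) δ) →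
      ∃ B, ∀ a ≤ N, ∃ w ≤ B, strN.sat (scons w (scons a ρ)) δ := by
    intro N
    induction N with
    | zero =>
      intro h
      obtain ⟨w, hw⟩ := h 0 le_rfl
      refine ⟨w, fun a ha => ?_⟩
      obtain rfl : a = 0 := by omega
      exact ⟨w, le_rfl, hw⟩
    | succ N ih =>
      intro h
      obtain ⟨B, hB⟩ := ih (fun a ha => h a (by omega))
      obtain ⟨w, hw⟩ := h (N + 1) le_rfl
      refine ⟨max B w, fun a ha => ?_⟩
      rcases Nat.lt_or_ge N a with h' | h'
      · obtain rfl : a = N + 1 := by omega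
        exact ⟨w, le_max_right _ _, hw⟩
      · obtain ⟨w', hw', h''⟩ := hB a h'
        exact ⟨w', le_trans hw' (le_max_left _ _), h''⟩
  constructor
  · intro h
    obtain ⟨B, hB⟩ := key _ h
    exact ⟨B, hB⟩
  · rintro ⟨B, hB⟩ a ha
    obtain ⟨w, -, hw⟩ := hB a ha
    exact ⟨w, hw⟩

theorem S1.sub {k : ℕ} {R : (ℕ → ℕ) → Prop} (h : S1 k R) (j : ℕ) (l : List ATerm)
    (hl : ∀ t ∈ l, t.FreeLt j) : S1 j (fun ρ => R (lenv 0 (l.map (strN.tval ρ)))) := by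
  obtain ⟨δ, h1, h2, h3⟩ := h
  refine ⟨δ.substAll (liftSub (lenv .zero l)), h1.substAll _,
    h2.substAll (fun n hn => liftSub_freeLt (c := k)
      (fun n _ => lenv_freeLt (z := .zero) (show ATerm.FreeLt j .zero from trivial) hl n) n hn), fun ρ => ?_⟩
  simp only [Str.sat_substAll, Str.scons_tval, h3, lenv_tval]
  rfl

theorem D0.sub {k : ℕ} {R : (ℕ → ℕ) → Prop} (h : D0 k R) (j : ℕ) (l : List ATerm)
    (hl : ∀ t ∈ l, t.FreeLt j) : D0 j (fun ρ => R (lenv 0 (l.map (strN.tval ρ)))) := by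
  obtain ⟨δ, h1, h2, h3⟩ := h
  refine ⟨δ.substAll (lenv .zero l), h1.substAll _,
    h2.substAll (fun n hn => lenv_freeLt (z := .zero) (show ATerm.FreeLt j .zero from trivial) hl n), fun ρ => ?_⟩
  simp only [Str.sat_substAll, h3, lenv_tval]
  rfl

/-- The graph of the pairing function: `pair (ρ 0) (ρ 1) = ρ 2`. -/
theorem d0_pair : D0 3 (fun ρ => Nat.pair (ρ 0) (ρ 1) = ρ 2) := by
  have h1 := ((D0.le (k := 3) (.succ (.var 0)) (.var 1) (by simp [ATerm.FreeLt])
      (by simp [ATerm.FreeLt])).and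
    (D0.eq (.var 2) (.add (.mul (.var 1) (.var 1)) (.var 0)) (by simp [ATerm.FreeLt])
      (by simp [ATerm.FreeLt]))).or
    ((D0.le (k := 3) (.var 1) (.var 0) (by simp [ATerm.FreeLt]) (by simp [ATerm.FreeLt])).and
    (D0.eq (.var 2) (.add (.add (.mul (.var 0) (.var 0)) (.var 0)) (.var 1))
      (by simp [ATerm.FreeLt]) (by simp [ATerm.FreeLt])))
  refine h1.congr (fun ρ => ?_)
  show _ ↔ (ρ 0 + 1 ≤ ρ 1 ∧ ρ 2 = ρ 1 * ρ 1 + ρ 0) ∨ (ρ 1 ≤ ρ 0 ∧ ρ 2 = ρ 0 * ρ 0 + ρ 0 + ρ 1)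
  unfold Nat.pair
  split_ifs with h <;> omega

/-- The graph of the beta function: `ρ 0 % ((ρ 2 + 1) * ρ 1 + 1) = ρ 3`. -/
theorem d0_beta : D0 4 (fun ρ => ρ 0 % ((ρ 2 + 1) * ρ 1 + 1) = ρ 3) := by
  have h1 := (D0.le (k := 4) (.var 3) (.mul (.succ (.var 2)) (.var 1)) (by simp [ATerm.FreeLt])
      (by simp [ATerm.FreeLt])).and
    (D0.bex (.var 0) (by simp [ATerm.FreeLt])
      (D0.eq (.add (.mul (.var 0) (.succ (.mul (.succ (.var 3)) (.var 2)))) (.var 4)) (.var 1)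
      (by simp [ATerm.FreeLt]) (by simp [ATerm.FreeLt])))
  refine h1.congr (fun ρ => ?_)
  show _ ↔ ρ 3 ≤ (ρ 2 + 1) * ρ 1 ∧ ∃ e ≤ ρ 0, e * ((ρ 2 + 1) * ρ 1 + 1) + ρ 3 = ρ 0
  generalize (ρ 2 + 1) * ρ 1 = m
  constructor
  · intro h
    have h2 := Nat.mod_lt (ρ 0) (Nat.succ_pos m)
    have h3 := Nat.div_add_mod (ρ 0) (m + 1)
    simp only [Nat.succ_eq_add_one] at h2
    refine ⟨by omega, ρ 0 / (m + 1), Nat.div_le_self _ _, ?_⟩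
    rw [← h, mul_comm]; exact h3
  · rintro ⟨h2, e, -, he⟩
    rw [← he, Nat.add_comm, Nat.add_mul_mod_self_right]
    exact Nat.mod_eq_of_lt (by omega)

theorem exists_beta (g : ℕ → ℕ) (n : ℕ) :
    ∃ c d, ∀ i ≤ n, c % ((i + 1) * d + 1) = g i := by
  refine ⟨(Nat.unbeta ((List.range (n + 1)).map g)).unpair.1,
    (Nat.unbeta ((List.range (n + 1)).map g)).unpair.2, fun i hi => ?_⟩
  have h := Nat.beta_unbeta_coe ((List.range (n + 1)).map g) ⟨i, by simp; omega⟩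
  simpa [Nat.beta] using h

theorem s1_primrec {f : ℕ → ℕ} (hf : Nat.Primrec f) : S1 2 (fun ρ => f (ρ 0) = ρ 1) := by
  induction hf with
  | zero =>
    exact (D0.eq (k := 2) .zero (.var 1) trivial (by simp [ATerm.FreeLt])).s1
  | succ =>
    exact (D0.eq (k := 2) (.succ (.var 0)) (.var 1) (by simp [ATerm.FreeLt])
      (by simp [ATerm.FreeLt])).s1
  | left =>
    refine ((d0_pair.sub 3 [.var 2, .var 0, .var 1] (by simp [ATerm.FreeLt])).s1.ex).congr
      (fun ρ => ?_)
    show _ ↔ ∃ a, Nat.pair (ρ 1) a = ρ 0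
    constructor
    · intro h; rw [← h]; exact ⟨_, Nat.pair_unpair _⟩
    · rintro ⟨a, h⟩; rw [← h]; simp
  | right =>
    refine ((d0_pair.sub 3 [.var 0, .var 2, .var 1] (by simp [ATerm.FreeLt])).s1.ex).congr
      (fun ρ => ?_)
    show _ ↔ ∃ a, Nat.pair a (ρ 1) = ρ 0
    constructor
    · intro h; rw [← h]; exact ⟨_, Nat.pair_unpair _⟩
    · rintro ⟨a, h⟩; rw [← h]; simp
  | @pair f g _ _ ih1 ih2 =>
    refine (((ih1.sub 4 [.var 2, .var 0] (by simp [ATerm.FreeLt])).and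
      ((ih2.sub 4 [.var 2, .var 1] (by simp [ATerm.FreeLt])).and
      (d0_pair.sub 4 [.var 0, .var 1, .var 3] (by simp [ATerm.FreeLt])).s1)).ex.ex).congr
      (fun ρ => ?_)
    show _ ↔ ∃ b a, f (ρ 0) = a ∧ g (ρ 0) = b ∧ Nat.pair a b = ρ 1
    constructor
    · intro h; exact ⟨_, _, rfl, rfl, h⟩
    · rintro ⟨b, a, rfl, rfl, h⟩; exact h
  | @comp f g _ _ ih1 ih2 =>
    refine (((ih2.sub 3 [.var 1, .var 0] (by simp [ATerm.FreeLt])).and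
      (ih1.sub 3 [.var 0, .var 2] (by simp [ATerm.FreeLt]))).ex).congr
      (fun ρ => ?_)
    show _ ↔ ∃ a, g (ρ 0) = a ∧ f a = ρ 1
    constructor
    · intro h; exact ⟨_, rfl, h⟩
    · rintro ⟨a, rfl, h⟩; exact h
  | @prec f g _ _ ih1 ih2 =>
    -- step: context i, d, c, n, z, x, y
    have hstep : S1 7 (fun ρ => ∃ p r v u, ρ 2 % ((ρ 0 + 1) * ρ 1 + 1) = u ∧
        ρ 2 % ((ρ 0 + 1 + 1) * ρ 1 + 1) = v ∧ Nat.pair (ρ 0) u = r ∧ Nat.pair (ρ 4) r = p ∧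
        g p = v) := by
      have := ((d0_beta.sub 11 [.var 6, .var 5, .var 4, .var 0] (by simp [ATerm.FreeLt])).s1.and
        ((d0_beta.sub 11 [.var 6, .var 5, .succ (.var 4), .var 1] (by simp [ATerm.FreeLt])).s1.and
        ((d0_pair.sub 11 [.var 4, .var 0, .var 2] (by simp [ATerm.FreeLt])).s1.and
        ((d0_pair.sub 11 [.var 8, .var 2, .var 3] (by simp [ATerm.FreeLt])).s1.and
        (ih2.sub 11 [.var 3, .var 1] (by simp [ATerm.FreeLt])))))).ex.ex.ex.ex
      exact this
    have hstep' : S1 7 (fun ρ => ρ 0 = ρ 3 ∨ ∃ p r v u, ρ 2 % ((ρ 0 + 1) * ρ 1 + 1) = u ∧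
        ρ 2 % ((ρ 0 + 1 + 1) * ρ 1 + 1) = v ∧ Nat.pair (ρ 0) u = r ∧ Nat.pair (ρ 4) r = p ∧
        g p = v) := by
      obtain ⟨δ, h1, h2, h3⟩ := hstep
      refine ⟨.or (.eq (.var 1) (.var 4)) δ, .or (.eq _ _) h1, ⟨by simp [AFml.FreeLt, ATerm.FreeLt], h2⟩,
        fun ρ => ?_⟩
      refine (or_congr Iff.rfl (h3 ρ)).trans ?_
      simp only [Str.sat]
      constructor
      · rintro (h | ⟨w, h⟩)
        · exact ⟨0, Or.inl h⟩
        · exact ⟨w, Or.inr h⟩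
      · rintro ⟨w, h | h⟩
        · exact Or.inl h
        · exact Or.inr ⟨w, h⟩
    have hb := S1.ball (k := 6) (.var 2) (by simp [ATerm.FreeLt]) hstep'
    -- context d, c, n, z, x, y
    have hz : S1 6 (fun ρ => ∃ u, ρ 1 % ((0 + 1) * ρ 0 + 1) = u ∧ f (ρ 3) = u) :=
      ((d0_beta.sub 7 [.var 2, .var 1, .zero, .var 0] (by simp [ATerm.FreeLt])).s1.and
        (ih1.sub 7 [.var 4, .var 0] (by simp [ATerm.FreeLt]))).ex
    have hall := ((d0_pair.sub 6 [.var 3, .var 2, .var 4] (by simp [ATerm.FreeLt])).s1.and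
      ((d0_beta.sub 6 [.var 1, .var 0, .var 2, .var 5] (by simp [ATerm.FreeLt])).s1.and
      (hz.and hb))).ex.ex.ex.ex
    refine hall.congr (fun ρ => ?_)
    show _ ↔ ∃ z n c d, Nat.pair z n = ρ 0 ∧ c % ((n + 1) * d + 1) = ρ 1 ∧
      (∃ u, c % ((0 + 1) * d + 1) = u ∧ f z = u) ∧
      ∀ i ≤ n, (i = n ∨ ∃ p r v u, c % ((i + 1) * d + 1) = u ∧
        c % ((i + 1 + 1) * d + 1) = v ∧ Nat.pair i u = r ∧ Nat.pair z r = p ∧ g p = v)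
    constructor
    · intro h
      obtain ⟨c, d, hcd⟩ := exists_beta (fun n => Nat.rec (f (ρ 0).unpair.1)
        (fun y IH => g (Nat.pair (ρ 0).unpair.1 (Nat.pair y IH))) n) (ρ 0).unpair.2
      refine ⟨(ρ 0).unpair.1, (ρ 0).unpair.2, c, d, Nat.pair_unpair _, ?_, ⟨_, rfl, ?_⟩, ?_⟩
      · rw [hcd _ le_rfl]; exact h
      · rw [hcd 0 (Nat.zero_le _)]; rfl
      · intro i hi
        rcases hi.eq_or_lt with h' | h'
        · exact Or.inl h'
        · right
          refine ⟨_, _, _, _, rfl, rfl, rfl, rfl, ?_⟩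
          rw [hcd i hi, hcd (i + 1) h']
    · rintro ⟨z, n, c, d, hx, hy, ⟨u, hu, hfz⟩, hi⟩
      have hrec : ∀ i ≤ n, c % ((i + 1) * d + 1) =
          Nat.rec (f z) (fun y IH => g (Nat.pair z (Nat.pair y IH))) i := by
        intro i
        induction i with
        | zero => intro _; rw [hu, ← hfz]; rfl
        | succ i ih =>
          intro h
          rcases hi i (by omega) with h' | ⟨p, r, v, u, h1, h2, h3, h4, h5⟩
          · omega
          · rw [h2, ← h5, ← h4, ← h3, ← h1, ih (by omega)]
      rw [← hx, ← hy, hrec n le_rfl]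
      simp [Nat.unpaired]



/-! ### Automation for primitive recursiveness, and recursively enumerable relations -/

attribute [fun_prop] Primrec
attribute [fun_prop] Primrec.id
attribute [fun_prop] Primrec.const
attribute [fun_prop] Primrec.comp
attribute [fun_prop] PrimrecPred

section pr
variable {α β γ : Type} [Primcodable α] [Primcodable β] [Primcodable γ]

@[fun_prop] theorem pr_pair {f : α → β} {g : α → γ} (hf : Primrec f) (hg : Primrec g) :
    Primrec fun a => (f a, g a) := hf.pair hg
@[fun_prop] theorem pr_fst {f : α → β × γ} (hf : Primrec f) : Primrec fun a => (f a).1 :=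
  Primrec.fst.comp hf
@[fun_prop] theorem pr_snd {f : α → β × γ} (hf : Primrec f) : Primrec fun a => (f a).2 :=
  Primrec.snd.comp hf
@[fun_prop] theorem pr_natpair {f g : α → ℕ} (hf : Primrec f) (hg : Primrec g) :
    Primrec fun a => Nat.pair (f a) (g a) := Primrec₂.natPair.comp hf hg
@[fun_prop] theorem pr_unpair {f : α → ℕ} (hf : Primrec f) : Primrec fun a => Nat.unpair (f a) :=
  Primrec.unpair.comp hf
@[fun_prop] theorem pr_add {f g : α → ℕ} (hf : Primrec f) (hg : Primrec g) :
    Primrec fun a => f a + g a := Primrec.nat_add.comp hf hg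
@[fun_prop] theorem pr_sub {f g : α → ℕ} (hf : Primrec f) (hg : Primrec g) :
    Primrec fun a => f a - g a := Primrec.nat_sub.comp hf hg
@[fun_prop] theorem pr_mul {f g : α → ℕ} (hf : Primrec f) (hg : Primrec g) :
    Primrec fun a => f a * g a := Primrec.nat_mul.comp hf hg
@[fun_prop] theorem pr_div {f g : α → ℕ} (hf : Primrec f) (hg : Primrec g) :
    Primrec fun a => f a / g a := Primrec.nat_div.comp hf hg
@[fun_prop] theorem pr_mod {f g : α → ℕ} (hf : Primrec f) (hg : Primrec g) :
    Primrec fun a => f a % g a := Primrec.nat_mod.comp hf hg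
@[fun_prop] theorem pr_ite {p : α → Prop} [DecidablePred p] {f g : α → β} (hp : PrimrecPred p)
    (hf : Primrec f) (hg : Primrec g) : Primrec fun a => if p a then f a else g a :=
  Primrec.ite hp hf hg
@[fun_prop] theorem pr_decide {p : α → Prop} [DecidablePred p] (hp : PrimrecPred p) :
    Primrec fun a => decide (p a) := by
  obtain ⟨_, h⟩ := hp
  exact h.of_eq fun a => by congr
@[fun_prop] theorem pr_bnot {f : α → Bool} (hf : Primrec f) : Primrec fun a => !(f a) :=
  Primrec.not.comp hf
@[fun_prop] theorem pr_band {f g : α → Bool} (hf : Primrec f) (hg : Primrec g) :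
    Primrec fun a => f a && g a := Primrec.and.comp hf hg
@[fun_prop] theorem pr_bor {f g : α → Bool} (hf : Primrec f) (hg : Primrec g) :
    Primrec fun a => f a || g a := Primrec.or.comp hf hg
@[fun_prop] theorem pr_some {f : α → β} (hf : Primrec f) : Primrec fun a => some (f a) :=
  Primrec.option_some.comp hf
@[fun_prop] theorem pr_getElem? {f : α → List β} {g : α → ℕ} (hf : Primrec f) (hg : Primrec g) :
    Primrec fun a => (f a)[g a]? := Primrec.list_getElem?.comp hf hg
@[fun_prop] theorem pr_getD {f : α → Option β} {g : α → β} (hf : Primrec f) (hg : Primrec g) :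
    Primrec fun a => (f a).getD (g a) := Primrec.option_getD.comp hf hg
@[fun_prop] theorem pr_length {f : α → List β} (hf : Primrec f) :
    Primrec fun a => (f a).length := Primrec.list_length.comp hf
@[fun_prop] theorem pr_range {f : α → ℕ} (hf : Primrec f) :
    Primrec fun a => List.range (f a) := Primrec.list_range.comp hf

@[fun_prop] theorem pr_pow {f g : α → ℕ} (hf : Primrec f) (hg : Primrec g) :
    Primrec fun a => f a ^ g a := by
  have h : Primrec₂ (fun x n : ℕ => x ^ n) := by
    refine (Primrec.nat_rec (f := fun _ : ℕ => 1) (g := fun (x : ℕ) (p : ℕ × ℕ) => p.2 * x)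
      (Primrec.const _) (by unfold Primrec₂; fun_prop)).of_eq (fun x n => ?_)
    induction n with
    | zero => rfl
    | succ n ih => simp only [pow_succ, ← ih]
  exact h.comp hf hg

@[fun_prop] theorem pp_eq [DecidableEq β] {f g : α → β} (hf : Primrec f) (hg : Primrec g) :
    PrimrecPred fun a => f a = g a := PrimrecRel.comp Primrec.eq hf hg
@[fun_prop] theorem pp_lt {f g : α → ℕ} (hf : Primrec f) (hg : Primrec g) :
    PrimrecPred fun a => f a < g a := PrimrecRel.comp Primrec.nat_lt hf hg
@[fun_prop] theorem pp_le {f g : α → ℕ} (hf : Primrec f) (hg : Primrec g) :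
    PrimrecPred fun a => f a ≤ g a := PrimrecRel.comp Primrec.nat_le hf hg
@[fun_prop] theorem pp_and {p q : α → Prop} (hf : PrimrecPred p) (hg : PrimrecPred q) :
    PrimrecPred fun a => p a ∧ q a := PrimrecPred.and hf hg
@[fun_prop] theorem pp_or {p q : α → Prop} (hf : PrimrecPred p) (hg : PrimrecPred q) :
    PrimrecPred fun a => p a ∨ q a := PrimrecPred.or hf hg
@[fun_prop] theorem pp_not {p : α → Prop} (hf : PrimrecPred p) :
    PrimrecPred fun a => ¬ p a := PrimrecPred.not hf
@[fun_prop] theorem pp_imp {p q : α → Prop} (hf : PrimrecPred p) (hg : PrimrecPred q) :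
    PrimrecPred fun a => p a → q a := by
  classical
  exact (PrimrecPred.or hf.not hg).of_eq (fun a => by tauto)

@[fun_prop] theorem pp_bex {R : ℕ → α → Prop} {f : α → ℕ} (hf : Primrec f)
    (hg : PrimrecPred fun a : ℕ × α => R a.1 a.2) :
    PrimrecPred fun a => ∃ x < f a, R x a := by
  have h := PrimrecRel.comp (PrimrecRel.exists_mem_list (R := R) hg)
    (pr_range hf) Primrec.id
  exact h.of_eq (fun a => by simp)

@[fun_prop] theorem pp_ball {R : ℕ → α → Prop} {f : α → ℕ} (hf : Primrec f)
    (hg : PrimrecPred fun a : ℕ × α => R a.1 a.2) :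
    PrimrecPred fun a => ∀ x < f a, R x a := by
  have h := PrimrecRel.comp (PrimrecRel.forall_mem_list (R := R) hg)
    (pr_range hf) Primrec.id
  exact h.of_eq (fun a => by simp)

theorem PrimrecPred.cmp {R : β → Prop} (h : PrimrecPred R) {f : α → β} (hf : Primrec f) :
    PrimrecPred fun a => R (f a) := PrimrecPred.comp h hf

/-- Recursively enumerable relations, via a primitive recursive matrix. -/
def RE (R : α → Prop) : Prop :=
  ∃ D : ℕ → α → Prop, PrimrecPred (fun p : ℕ × α => D p.1 p.2) ∧ ∀ a, R a ↔ ∃ n, D n a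

theorem RE.of_pp {R : α → Prop} (h : PrimrecPred R) : RE R :=
  ⟨fun _ a => R a, PrimrecPred.comp h Primrec.snd, fun a => by simp⟩

theorem RE.congr {R R' : α → Prop} (h : RE R) (hR : ∀ a, R' a ↔ R a) : RE R' := by
  obtain ⟨D, h1, h2⟩ := h
  exact ⟨D, h1, fun a => (hR a).trans (h2 a)⟩

theorem RE.comp {R : β → Prop} (h : RE R) {f : α → β} (hf : Primrec f) :
    RE fun a => R (f a) := by
  obtain ⟨D, h1, h2⟩ := h
  exact ⟨fun n a => D n (f a), PrimrecPred.cmp (R := fun p : ℕ × β => D p.1 p.2)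
    (f := fun p : ℕ × α => (p.1, f p.2)) h1 (by fun_prop), fun a => h2 _⟩

theorem RE.and {R R' : α → Prop} (h : RE R) (h' : RE R') : RE fun a => R a ∧ R' a := by
  obtain ⟨D, h1, h2⟩ := h
  obtain ⟨D', h1', h2'⟩ := h'
  refine ⟨fun n a => D n.unpair.1 a ∧ D' n.unpair.2 a, ?_, fun a => ?_⟩
  · exact (PrimrecPred.cmp h1 (f := fun p : ℕ × α => (p.1.unpair.1, p.2)) (by fun_prop)).and
      (PrimrecPred.cmp h1' (f := fun p : ℕ × α => (p.1.unpair.2, p.2)) (by fun_prop))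
  · simp only [h2, h2']
    constructor
    · rintro ⟨⟨x, hx⟩, ⟨y, hy⟩⟩
      exact ⟨Nat.pair x y, by simpa using ⟨hx, hy⟩⟩
    · rintro ⟨n, hx, hy⟩
      exact ⟨⟨_, hx⟩, ⟨_, hy⟩⟩

theorem RE.or {R R' : α → Prop} (h : RE R) (h' : RE R') : RE fun a => R a ∨ R' a := by
  obtain ⟨D, h1, h2⟩ := h
  obtain ⟨D', h1', h2'⟩ := h'
  refine ⟨fun n a => D n a ∨ D' n a, h1.or h1', fun a => ?_⟩
  simp only [h2, h2', exists_or]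

theorem RE.ex {R : ℕ → α → Prop} (h : RE fun p : ℕ × α => R p.1 p.2) :
    RE fun a => ∃ x, R x a := by
  obtain ⟨D, h1, h2⟩ := h
  refine ⟨fun n a => D n.unpair.1 (n.unpair.2, a), ?_, fun a => ?_⟩
  · exact PrimrecPred.cmp h1 (f := fun p : ℕ × α => (p.1.unpair.1, (p.1.unpair.2, p.2)))
      (by fun_prop)
  · constructor
    · rintro ⟨x, hx⟩
      obtain ⟨n, hn⟩ := (h2 (x, a)).1 hx
      exact ⟨Nat.pair n x, by simpa using hn⟩
    · rintro ⟨n, hn⟩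
      exact ⟨_, (h2 _).2 ⟨_, hn⟩⟩

theorem RE.exList {R : List ℕ → α → Prop} (h : RE fun p : List ℕ × α => R p.1 p.2) :
    RE fun a => ∃ x, R x a := by
  have h1 : RE fun a => ∃ n : ℕ, R ((Encodable.decode n).getD []) a := by
    apply RE.ex (R := fun n a => R ((Encodable.decode n).getD []) a)
    exact h.comp (f := fun p : ℕ × α => ((Encodable.decode p.1).getD [], p.2))
      (Primrec.pair (Primrec.option_getD.comp (Primrec.decode.comp Primrec.fst)
        (Primrec.const _)) Primrec.snd)
  refine h1.congr (fun a => ⟨fun ⟨x, hx⟩ => ⟨Encodable.encode x, by simpa using hx⟩,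
    fun ⟨n, hn⟩ => ⟨_, hn⟩⟩)

theorem RE.ball {R : ℕ → α → Prop} {f : α → ℕ} (hf : Primrec f)
    (h : RE fun p : ℕ × α => R p.1 p.2) : RE fun a => ∀ x < f a, R x a := by
  obtain ⟨D, h1, h2⟩ := h
  refine ⟨fun n a => ∀ x < f a, ∃ k < n, D k (x, a), ?_, fun a => ?_⟩
  · have h3 : PrimrecPred fun p : ℕ × (ℕ × (ℕ × α)) => D p.1 (p.2.1, p.2.2.2) :=
      PrimrecPred.cmp h1 (f := fun p : ℕ × (ℕ × (ℕ × α)) => (p.1, (p.2.1, p.2.2.2)))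
        (by fun_prop)
    have h4 := pp_bex (R := fun k (p : ℕ × (ℕ × α)) => D k (p.1, p.2.2))
      (f := fun p => p.2.1) (by fun_prop) h3
    exact pp_ball (R := fun x (p : ℕ × α) => ∃ k < p.1, D k (x, p.2)) (f := fun p => f p.2)
      (by fun_prop) h4
  · constructor
    · intro h
      have key : ∀ N, (∀ x < N, R x a) → ∃ B, ∀ x < N, ∃ k < B, D k (x, a) := by
        intro N
        induction N with
        | zero => intro _; exact ⟨0, fun x hx => absurd hx (by omega)⟩
        | succ N ih =>
          intro h
          obtain ⟨B, hB⟩ := ih (fun x hx => h x (by omega))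
          obtain ⟨k, hk⟩ := (h2 (N, a)).1 (h N (by omega))
          refine ⟨max B (k + 1), fun x hx => ?_⟩
          rcases Nat.lt_or_ge x N with h' | h'
          · obtain ⟨k', hk', h''⟩ := hB x h'
            exact ⟨k', lt_of_lt_of_le hk' (le_max_left _ _), h''⟩
          · obtain rfl : x = N := by omega
            exact ⟨k, lt_of_lt_of_le (Nat.lt_succ_self k) (le_max_right _ _), hk⟩
      exact key _ h
    · rintro ⟨n, hn⟩ x hx
      obtain ⟨k, -, hk⟩ := hn x hx
      exact (h2 (x, a)).2 ⟨k, hk⟩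

theorem RE.bex {R : ℕ → α → Prop} {f : α → ℕ} (hf : Primrec f)
    (h : RE fun p : ℕ × α => R p.1 p.2) : RE fun a => ∃ x < f a, R x a :=
  RE.ex (R := fun x a => x < f a ∧ R x a) (RE.and (RE.of_pp (by fun_prop)) h)

end pr

/-! ### Inductively generated sets are r.e. -/

inductive Gen (B : ℕ → Prop) (St : ℕ → ℕ → ℕ → Prop) : ℕ → Prop
  | base {x} : B x → Gen B St x
  | step {x y z} : St x y z → Gen B St y → Gen B St z → Gen B St x

theorem RE.gen {B : ℕ → Prop} {St : ℕ → ℕ → ℕ → Prop} (hB : RE B)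
    (hSt : RE fun p : ℕ × ℕ × ℕ => St p.1 p.2.1 p.2.2) : RE (Gen B St) := by
  have main : RE fun x => ∃ L : List ℕ, (∃ i < L.length, x = L[i]?.getD 0) ∧
      ∀ i < L.length, (B (L[i]?.getD 0) ∨ ∃ j < i, ∃ k < i,
        St (L[i]?.getD 0) (L[j]?.getD 0) (L[k]?.getD 0)) := by
    apply RE.exList
    apply RE.and
    · exact RE.of_pp (by fun_prop)
    · apply RE.ball (by fun_prop)
      apply RE.or
      · exact hB.comp (by fun_prop)
      · apply RE.bex (by fun_prop)
        apply RE.bex (by fun_prop)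
        exact hSt.comp (f := fun p : ℕ × ℕ × ℕ × List ℕ × ℕ => (p.2.2.2.1[p.2.2.1]?.getD 0,
          p.2.2.2.1[p.2.1]?.getD 0, p.2.2.2.1[p.1]?.getD 0)) (by fun_prop)
  refine main.congr (fun x => ?_)
  constructor
  · intro h
    induction h with
    | @base x h =>
      refine ⟨[x], ⟨0, by simp⟩, ?_⟩
      intro i hi
      obtain rfl : i = 0 := by simpa using hi
      left; simpa using h
    | @step x y z h _ _ ih1 ih2 =>
      obtain ⟨L1, ⟨i1, hi1, rfl⟩, h1⟩ := ih1
      obtain ⟨L2, ⟨i2, hi2, rfl⟩, h2⟩ := ih2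
      have e1 : ∀ i < L1.length, (L1 ++ L2 ++ [x])[i]?.getD 0 = L1[i]?.getD 0 := by
        intro i hi
        rw [List.append_assoc, List.getElem?_append_left hi]
      have e2 : ∀ i < L2.length, (L1 ++ L2 ++ [x])[L1.length + i]?.getD 0 = L2[i]?.getD 0 := by
        intro i hi
        rw [List.append_assoc, List.getElem?_append_right (by omega), Nat.add_sub_cancel_left,
          List.getElem?_append_left hi]
      have e3 : (L1 ++ L2 ++ [x])[L1.length + L2.length]?.getD 0 = x := by
        rw [List.getElem?_append_right (by simp)]
        simp
      refine ⟨L1 ++ L2 ++ [x], ⟨L1.length + L2.length, by simp, e3.symm⟩, fun i hi => ?_⟩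
      simp only [List.length_append, List.length_cons, List.length_nil] at hi
      rcases Nat.lt_or_ge i L1.length with h' | h'
      · rw [e1 i h']
        rcases h1 i h' with h'' | ⟨j, hj, k, hk, h''⟩
        · exact Or.inl h''
        · refine Or.inr ⟨j, hj, k, hk, ?_⟩
          rw [e1 j (by omega), e1 k (by omega)]; exact h''
      · obtain ⟨i, rfl⟩ := Nat.exists_eq_add_of_le h'
        rcases Nat.lt_or_ge i L2.length with h'' | h''
        · rw [e2 i h'']
          rcases h2 i h'' with h3 | ⟨j, hj, k, hk, h3⟩
          · exact Or.inl h3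
          · refine Or.inr ⟨L1.length + j, by omega, L1.length + k, by omega, ?_⟩
            rw [e2 j (by omega), e2 k (by omega)]; exact h3
        · obtain rfl : i = L2.length := by omega
          rw [e3]
          refine Or.inr ⟨i1, by omega, L1.length + i2, by omega, ?_⟩
          rw [e1 i1 hi1, e2 i2 hi2]; exact h
  · rintro ⟨L, ⟨i, hi, rfl⟩, h⟩
    induction i using Nat.strong_induction_on with
    | _ i ih =>
      rcases h i hi with h' | ⟨j, hj, k, hk, h'⟩
      · exact .base h'
      · exact .step h' (ih j hj (by omega)) (ih k hk (by omega))

/-! ### R.e. relations are defined by `Σ₁` formulas -/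

theorem RE.delta2 {R : ℕ → ℕ → Prop} (h : RE fun p : ℕ × ℕ => R p.1 p.2) :
    ∃ δ, IsDelta0 δ ∧ δ.FreeLt 3 ∧ ∀ a q, R a q ↔ ∃ w, strN.sat (lenv 0 [w, a, q]) δ := by
  obtain ⟨D, h1, h2⟩ := h
  classical
  have hf : Primrec (fun x : ℕ => if D x.unpair.1 x.unpair.2.unpair then 1 else 0) :=
    Primrec.ite (PrimrecPred.cmp h1 (f := fun x : ℕ => (x.unpair.1, x.unpair.2.unpair))
      (by fun_prop)) (Primrec.const _) (Primrec.const _)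
  have hs := s1_primrec (Primrec.nat_iff.1 hf)
  have hall := ((d0_pair.sub 5 [.var 3, .var 4, .var 1] (by simp [ATerm.FreeLt])).s1.and
    ((d0_pair.sub 5 [.var 2, .var 1, .var 0] (by simp [ATerm.FreeLt])).s1.and
    (hs.sub 5 [.var 0, .succ .zero] (by simp [ATerm.FreeLt])))).ex.ex.ex
  obtain ⟨δ, d1, d2, d3⟩ := hall
  refine ⟨δ, d1, d2, fun a q => ?_⟩
  refine Iff.trans ?_ (d3 (lenv 0 [a, q]))
  show _ ↔ ∃ n p r, Nat.pair a q = p ∧ Nat.pair n p = r ∧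
    (if D r.unpair.1 r.unpair.2.unpair then 1 else 0) = 1
  refine (h2 (a, q)).trans ?_
  constructor
  · rintro ⟨n, hn⟩
    refine ⟨n, _, _, rfl, rfl, ?_⟩
    simp [hn]
  · rintro ⟨n, p, r, rfl, rfl, h⟩
    refine ⟨n, ?_⟩
    simpa using h

theorem RE.delta3 {R : ℕ → ℕ → ℕ → Prop} (h : RE fun p : ℕ × ℕ × ℕ => R p.1 p.2.1 p.2.2) :
    ∃ δ, IsDelta0 δ ∧ δ.FreeLt 4 ∧
      ∀ a b q, R a b q ↔ ∃ w, strN.sat (lenv 0 [w, a, b, q]) δ := by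
  obtain ⟨D, h1, h2⟩ := h
  classical
  have hf : Primrec (fun x : ℕ => if D x.unpair.1 (x.unpair.2.unpair.1,
      x.unpair.2.unpair.2.unpair) then 1 else 0) :=
    Primrec.ite (PrimrecPred.cmp h1 (f := fun x : ℕ => (x.unpair.1, (x.unpair.2.unpair.1,
      x.unpair.2.unpair.2.unpair))) (by fun_prop)) (Primrec.const _) (Primrec.const _)
  have hs := s1_primrec (Primrec.nat_iff.1 hf)
  -- context r, p, p', n, a, b, q
  have hall := ((d0_pair.sub 7 [.var 5, .var 6, .var 2] (by simp [ATerm.FreeLt])).s1.and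
    ((d0_pair.sub 7 [.var 4, .var 2, .var 1] (by simp [ATerm.FreeLt])).s1.and
    ((d0_pair.sub 7 [.var 3, .var 1, .var 0] (by simp [ATerm.FreeLt])).s1.and
    (hs.sub 7 [.var 0, .succ .zero] (by simp [ATerm.FreeLt]))))).ex.ex.ex.ex
  obtain ⟨δ, d1, d2, d3⟩ := hall
  refine ⟨δ, d1, d2, fun a b q => ?_⟩
  refine Iff.trans ?_ (d3 (lenv 0 [a, b, q]))
  show _ ↔ ∃ n p' p r, Nat.pair b q = p' ∧ Nat.pair a p' = p ∧ Nat.pair n p = r ∧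
    (if D r.unpair.1 (r.unpair.2.unpair.1, r.unpair.2.unpair.2.unpair) then 1 else 0) = 1
  refine (h2 (a, b, q)).trans ?_
  constructor
  · rintro ⟨n, hn⟩
    refine ⟨n, _, _, _, rfl, rfl, rfl, ?_⟩
    simp [hn]
  · rintro ⟨n, p', p, r, rfl, rfl, rfl, h⟩
    refine ⟨n, ?_⟩
    simpa using h



/-! ### Boolean evaluation of codes -/

def bit (V x : ℕ) : ℕ := V / 2 ^ x % 2

@[fun_prop] theorem pr_bit {α : Type} [Primcodable α] {f g : α → ℕ} (hf : Primrec f)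
    (hg : Primrec g) : Primrec fun a => bit (f a) (g a) := by
  unfold bit; fun_prop

theorem bit_lt (V x : ℕ) : bit V x < 2 := Nat.mod_lt _ (by norm_num)

theorem exists_bits (p : ℕ → Prop) (N : ℕ) :
    ∃ V < 2 ^ N, ∀ x, bit V x = 1 ↔ (x < N ∧ p x) := by
  classical
  induction N with
  | zero => exact ⟨0, by simp, fun x => by simp [bit]⟩
  | succ N ih =>
    obtain ⟨V, hV, h⟩ := ih
    have hlt : ∀ x, N ≤ x → V / 2 ^ x = 0 := fun x hx =>
      Nat.div_eq_of_lt (lt_of_lt_of_le hV (Nat.pow_le_pow_right (by norm_num) hx))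
    by_cases hp : p N
    · refine ⟨V + 2 ^ N, by rw [pow_succ]; omega, fun x => ?_⟩
      rcases lt_trichotomy x N with hx | rfl | hx
      · have : bit (V + 2 ^ N) x = bit V x := by
          unfold bit
          obtain ⟨k, rfl⟩ := Nat.exists_eq_add_of_lt hx
          have : 2 ^ (x + k + 1) = 2 ^ x * (2 * 2 ^ k) := by ring
          rw [this, Nat.add_mul_div_left _ _ (by positivity), Nat.add_mul_mod_self_left]
        rw [this, h]
        exact ⟨fun h => ⟨by omega, h.2⟩, fun h => ⟨hx, h.2⟩⟩
      · have : bit (V + 2 ^ x) x = 1 := by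
          unfold bit
          rw [Nat.add_div_right _ (by positivity), hlt x le_rfl]
        simp [this, hp]
      · have : bit (V + 2 ^ N) x = 0 := by
          unfold bit
          rw [Nat.div_eq_of_lt]
          calc V + 2 ^ N < 2 ^ (N + 1) := by rw [pow_succ]; omega
            _ ≤ 2 ^ x := Nat.pow_le_pow_right (by norm_num) hx
        rw [this]
        constructor
        · intro h; omega
        · intro h; omega
    · refine ⟨V, by rw [pow_succ]; omega, fun x => ?_⟩
      rw [h]
      constructor
      · intro h; exact ⟨by omega, h.2⟩
      · rintro ⟨h1, h2⟩
        refine ⟨?_, h2⟩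
        rcases Nat.lt_or_ge x N with h' | h'
        · exact h'
        · obtain rfl : x = N := by omega
          exact absurd h2 hp

def vneg (v : ℕ) : ℕ := if v = 2 then 2 else 1 - v
def vop (i v w : ℕ) : ℕ :=
  if v = 2 ∨ w = 2 then 2 else
  if i = 3 then (if v = 1 ∧ w = 1 then 1 else 0) else
  if i = 4 then (if v = 1 ∨ w = 1 then 1 else 0) else
  (if v = 0 ∨ w = 1 then 1 else 0)

theorem lt_of_tag {c : ℕ} (h : c.unpair.1 ≠ 0) : c.unpair.2 < c := by
  have h1 := Nat.add_le_pair c.unpair.1 c.unpair.2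
  rw [Nat.pair_unpair] at h1
  omega

/-- Three-valued evaluation of (codes of) Boolean combinations: 0 false, 1 true, 2 undefined. -/
def evC (At : ℕ → ℕ) (c : ℕ) : ℕ :=
  if _h : c.unpair.1 = 2 then vneg (evC At c.unpair.2)
  else if _h : 3 ≤ c.unpair.1 ∧ c.unpair.1 ≤ 5 then
    vop c.unpair.1 (evC At c.unpair.2.unpair.1) (evC At c.unpair.2.unpair.2)
  else At c
termination_by c
decreasing_by
  · exact lt_of_tag (by omega)
  · exact lt_of_le_of_lt (Nat.unpair_left_le _) (lt_of_tag (by omega))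
  · exact lt_of_le_of_lt (Nat.unpair_right_le _) (lt_of_tag (by omega))

theorem evC_congr {At At' : ℕ → ℕ} (c : ℕ) (h : ∀ x ≤ c, At x = At' x) : evC At c = evC At' c := by
  induction c using Nat.strong_induction_on with
  | _ c ih =>
    conv_lhs => rw [evC]
    conv_rhs => rw [evC]
    split_ifs with h1 h2
    · have := lt_of_tag (c := c) (by omega)
      rw [ih _ this (fun x hx => h x (by omega))]
    · have := lt_of_tag (c := c) (by omega)
      have h3 := Nat.unpair_left_le c.unpair.2
      have h4 := Nat.unpair_right_le c.unpair.2
      rw [ih _ (by omega) (fun x hx => h x (by omega)),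
        ih c.unpair.2.unpair.2 (by omega) (fun x hx => h x (by omega))]
    · exact h c le_rfl

theorem pr_evC {α : Type} [Primcodable α] {At : α → ℕ → ℕ}
    (hAt : Primrec fun p : α × ℕ => At p.1 p.2) : Primrec fun p : α × ℕ => evC (At p.1) p.2 := by
  have hg : Primrec₂ (fun (a : α) (L : List ℕ) =>
      some (if L.length.unpair.1 = 2 then vneg (L[L.length.unpair.2]?.getD 0)
      else if 3 ≤ L.length.unpair.1 ∧ L.length.unpair.1 ≤ 5 then
        vop L.length.unpair.1 (L[L.length.unpair.2.unpair.1]?.getD 0)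
          (L[L.length.unpair.2.unpair.2]?.getD 0)
      else At a L.length)) := by
    unfold Primrec₂ vneg vop
    fun_prop
  refine Primrec.nat_strong_rec (fun a c => evC (At a) c) hg (fun a n => ?_)
  rw [evC]
  simp only [List.length_map, List.length_range]
  have key : ∀ i < n, (List.map (fun c => evC (At a) c) (List.range n))[i]?.getD 0 =
      evC (At a) i := by
    intro i hi
    simp [hi]
  split_ifs with h1 h2
  · rw [key _ (lt_of_tag (by omega))]
  · have := lt_of_tag (c := n) (by omega)
    have h3 := Nat.unpair_left_le n.unpair.2
    have h4 := Nat.unpair_right_le n.unpair.2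
    rw [key _ (by omega), key _ (by omega)]
  · rfl

theorem evC_neg (At : ℕ → ℕ) (φ : AFml) : evC At (AFml.neg φ).code = vneg (evC At φ.code) := by
  rw [evC]; simp [AFml.code]
theorem evC_and (At : ℕ → ℕ) (φ ψ : AFml) :
    evC At (AFml.and φ ψ).code = vop 3 (evC At φ.code) (evC At ψ.code) := by
  rw [evC]; simp [AFml.code]
theorem evC_or (At : ℕ → ℕ) (φ ψ : AFml) :
    evC At (AFml.or φ ψ).code = vop 4 (evC At φ.code) (evC At ψ.code) := by
  rw [evC]; simp [AFml.code]
theorem evC_imp (At : ℕ → ℕ) (φ ψ : AFml) :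
    evC At (AFml.imp φ ψ).code = vop 5 (evC At φ.code) (evC At ψ.code) := by
  rw [evC]; simp [AFml.code]
theorem evC_atom (At : ℕ → ℕ) (c : ℕ) (h : c.unpair.1 < 2 ∨ 5 < c.unpair.1) :
    evC At c = At c := by
  rw [evC]; rw [dif_neg (by omega), dif_neg (by omega)]

theorem evC_evalProp (At : ℕ → ℕ) (hAt : ∀ x, At x < 2) (φ : AFml) :
    evC At φ.code < 2 ∧ (evC At φ.code = 1 ↔ φ.evalProp (fun ψ => At ψ.code = 1)) := by
  induction φ with
  | eq t s => rw [evC_atom _ _ (by simp [AFml.code])]; exact ⟨hAt _, Iff.rfl⟩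
  | le t s => rw [evC_atom _ _ (by simp [AFml.code])]; exact ⟨hAt _, Iff.rfl⟩
  | all φ => rw [evC_atom _ _ (by simp [AFml.code])]; exact ⟨hAt _, Iff.rfl⟩
  | ex φ => rw [evC_atom _ _ (by simp [AFml.code])]; exact ⟨hAt _, Iff.rfl⟩
  | neg φ ih =>
    rw [evC_neg, AFml.evalProp, ← ih.2]
    have := ih.1
    unfold vneg; split_ifs <;> omega
  | and φ ψ ih ih' =>
    rw [evC_and, AFml.evalProp, ← ih.2, ← ih'.2]
    have h1 := ih.1
    have h2 := ih'.1
    generalize evC At φ.code = v at h1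
    generalize evC At ψ.code = w at h2
    interval_cases v <;> interval_cases w <;> simp [vop]
  | or φ ψ ih ih' =>
    rw [evC_or, AFml.evalProp, ← ih.2, ← ih'.2]
    have h1 := ih.1
    have h2 := ih'.1
    generalize evC At φ.code = v at h1
    generalize evC At ψ.code = w at h2
    interval_cases v <;> interval_cases w <;> simp [vop]
  | imp φ ψ ih ih' =>
    rw [evC_imp, AFml.evalProp, ← ih.2, ← ih'.2]
    have h1 := ih.1
    have h2 := ih'.1
    generalize evC At φ.code = v at h1
    generalize evC At ψ.code = w at h2
    interval_cases v <;> interval_cases w <;> simp [vop]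

theorem evalProp_congr {v v' : AFml → Prop} (φ : AFml) (h : ∀ ψ : AFml, ψ.code ≤ φ.code → (v ψ ↔ v' ψ)) :
    φ.evalProp v ↔ φ.evalProp v' := by
  have hp : ∀ i a b, a ≤ Nat.pair i (Nat.pair a b) ∧ b ≤ Nat.pair i (Nat.pair a b) := by
    intro i a b
    have h1 := Nat.right_le_pair i (Nat.pair a b)
    have h2 := Nat.right_le_pair a b
    have h3 := Nat.left_le_pair a b
    omega
  induction φ with
  | eq t s => exact h _ le_rfl
  | le t s => exact h _ le_rfl
  | all φ => exact h _ le_rfl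
  | ex φ => exact h _ le_rfl
  | neg φ ih =>
    exact not_congr (ih fun ψ hψ => h ψ (hψ.trans (Nat.right_le_pair _ _)))
  | and φ ψ ih ih' =>
    exact and_congr (ih fun χ hχ => h χ (hχ.trans (hp _ _ _).1))
      (ih' fun χ hχ => h χ (hχ.trans (hp _ _ _).2))
  | or φ ψ ih ih' =>
    exact or_congr (ih fun χ hχ => h χ (hχ.trans (hp _ _ _).1))
      (ih' fun χ hχ => h χ (hχ.trans (hp _ _ _).2))
  | imp φ ψ ih ih' =>
    exact imp_congr (ih fun χ hχ => h χ (hχ.trans (hp _ _ _).1))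
      (ih' fun χ hχ => h χ (hχ.trans (hp _ _ _).2))

def tautC (c : ℕ) : Prop := ∀ V < 2 ^ (c + 1), evC (bit V) c = 1

theorem pp_tautC : PrimrecPred tautC := by
  have h : Primrec fun p : ℕ × ℕ => evC (bit p.1) p.2 := pr_evC (At := bit) (by fun_prop)
  exact pp_ball (R := fun V c => evC (bit V) c = 1) (f := fun c => 2 ^ (c + 1)) (by fun_prop)
    (by fun_prop)

theorem tautC_iff (φ : AFml) : tautC φ.code ↔ ATaut φ := by
  constructor
  · intro h v
    obtain ⟨V, hV, hb⟩ := exists_bits (fun x => ∃ ψ : AFml, ψ.code = x ∧ v ψ) (φ.code + 1)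
    have h1 := (evC_evalProp (bit V) (bit_lt V) φ).2.1 (h V hV)
    refine (evalProp_congr φ (fun ψ hψ => ?_)).1 h1
    rw [hb]
    constructor
    · rintro ⟨_, χ, hχ, hv⟩
      rwa [AFml.code_injective hχ] at hv
    · intro hv
      exact ⟨by omega, ψ, rfl, hv⟩
  · intro h V _
    exact (evC_evalProp (bit V) (bit_lt V) φ).2.2 (h _)



/-! ### The set of (codes of) theorems is r.e. -/

/-- The substitutions needed: mode `0` lifts above `c`, mode `≠ 0` substitutes `τ` for `c`. -/
def envS (k c : ℕ) (τ : ATerm) (n : ℕ) : ATerm :=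
  if n < c then .var n else if k = 0 then .var (n + 1) else if n = c then τ else .var (n - 1)

def envC (k c T n : ℕ) : ℕ :=
  if n < c then Nat.pair 0 n else if k = 0 then Nat.pair 0 (n + 1) else
    if n = c then T else Nat.pair 0 (n - 1)

theorem envS_code (k c : ℕ) (τ : ATerm) (n : ℕ) : (envS k c τ n).code = envC k c τ.code n := by
  unfold envS envC; split_ifs <;> rfl

theorem liftSub_envS (k c : ℕ) (τ : ATerm) :
    liftSub (envS k c τ) = envS k (c + 1) (τ.lift 0) := by
  funext n
  cases n with
  | zero => simp [liftSub, envS]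
  | succ n =>
    simp only [liftSub, envS]
    split_ifs <;> first | omega | simp [ATerm.lift] | skip
    all_goals first | omega | skip

theorem subst0Env_eq (t : ATerm) : subst0Env t = envS 1 0 t := by
  funext n; cases n <;> simp [subst0Env, envS]

theorem lift0_envS (φ : AFml) : φ.lift 0 = φ.substAll (envS 0 0 .zero) := by
  rw [AFml.lift0_eq]; congr

theorem tlift0_envS (t : ATerm) : t.lift 0 = t.substAll (envS 0 0 .zero) := by
  rw [ATerm.lift0_eq]; congr

def TmR : ℕ → Prop := Gen (fun x => (∃ n, x = Nat.pair 0 n) ∨ x = Nat.pair 1 0)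
  (fun x y z => x = Nat.pair 2 y ∨ x = Nat.pair 3 (Nat.pair y z) ∨ x = Nat.pair 4 (Nat.pair y z))

theorem re_TmR : RE TmR := by
  apply RE.gen
  · apply RE.or
    · apply RE.ex; exact RE.of_pp (by fun_prop)
    · exact RE.of_pp (by fun_prop)
  · exact RE.of_pp (by fun_prop)

theorem TmR_iff (x : ℕ) : TmR x ↔ ∃ t : ATerm, x = t.code := by
  constructor
  · intro h
    induction h with
    | base h =>
      rcases h with ⟨n, rfl⟩ | rfl
      · exact ⟨.var n, rfl⟩
      · exact ⟨.zero, rfl⟩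
    | step h _ _ ih1 ih2 =>
      obtain ⟨t, rfl⟩ := ih1
      obtain ⟨s, rfl⟩ := ih2
      rcases h with rfl | rfl | rfl
      · exact ⟨.succ t, rfl⟩
      · exact ⟨.add t s, rfl⟩
      · exact ⟨.mul t s, rfl⟩
  · rintro ⟨t, rfl⟩
    induction t with
    | var n => exact .base (Or.inl ⟨n, rfl⟩)
    | zero => exact .base (Or.inr rfl)
    | succ t ih => exact .step (Or.inl rfl) ih ih
    | add t s ih1 ih2 => exact .step (Or.inr (Or.inl rfl)) ih1 ih2
    | mul t s ih1 ih2 => exact .step (Or.inr (Or.inr rfl)) ih1 ih2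

def jd (i k c T x y : ℕ) : ℕ :=
  Nat.pair i (Nat.pair k (Nat.pair c (Nat.pair T (Nat.pair x y))))

theorem jd_inj {i k c T x y i' k' c' T' x' y' : ℕ} :
    jd i k c T x y = jd i' k' c' T' x' y' ↔
      i = i' ∧ k = k' ∧ c = c' ∧ T = T' ∧ x = x' ∧ y = y' := by
  simp [jd, Nat.pair_eq_pair]

def JB (x : ℕ) : Prop := ∃ k c T n, TmR T ∧
  (x = jd 0 k c T (Nat.pair 0 n) (envC k c T n) ∨ x = jd 0 k c T (Nat.pair 1 0) (Nat.pair 1 0))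

def JS (x y z : ℕ) : Prop := ∃ k c T a a' b b' i,
  (y = jd 0 k c T a a' ∧ z = jd 0 k c T b b' ∧
    (x = jd 0 k c T (Nat.pair 2 a) (Nat.pair 2 a') ∨
    ((i = 3 ∨ i = 4) ∧
      x = jd 0 k c T (Nat.pair i (Nat.pair a b)) (Nat.pair i (Nat.pair a' b'))) ∨
    ((i = 0 ∨ i = 1) ∧
      x = jd 1 k c T (Nat.pair i (Nat.pair a b)) (Nat.pair i (Nat.pair a' b'))))) ∨
  (y = jd 1 k c T a a' ∧ z = jd 1 k c T b b' ∧
    (x = jd 1 k c T (Nat.pair 2 a) (Nat.pair 2 a') ∨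
    ((i = 3 ∨ i = 4 ∨ i = 5) ∧
      x = jd 1 k c T (Nat.pair i (Nat.pair a b)) (Nat.pair i (Nat.pair a' b'))))) ∨
  (y = jd 1 k (c + 1) b a a' ∧ z = jd 0 0 0 (Nat.pair 1 0) T b ∧ (i = 6 ∨ i = 7) ∧
      x = jd 1 k c T (Nat.pair i a) (Nat.pair i a'))

def JR : ℕ → Prop := Gen JB JS

theorem re_JR : RE JR := by
  apply RE.gen
  · unfold JB
    apply RE.ex; apply RE.ex; apply RE.ex; apply RE.ex
    apply RE.and
    · exact re_TmR.comp (by fun_prop)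
    · exact RE.of_pp (by unfold jd envC; fun_prop)
  · unfold JS
    apply RE.ex; apply RE.ex; apply RE.ex; apply RE.ex
    apply RE.ex; apply RE.ex; apply RE.ex; apply RE.ex
    exact RE.of_pp (by unfold jd; fun_prop)

def JX (x : ℕ) : Prop :=
  (∃ k c, ∃ τ t : ATerm, x = jd 0 k c τ.code t.code (t.substAll (envS k c τ)).code) ∨
  (∃ k c, ∃ τ : ATerm, ∃ φ : AFml, x = jd 1 k c τ.code φ.code (φ.substAll (envS k c τ)).code)

theorem JX.inv0 {k c T a a' : ℕ} (h : JX (jd 0 k c T a a')) :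
    ∃ τ t : ATerm, T = τ.code ∧ a = t.code ∧ a' = (t.substAll (envS k c τ)).code := by
  rcases h with ⟨k', c', τ, t, h⟩ | ⟨k', c', τ, t, h⟩
  · obtain ⟨-, rfl, rfl, h1, h2, h3⟩ := jd_inj.1 h
    exact ⟨τ, t, h1, h2, h3⟩
  · exact absurd (jd_inj.1 h).1 (by norm_num)

theorem JX.inv1 {k c T a a' : ℕ} (h : JX (jd 1 k c T a a')) :
    ∃ (τ : ATerm) (t : AFml), T = τ.code ∧ a = t.code ∧ a' = (t.substAll (envS k c τ)).code := by
  rcases h with ⟨k', c', τ, t, h⟩ | ⟨k', c', τ, t, h⟩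
  · exact absurd (jd_inj.1 h).1 (by norm_num)
  · obtain ⟨-, rfl, rfl, h1, h2, h3⟩ := jd_inj.1 h
    exact ⟨τ, t, h1, h2, h3⟩

theorem JR_sound {x : ℕ} (h : JR x) : JX x := by
  induction h with
  | base h =>
    obtain ⟨k, c, T, n, hT, h⟩ := h
    obtain ⟨τ, rfl⟩ := (TmR_iff T).1 hT
    rcases h with rfl | rfl
    · exact Or.inl ⟨k, c, τ, .var n, by simp only [ATerm.substAll, envS_code, ATerm.code]⟩
    · exact Or.inl ⟨k, c, τ, .zero, rfl⟩
  | step h _ _ ih1 ih2 =>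
    obtain ⟨k, c, T, a, a', b, b', i, h⟩ := h
    rcases h with ⟨rfl, rfl, h⟩ | ⟨rfl, rfl, h⟩ | ⟨rfl, rfl, hi, rfl⟩
    · obtain ⟨τ, t, rfl, rfl, rfl⟩ := ih1.inv0
      obtain ⟨τ', s, hτ, rfl, rfl⟩ := ih2.inv0
      obtain rfl := ATerm.code_injective hτ
      rcases h with rfl | ⟨rfl | rfl, rfl⟩ | ⟨rfl | rfl, rfl⟩
      · exact Or.inl ⟨k, c, τ, .succ t, rfl⟩
      · exact Or.inl ⟨k, c, τ, .add t s, rfl⟩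
      · exact Or.inl ⟨k, c, τ, .mul t s, rfl⟩
      · exact Or.inr ⟨k, c, τ, .eq t s, rfl⟩
      · exact Or.inr ⟨k, c, τ, .le t s, rfl⟩
    · obtain ⟨τ, t, rfl, rfl, rfl⟩ := ih1.inv1
      obtain ⟨τ', s, hτ, rfl, rfl⟩ := ih2.inv1
      obtain rfl := ATerm.code_injective hτ
      rcases h with rfl | ⟨rfl | rfl | rfl, rfl⟩
      · exact Or.inr ⟨k, c, τ, .neg t, rfl⟩
      · exact Or.inr ⟨k, c, τ, .and t s, rfl⟩
      · exact Or.inr ⟨k, c, τ, .or t s, rfl⟩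
      · exact Or.inr ⟨k, c, τ, .imp t s, rfl⟩
    · obtain ⟨τ, φ, rfl, rfl, rfl⟩ := ih1.inv1
      obtain ⟨ζ, t, hζ, rfl, ht⟩ := ih2.inv0
      obtain rfl : ζ = .zero := ATerm.code_injective hζ.symm
      rw [← tlift0_envS] at ht
      obtain rfl := ATerm.code_injective ht
      rw [← liftSub_envS]
      rcases hi with rfl | rfl
      · exact Or.inr ⟨k, c, t, .all φ, rfl⟩
      · exact Or.inr ⟨k, c, t, .ex φ, rfl⟩

theorem JR_term (k c : ℕ) (τ t : ATerm) :
    JR (jd 0 k c τ.code t.code (t.substAll (envS k c τ)).code) := by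
  induction t with
  | var n =>
    exact .base ⟨k, c, τ.code, n, (TmR_iff _).2 ⟨τ, rfl⟩,
      Or.inl (by simp only [ATerm.substAll, envS_code, ATerm.code])⟩
  | zero => exact .base ⟨k, c, τ.code, 0, (TmR_iff _).2 ⟨τ, rfl⟩, Or.inr rfl⟩
  | succ t ih =>
    exact .step ⟨k, c, τ.code, _, _, _, _, 0, Or.inl ⟨rfl, rfl, Or.inl rfl⟩⟩ ih ih
  | add t s ih1 ih2 =>
    exact .step ⟨k, c, τ.code, _, _, _, _, 3,
      Or.inl ⟨rfl, rfl, Or.inr (Or.inl ⟨Or.inl rfl, rfl⟩)⟩⟩ ih1 ih2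
  | mul t s ih1 ih2 =>
    exact .step ⟨k, c, τ.code, _, _, _, _, 4,
      Or.inl ⟨rfl, rfl, Or.inr (Or.inl ⟨Or.inr rfl, rfl⟩)⟩⟩ ih1 ih2

theorem JR_fml (φ : AFml) : ∀ (k c : ℕ) (τ : ATerm),
    JR (jd 1 k c τ.code φ.code (φ.substAll (envS k c τ)).code) := by
  have quant : ∀ (φ : AFml) (k c i : ℕ) (τ : ATerm), (i = 6 ∨ i = 7) →
      JR (jd 1 k (c + 1) (τ.lift 0).code φ.code (φ.substAll (envS k (c + 1) (τ.lift 0))).code) →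
      JR (jd 1 k c τ.code (Nat.pair i φ.code)
        (Nat.pair i (φ.substAll (liftSub (envS k c τ))).code)) := by
    intro φ k c i τ hi h
    have h2 := JR_term 0 0 .zero τ
    rw [← tlift0_envS] at h2
    rw [liftSub_envS]
    exact .step ⟨k, c, τ.code, _, _, _, 0, i, Or.inr (Or.inr ⟨rfl, rfl, hi, rfl⟩)⟩ h h2
  induction φ with
  | eq t s =>
    intro k c τ
    exact .step ⟨k, c, τ.code, _, _, _, _, 0,
      Or.inl ⟨rfl, rfl, Or.inr (Or.inr ⟨Or.inl rfl, rfl⟩)⟩⟩ (JR_term k c τ t) (JR_term k c τ s)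
  | le t s =>
    intro k c τ
    exact .step ⟨k, c, τ.code, _, _, _, _, 1,
      Or.inl ⟨rfl, rfl, Or.inr (Or.inr ⟨Or.inr rfl, rfl⟩)⟩⟩ (JR_term k c τ t) (JR_term k c τ s)
  | neg φ ih =>
    intro k c τ
    exact .step ⟨k, c, τ.code, _, _, _, _, 0, Or.inr (Or.inl ⟨rfl, rfl, Or.inl rfl⟩)⟩
      (ih k c τ) (ih k c τ)
  | and φ ψ ih1 ih2 =>
    intro k c τ
    exact .step ⟨k, c, τ.code, _, _, _, _, 3,
      Or.inr (Or.inl ⟨rfl, rfl, Or.inr ⟨Or.inl rfl, rfl⟩⟩)⟩ (ih1 k c τ) (ih2 k c τ)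
  | or φ ψ ih1 ih2 =>
    intro k c τ
    exact .step ⟨k, c, τ.code, _, _, _, _, 4,
      Or.inr (Or.inl ⟨rfl, rfl, Or.inr ⟨Or.inr (Or.inl rfl), rfl⟩⟩)⟩ (ih1 k c τ) (ih2 k c τ)
  | imp φ ψ ih1 ih2 =>
    intro k c τ
    exact .step ⟨k, c, τ.code, _, _, _, _, 5,
      Or.inr (Or.inl ⟨rfl, rfl, Or.inr ⟨Or.inr (Or.inr rfl), rfl⟩⟩)⟩ (ih1 k c τ) (ih2 k c τ)
  | all φ ih => intro k c τ; exact quant φ k c 6 τ (Or.inl rfl) (ih _ _ _)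
  | ex φ ih => intro k c τ; exact quant φ k c 7 τ (Or.inr rfl) (ih _ _ _)

theorem JR_fml_iff {k c T a b : ℕ} : JR (jd 1 k c T a b) ↔
    ∃ (τ : ATerm) (φ : AFml), T = τ.code ∧ a = φ.code ∧ b = (φ.substAll (envS k c τ)).code :=
  ⟨fun h => (JR_sound h).inv1, fun ⟨τ, φ, h1, h2, h3⟩ => by subst h1 h2 h3; exact JR_fml φ k c τ⟩

def FmR (a : ℕ) : Prop := ∃ b, JR (jd 1 0 0 (Nat.pair 1 0) a b)

theorem FmR_iff (a : ℕ) : FmR a ↔ ∃ φ : AFml, a = φ.code := by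
  constructor
  · rintro ⟨b, h⟩
    obtain ⟨_, φ, _, h, _⟩ := JR_fml_iff.1 h
    exact ⟨φ, h⟩
  · rintro ⟨φ, rfl⟩
    exact ⟨_, JR_fml φ 0 0 .zero⟩

theorem re_FmR : RE FmR := by
  unfold FmR
  apply RE.ex
  exact re_JR.comp (by unfold jd; fun_prop)

def imC (a b : ℕ) : ℕ := Nat.pair 5 (Nat.pair a b)

def PB (p : ℕ → Bool) (x : ℕ) : Prop :=
  (FmR x ∧ tautC x) ∨ (FmR x ∧ p x = true) ∨
  (∃ T a b, JR (jd 1 1 0 T a b) ∧ (x = imC (Nat.pair 6 a) b ∨ x = imC b (Nat.pair 7 a))) ∨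
  (∃ a b, JR (jd 1 0 0 (Nat.pair 1 0) a b) ∧ x = imC a (Nat.pair 6 b)) ∨
  (∃ a b, FmR a ∧ FmR b ∧
    x = imC (Nat.pair 6 (imC a b)) (imC (Nat.pair 6 a) (Nat.pair 6 b))) ∨
  (∃ a, FmR a ∧ x = Nat.pair 3 (Nat.pair
    (imC (Nat.pair 7 a) (Nat.pair 2 (Nat.pair 6 (Nat.pair 2 a))))
    (imC (Nat.pair 2 (Nat.pair 6 (Nat.pair 2 a))) (Nat.pair 7 a)))) ∨
  (∃ T, TmR T ∧ x = Nat.pair 0 (Nat.pair T T)) ∨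
  (∃ T T' a b b', (JR (jd 1 1 0 T a b) ∧ JR (jd 1 1 0 T' a b')) ∧
    x = imC (Nat.pair 0 (Nat.pair T T')) (imC b b'))

theorem re_PB {p : ℕ → Bool} (hp : Primrec p) : RE (PB p) := by
  unfold PB imC
  apply RE.or
  · exact re_FmR.and (RE.of_pp pp_tautC)
  apply RE.or
  · exact re_FmR.and (RE.of_pp (by fun_prop))
  apply RE.or
  · apply RE.ex; apply RE.ex; apply RE.ex; apply RE.and
    · exact re_JR.comp (by unfold jd; fun_prop)
    · exact RE.of_pp (by fun_prop)
  apply RE.or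
  · apply RE.ex; apply RE.ex; apply RE.and
    · exact re_JR.comp (by unfold jd; fun_prop)
    · exact RE.of_pp (by fun_prop)
  apply RE.or
  · apply RE.ex; apply RE.ex; apply RE.and
    · exact re_FmR.comp (by fun_prop)
    · apply RE.and
      · exact re_FmR.comp (by fun_prop)
      · exact RE.of_pp (by fun_prop)
  apply RE.or
  · apply RE.ex; apply RE.and
    · exact re_FmR.comp (by fun_prop)
    · exact RE.of_pp (by fun_prop)
  apply RE.or
  · apply RE.ex; apply RE.and
    · exact re_TmR.comp (by fun_prop)
    · exact RE.of_pp (by fun_prop)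
  · apply RE.ex; apply RE.ex; apply RE.ex; apply RE.ex; apply RE.ex; apply RE.and
    · apply RE.and
      · exact re_JR.comp (by unfold jd; fun_prop)
      · exact re_JR.comp (by unfold jd; fun_prop)
    · exact RE.of_pp (by fun_prop)

def PrR (p : ℕ → Bool) : ℕ → Prop :=
  Gen (PB p) (fun x y z => y = imC z x ∨ x = Nat.pair 6 y)

theorem re_PrR {p : ℕ → Bool} (hp : Primrec p) : RE (PrR p) := by
  apply RE.gen (re_PB hp)
  exact RE.of_pp (by unfold imC; fun_prop)

theorem PrR_iff {Tax : Set AFml} {p : ℕ → Bool} (hp : ∀ φ : AFml, φ ∈ Tax ↔ p φ.code = true)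
    (x : ℕ) : PrR p x ↔ ∃ φ : AFml, x = φ.code ∧ Proves Tax φ := by
  constructor
  · intro h
    induction h with
    | base h =>
      rcases h with ⟨h1, h2⟩ | ⟨h1, h2⟩ | ⟨T, a, b, h, h2⟩ | ⟨a, b, h, rfl⟩ |
        ⟨a, b, h1, h2, rfl⟩ | ⟨a, h, rfl⟩ | ⟨T, h, rfl⟩ | ⟨T, T', a, b, b', ⟨h1, h2⟩, rfl⟩
      · obtain ⟨φ, rfl⟩ := (FmR_iff _).1 h1
        exact ⟨φ, rfl, .taut ((tautC_iff φ).1 h2)⟩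
      · obtain ⟨φ, rfl⟩ := (FmR_iff _).1 h1
        exact ⟨φ, rfl, .ax ((hp φ).2 h2)⟩
      · obtain ⟨τ, φ, rfl, rfl, rfl⟩ := JR_fml_iff.1 h
        rw [← subst0Env_eq] at h2
        rcases h2 with rfl | rfl
        · exact ⟨_, rfl, .allE φ τ⟩
        · exact ⟨_, rfl, .exI φ τ⟩
      · obtain ⟨τ, φ, hτ, rfl, rfl⟩ := JR_fml_iff.1 h
        obtain rfl : τ = .zero := ATerm.code_injective hτ.symm
        rw [← lift0_envS]
        exact ⟨_, rfl, .vacAll φ⟩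
      · obtain ⟨φ, rfl⟩ := (FmR_iff _).1 h1
        obtain ⟨ψ, rfl⟩ := (FmR_iff _).1 h2
        exact ⟨_, rfl, .allImp φ ψ⟩
      · obtain ⟨φ, rfl⟩ := (FmR_iff _).1 h
        exact ⟨_, rfl, .exDef φ⟩
      · obtain ⟨t, rfl⟩ := (TmR_iff _).1 h
        exact ⟨_, rfl, .eqRefl t⟩
      · obtain ⟨τ, φ, rfl, rfl, rfl⟩ := JR_fml_iff.1 h1
        obtain ⟨τ', φ', rfl, hφ, rfl⟩ := JR_fml_iff.1 h2
        obtain rfl := AFml.code_injective hφ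
        rw [← subst0Env_eq, ← subst0Env_eq]
        exact ⟨_, rfl, .eqSubst φ τ τ'⟩
    | step h _ _ ih1 ih2 =>
      obtain ⟨φ, rfl, h1⟩ := ih1
      obtain ⟨ψ, rfl, h2⟩ := ih2
      rcases h with h | rfl
      · cases φ <;> simp [AFml.code, imC, Nat.pair_eq_pair] at h
        obtain ⟨h3, rfl⟩ := h
        obtain rfl := AFml.code_injective h3
        exact ⟨_, rfl, .mp h1 h2⟩
      · exact ⟨_, rfl, .gen h1⟩
  · rintro ⟨φ, rfl, h⟩
    have hF : ∀ φ : AFml, FmR φ.code := fun φ => (FmR_iff _).2 ⟨φ, rfl⟩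
    induction h with
    | @ax φ h => exact .base (Or.inr (Or.inl ⟨hF φ, (hp φ).1 h⟩))
    | @taut φ h => exact .base (Or.inl ⟨hF φ, (tautC_iff φ).2 h⟩)
    | mp _ _ ih1 ih2 => exact .step (Or.inl rfl) ih1 ih2
    | gen _ ih => exact .step (Or.inr rfl) ih ih
    | allE φ t =>
      refine .base (Or.inr (Or.inr (Or.inl ⟨_, _, _, JR_fml φ 1 0 t, Or.inl ?_⟩)))
      rw [← subst0Env_eq]; rfl
    | exI φ t =>
      refine .base (Or.inr (Or.inr (Or.inl ⟨_, _, _, JR_fml φ 1 0 t, Or.inr ?_⟩)))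
      rw [← subst0Env_eq]; rfl
    | vacAll φ =>
      refine .base (Or.inr (Or.inr (Or.inr (Or.inl ⟨_, _, JR_fml φ 0 0 .zero, ?_⟩))))
      rw [← lift0_envS]; rfl
    | allImp φ ψ =>
      exact .base (Or.inr (Or.inr (Or.inr (Or.inr (Or.inl ⟨_, _, hF φ, hF ψ, rfl⟩)))))
    | exDef φ =>
      exact .base (Or.inr (Or.inr (Or.inr (Or.inr (Or.inr (Or.inl ⟨_, hF φ, rfl⟩))))))
    | eqRefl t =>
      exact .base (Or.inr (Or.inr (Or.inr (Or.inr (Or.inr (Or.inr (Or.inl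
        ⟨_, (TmR_iff _).2 ⟨t, rfl⟩, rfl⟩)))))))
    | eqSubst φ t s =>
      refine .base (Or.inr (Or.inr (Or.inr (Or.inr (Or.inr (Or.inr (Or.inr
        ⟨_, _, _, _, _, ⟨JR_fml φ 1 0 t, JR_fml φ 1 0 s⟩, ?_⟩)))))))
      rw [← subst0Env_eq, ← subst0Env_eq]; rfl

/-- The theorems of a primitive recursively axiomatized theory are r.e. -/
theorem re_theorems {Tax : Set AFml} (hpr : PrAxiomatized Tax) :
    RE fun x => ∃ φ : AFml, x = φ.code ∧ Proves Tax φ := by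
  obtain ⟨p, hp, h⟩ := hpr
  exact (re_PrR hp).congr (fun x => (PrR_iff h x).symm)


/-! ### The recursion-theoretic construction: stage predicates -/

/-- The code of `0 = 1`. -/
def botC : ℕ := botFml.code

/-- Atomic evaluation relative to an oracle `g` for the provability predicate. -/
def atG (p : ℕ → ℕ) (g : ℕ → ℕ) (c : ℕ) : ℕ :=
  if c = botC then 0 else
  if ∃ x < c, c = p x ∧ g x = 1 then 1 else
  if ∃ x < c, c = p x then 0 else 2

/-- Theorems found by stage `s`. -/
def Ps (D : ℕ → ℕ → Prop) (s x : ℕ) : Prop := x < s ∧ ∃ k < s, D k x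

def Rr (p : ℕ → ℕ) (m n a b : ℕ) : Prop := ∃ i < a + 1, p^[n - 1] i = a ∧ p^[m - 1] i = b

def Cl (p : ℕ → ℕ) (D : ℕ → ℕ → Prop) (m n s Y : ℕ) : Prop :=
  (∀ x < s, Ps D s x → bit Y x = 1) ∧
  ∀ a < s + 1, ∀ b < s + 1, Rr p m n a b → bit Y a = 1 → bit Y b = 1

def Adm (p : ℕ → ℕ) (D : ℕ → ℕ → Prop) (m n s Y : ℕ) : Prop :=
  Cl p D m n s Y ∧ ∀ x < s + 1, Ps D s (Nat.pair 2 (p x)) → ¬ bit Y (p x) = 1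

def Dis (p : ℕ → ℕ) (D : ℕ → ℕ → Prop) (m n s Y : ℕ) : Prop :=
  Adm p D m n s Y ∧ ∃ z < s + 1, Ps D (s + 1) z ∧ evC (atG p (bit Y)) z = 0

/-- No disaster strictly before stage `s`. -/
def ND (p : ℕ → ℕ) (D : ℕ → ℕ → Prop) (m n s : ℕ) : Prop :=
  ∀ s' < s, ∀ Y < 2 ^ (s' + 1), ¬ Dis p D m n s' Y

def Fst (p : ℕ → ℕ) (D : ℕ → ℕ → Prop) (m n s Y : ℕ) : Prop :=
  Y < 2 ^ (s + 1) ∧ Dis p D m n s Y ∧ ND p D m n s ∧ ∀ Y' < Y, ¬ Dis p D m n s Y'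

def Us (p : ℕ → ℕ) (D : ℕ → ℕ → Prop) (m n s x : ℕ) : Prop :=
  x < s + 1 ∧ ∀ Y < 2 ^ (s + 1), Cl p D m n s Y → bit Y x = 1

def UU (p : ℕ → ℕ) (D : ℕ → ℕ → Prop) (m n x : ℕ) : Prop :=
  (∃ s, ND p D m n s ∧ Us p D m n s x) ∨ ∃ s Y, Fst p D m n s Y ∧ bit Y x = 1

def KK (p : ℕ → ℕ) (D : ℕ → ℕ → Prop) (m n a b : ℕ) : Prop :=
  Rr p m n a b ∧ ∃ s, ND p D m n s ∧ a < s + 1 ∧ b < s + 1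

def EE (p : ℕ → ℕ) (D : ℕ → ℕ → Prop) (m n a : ℕ) : Prop :=
  (∃ s, ND p D m n s ∧ ∃ x < s + 1, a = p x ∧ Ps D s (Nat.pair 2 a)) ∨
    ∃ s Y, Fst p D m n s Y ∧ ¬ bit Y a = 1

section prim
variable {π : ℕ → ℕ → ℕ} {D : ℕ → ℕ → Prop} {m n : ℕ}
variable {α : Type} [Primcodable α] 

theorem pr_at (h : Primrec fun p : ℕ × ℕ => π p.1 p.2) :
    Primrec fun r : (ℕ × ℕ) × ℕ => atG (π r.1.1) (bit r.1.2) r.2 := by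
  have h' : ∀ {α : Type} [Primcodable α] {f g : α → ℕ}, Primrec f → Primrec g →
    Primrec fun a => π (f a) (g a) := fun hf hg => h.comp (hf.pair hg)
  unfold atG
  have h1 : PrimrecPred fun r : (ℕ × ℕ) × ℕ => ∃ x < r.2, r.2 = π r.1.1 x ∧ bit r.1.2 x = 1 := by
    apply pp_bex (R := fun x (r : (ℕ × ℕ) × ℕ) => r.2 = π r.1.1 x ∧ bit r.1.2 x = 1) (f := fun r => r.2)
    · fun_prop
    · have := @h' (ℕ × (ℕ × ℕ) × ℕ) _ (fun r => r.2.1.1) (fun r => r.1) (by fun_prop) (by fun_prop)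
      fun_prop
  have h2 : PrimrecPred fun r : (ℕ × ℕ) × ℕ => ∃ x < r.2, r.2 = π r.1.1 x := by
    apply pp_bex (R := fun x (r : (ℕ × ℕ) × ℕ) => r.2 = π r.1.1 x) (f := fun r => r.2)
    · fun_prop
    · have := @h' (ℕ × (ℕ × ℕ) × ℕ) _ (fun r => r.2.1.1) (fun r => r.1) (by fun_prop) (by fun_prop)
      fun_prop
  refine Primrec.ite (by fun_prop) (by fun_prop) ?_
  refine Primrec.ite h1 (by fun_prop) ?_
  exact Primrec.ite h2 (by fun_prop) (by fun_prop)

theorem pr_iter (h : Primrec fun p : ℕ × ℕ => π p.1 p.2) (k : ℕ) :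
    Primrec fun p : ℕ × ℕ => (π p.1)^[k] p.2 := by
  induction k with
  | zero => exact Primrec.snd
  | succ k ih =>
    simp only [Function.iterate_succ_apply']
    exact h.comp (Primrec.fst.pair ih)

theorem pp_Ps (hD : PrimrecPred fun p : ℕ × ℕ => D p.1 p.2) :
    PrimrecPred fun r : ℕ × ℕ => Ps D r.1 r.2 := by
  unfold Ps
  refine PrimrecPred.and (by fun_prop) ?_
  apply pp_bex (R := fun k (r : ℕ × ℕ) => D k r.2) (f := fun r => r.1)
  · fun_prop
  · exact PrimrecPred.cmp hD (f := fun r : ℕ × ℕ × ℕ => (r.1, r.2.2)) (by fun_prop)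

theorem pp_Rr (h : Primrec fun p : ℕ × ℕ => π p.1 p.2) (m n : ℕ) :
    PrimrecPred fun r : ℕ × ℕ × ℕ => Rr (π r.1) m n r.2.1 r.2.2 := by
  unfold Rr
  apply pp_bex (R := fun i (r : ℕ × ℕ × ℕ) => (π r.1)^[n-1] i = r.2.1 ∧ (π r.1)^[m-1] i = r.2.2)
    (f := fun r => r.2.1 + 1)
  · fun_prop
  · have h1 := (pr_iter h (n-1)).comp (g := fun r : ℕ × ℕ × ℕ × ℕ => (r.2.1, r.1)) (by fun_prop)
    have h2 := (pr_iter h (m-1)).comp (g := fun r : ℕ × ℕ × ℕ × ℕ => (r.2.1, r.1)) (by fun_prop)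
    simp only at h1 h2
    fun_prop

theorem pp_Cl (h : Primrec fun p : ℕ × ℕ => π p.1 p.2)
    (hD : PrimrecPred fun p : ℕ × ℕ => D p.1 p.2) (m n : ℕ) :
    PrimrecPred fun r : ℕ × ℕ × ℕ => Cl (π r.1) D m n r.2.1 r.2.2 := by
  unfold Cl
  refine PrimrecPred.and ?_ ?_
  · apply pp_ball (R := fun x (r : ℕ × ℕ × ℕ) => Ps D r.2.1 x → bit r.2.2 x = 1)
      (f := fun r => r.2.1)
    · fun_prop
    · have h1 := PrimrecPred.cmp (pp_Ps hD) (f := fun r : ℕ × ℕ × ℕ × ℕ => (r.2.2.1, r.1)) (by fun_prop)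
      simp only at h1
      fun_prop
  · apply pp_ball (R := fun a (r : ℕ × ℕ × ℕ) => ∀ b < r.2.1 + 1, Rr (π r.1) m n a b →
      bit r.2.2 a = 1 → bit r.2.2 b = 1) (f := fun r => r.2.1 + 1)
    · fun_prop
    apply pp_ball (R := fun b (r : ℕ × ℕ × ℕ × ℕ) => Rr (π r.2.1) m n r.1 b →
      bit r.2.2.2 r.1 = 1 → bit r.2.2.2 b = 1) (f := fun r => r.2.2.1 + 1)
    · fun_prop
    · have h1 := PrimrecPred.cmp (pp_Rr h m n) (f := fun r : ℕ × ℕ × ℕ × ℕ × ℕ => (r.2.2.1, r.2.1, r.1))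
        (by fun_prop)
      simp only at h1
      fun_prop

theorem pp_Adm (h : Primrec fun p : ℕ × ℕ => π p.1 p.2)
    (hD : PrimrecPred fun p : ℕ × ℕ => D p.1 p.2) (m n : ℕ) :
    PrimrecPred fun r : ℕ × ℕ × ℕ => Adm (π r.1) D m n r.2.1 r.2.2 := by
  unfold Adm
  refine PrimrecPred.and (pp_Cl h hD m n) ?_
  apply pp_ball (R := fun x (r : ℕ × ℕ × ℕ) => Ps D r.2.1 (Nat.pair 2 (π r.1 x)) →
    ¬ bit r.2.2 (π r.1 x) = 1) (f := fun r => r.2.1 + 1)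
  · fun_prop
  · have h0 := h.comp (g := fun r : ℕ × ℕ × ℕ × ℕ => (r.2.1, r.1)) (by fun_prop)
    simp only at h0
    have h1 := PrimrecPred.cmp (pp_Ps hD) (f := fun r : ℕ × ℕ × ℕ × ℕ => (r.2.2.1, Nat.pair 2 (π r.2.1 r.1)))
      (by fun_prop)
    simp only at h1
    fun_prop

theorem pp_Dis (h : Primrec fun p : ℕ × ℕ => π p.1 p.2)
    (hD : PrimrecPred fun p : ℕ × ℕ => D p.1 p.2) (m n : ℕ) :
    PrimrecPred fun r : ℕ × ℕ × ℕ => Dis (π r.1) D m n r.2.1 r.2.2 := by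
  unfold Dis
  refine PrimrecPred.and (pp_Adm h hD m n) ?_
  apply pp_bex (R := fun z (r : ℕ × ℕ × ℕ) => Ps D (r.2.1 + 1) z ∧
    evC (atG (π r.1) (bit r.2.2)) z = 0) (f := fun r => r.2.1 + 1)
  · fun_prop
  · have h0 := (pr_evC (At := fun r : ℕ × ℕ => atG (π r.1) (bit r.2)) (pr_at h)).comp (g := fun r : ℕ × ℕ × ℕ × ℕ => ((r.2.1, r.2.2.2), r.1))
      (by fun_prop)
    simp only at h0
    have h1 := PrimrecPred.cmp (pp_Ps hD) (f := fun r : ℕ × ℕ × ℕ × ℕ => (r.2.2.1 + 1, r.1))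
      (by fun_prop)
    simp only at h1
    fun_prop

theorem pp_ND (h : Primrec fun p : ℕ × ℕ => π p.1 p.2)
    (hD : PrimrecPred fun p : ℕ × ℕ => D p.1 p.2) (m n : ℕ) :
    PrimrecPred fun r : ℕ × ℕ => ND (π r.1) D m n r.2 := by
  unfold ND
  apply pp_ball (R := fun s' (r : ℕ × ℕ) => ∀ Y < 2 ^ (s' + 1), ¬ Dis (π r.1) D m n s' Y)
    (f := fun r => r.2)
  · fun_prop
  apply pp_ball (R := fun Y (r : ℕ × ℕ × ℕ) => ¬ Dis (π r.2.1) D m n r.1 Y)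
    (f := fun r => 2 ^ (r.1 + 1))
  · fun_prop
  · have h1 := PrimrecPred.cmp (pp_Dis h hD m n) (f := fun r : ℕ × ℕ × ℕ × ℕ => (r.2.2.1, r.2.1, r.1))
      (by fun_prop)
    simp only at h1
    fun_prop

theorem pp_Fst (h : Primrec fun p : ℕ × ℕ => π p.1 p.2)
    (hD : PrimrecPred fun p : ℕ × ℕ => D p.1 p.2) (m n : ℕ) :
    PrimrecPred fun r : ℕ × ℕ × ℕ => Fst (π r.1) D m n r.2.1 r.2.2 := by
  unfold Fst
  refine PrimrecPred.and (by fun_prop) (PrimrecPred.and (pp_Dis h hD m n) (PrimrecPred.and ?_ ?_))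
  · exact PrimrecPred.cmp (pp_ND h hD m n) (f := fun r : ℕ × ℕ × ℕ => (r.1, r.2.1)) (by fun_prop)
  apply pp_ball (R := fun Y (r : ℕ × ℕ × ℕ) => ¬ Dis (π r.1) D m n r.2.1 Y)
    (f := fun r => r.2.2)
  · fun_prop
  · have h1 := PrimrecPred.cmp (pp_Dis h hD m n) (f := fun r : ℕ × ℕ × ℕ × ℕ => (r.2.1, r.2.2.1, r.1))
      (by fun_prop)
    simp only at h1
    fun_prop

theorem pp_Us (h : Primrec fun p : ℕ × ℕ => π p.1 p.2)
    (hD : PrimrecPred fun p : ℕ × ℕ => D p.1 p.2) (m n : ℕ) :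
    PrimrecPred fun r : ℕ × ℕ × ℕ => Us (π r.1) D m n r.2.1 r.2.2 := by
  unfold Us
  refine PrimrecPred.and (by fun_prop) ?_
  apply pp_ball (R := fun Y (r : ℕ × ℕ × ℕ) => Cl (π r.1) D m n r.2.1 Y → bit Y r.2.2 = 1)
    (f := fun r => 2 ^ (r.2.1 + 1))
  · fun_prop
  · have h1 := PrimrecPred.cmp (pp_Cl h hD m n) (f := fun r : ℕ × ℕ × ℕ × ℕ => (r.2.1, r.2.2.1, r.1))
      (by fun_prop)
    simp only at h1
    fun_prop

theorem re_UU (h : Primrec fun p : ℕ × ℕ => π p.1 p.2)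
    (hD : PrimrecPred fun p : ℕ × ℕ => D p.1 p.2) (m n : ℕ) :
    RE fun r : ℕ × ℕ => UU (π r.2) D m n r.1 := by
  unfold UU
  refine RE.or ?_ ?_
  · apply RE.ex (R := fun s (r : ℕ × ℕ) => ND (π r.2) D m n s ∧ Us (π r.2) D m n s r.1)
    apply RE.of_pp
    refine PrimrecPred.and ?_ ?_
    · exact PrimrecPred.cmp (pp_ND h hD m n) (f := fun r : ℕ × ℕ × ℕ => (r.2.2, r.1)) (by fun_prop)
    · exact PrimrecPred.cmp (pp_Us h hD m n) (f := fun r : ℕ × ℕ × ℕ => (r.2.2, r.1, r.2.1)) (by fun_prop)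
  · apply RE.ex (R := fun s (r : ℕ × ℕ) => ∃ Y, Fst (π r.2) D m n s Y ∧ bit Y r.1 = 1)
    apply RE.ex (R := fun Y (r : ℕ × ℕ × ℕ) => Fst (π r.2.2) D m n r.1 Y ∧ bit Y r.2.1 = 1)
    apply RE.of_pp
    refine PrimrecPred.and ?_ (by fun_prop)
    exact PrimrecPred.cmp (pp_Fst h hD m n) (f := fun r : ℕ × ℕ × ℕ × ℕ => (r.2.2.2, r.2.1, r.1)) (by fun_prop)

theorem re_EE (h : Primrec fun p : ℕ × ℕ => π p.1 p.2)
    (hD : PrimrecPred fun p : ℕ × ℕ => D p.1 p.2) (m n : ℕ) :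
    RE fun r : ℕ × ℕ => EE (π r.2) D m n r.1 := by
  unfold EE
  refine RE.or ?_ ?_
  · apply RE.ex (R := fun s (r : ℕ × ℕ) => ND (π r.2) D m n s ∧ ∃ x < s + 1, r.1 = π r.2 x ∧
      Ps D s (Nat.pair 2 r.1))
    apply RE.of_pp
    refine PrimrecPred.and ?_ ?_
    · exact PrimrecPred.cmp (pp_ND h hD m n) (f := fun r : ℕ × ℕ × ℕ => (r.2.2, r.1)) (by fun_prop)
    · apply pp_bex (R := fun x (r : ℕ × ℕ × ℕ) => r.2.1 = π r.2.2 x ∧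
        Ps D r.1 (Nat.pair 2 r.2.1)) (f := fun r => r.1 + 1)
      · fun_prop
      have h0 := h.comp (g := fun r : ℕ × ℕ × ℕ × ℕ => (r.2.2.2, r.1)) (by fun_prop)
      simp only at h0
      have h1 := PrimrecPred.cmp (pp_Ps hD) (f := fun r : ℕ × ℕ × ℕ × ℕ => (r.2.1, Nat.pair 2 r.2.2.1))
        (by fun_prop)
      simp only at h1
      fun_prop
  · apply RE.ex (R := fun s (r : ℕ × ℕ) => ∃ Y, Fst (π r.2) D m n s Y ∧ ¬ bit Y r.1 = 1)
    apply RE.ex (R := fun Y (r : ℕ × ℕ × ℕ) => Fst (π r.2.2) D m n r.1 Y ∧ ¬ bit Y r.2.1 = 1)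
    apply RE.of_pp
    refine PrimrecPred.and ?_ (by fun_prop)
    exact PrimrecPred.cmp (pp_Fst h hD m n) (f := fun r : ℕ × ℕ × ℕ × ℕ => (r.2.2.2, r.2.1, r.1)) (by fun_prop)

theorem re_KK (h : Primrec fun p : ℕ × ℕ => π p.1 p.2)
    (hD : PrimrecPred fun p : ℕ × ℕ => D p.1 p.2) (m n : ℕ) :
    RE fun r : ℕ × ℕ × ℕ => KK (π r.2.2) D m n r.1 r.2.1 := by
  unfold KK
  refine RE.and (RE.of_pp ?_) ?_
  · exact PrimrecPred.cmp (pp_Rr h m n) (f := fun r : ℕ × ℕ × ℕ => (r.2.2, r.1, r.2.1)) (by fun_prop)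
  · apply RE.ex (R := fun s (r : ℕ × ℕ × ℕ) => ND (π r.2.2) D m n s ∧ r.1 < s + 1 ∧ r.2.1 < s + 1)
    apply RE.of_pp
    refine PrimrecPred.and ?_ (by fun_prop)
    exact PrimrecPred.cmp (pp_ND h hD m n) (f := fun r : ℕ × ℕ × ℕ × ℕ => (r.2.2.2, r.1)) (by fun_prop)

end prim

open Classical in
/-- Indicator of a set. -/
noncomputable def ind (G : Set ℕ) (x : ℕ) : ℕ := if x ∈ G then 1 else 0

theorem ind_one (G : Set ℕ) (x : ℕ) : ind G x = 1 ↔ x ∈ G := by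
  unfold ind; split_ifs <;> simp_all

section comb
variable {p : ℕ → ℕ} {D : ℕ → ℕ → Prop} {m n : ℕ}

theorem atG_congr {g g' : ℕ → ℕ} {c : ℕ} (h : ∀ x < c, g x = 1 ↔ g' x = 1) :
    atG p g c = atG p g' c := by
  unfold atG
  have : (∃ x < c, c = p x ∧ g x = 1) ↔ (∃ x < c, c = p x ∧ g' x = 1) := by
    constructor
    · rintro ⟨x, hx, h1, h2⟩; exact ⟨x, hx, h1, (h x hx).1 h2⟩
    · rintro ⟨x, hx, h1, h2⟩; exact ⟨x, hx, h1, (h x hx).2 h2⟩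
  simp only [this]

theorem ev_congr {g g' : ℕ → ℕ} {c : ℕ} (h : ∀ x < c, g x = 1 ↔ g' x = 1) :
    evC (atG p g) c = evC (atG p g') c :=
  evC_congr c fun _ hx => atG_congr fun y hy => h y (by omega)

structure PiOk (p : ℕ → ℕ) : Prop where
  inj : Function.Injective p
  gt : ∀ x, x < p x
  tag : ∀ x, (p x).unpair.1 = 7

theorem PiOk.ne_bot (h : PiOk p) (x : ℕ) : p x ≠ botC := by
  intro h1
  have := h.tag x
  rw [h1] at this
  simp [botC, botFml, AFml.code] at this

theorem PiOk.at_p (h : PiOk p) (g : ℕ → ℕ) (x : ℕ) :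
    atG p g (p x) = if g x = 1 then 1 else 0 := by
  unfold atG
  rw [if_neg (h.ne_bot x)]
  have h1 : (∃ y < p x, p x = p y ∧ g y = 1) ↔ g x = 1 := by
    constructor
    · rintro ⟨y, _, h1, h2⟩; rw [h.inj h1]; exact h2
    · intro h1; exact ⟨x, h.gt x, rfl, h1⟩
  have h2 : ∃ y < p x, p x = p y := ⟨x, h.gt x, rfl⟩
  simp only [h1]
  rw [if_pos h2]

theorem PiOk.ev_p (h : PiOk p) (g : ℕ → ℕ) (x : ℕ) :
    evC (atG p g) (p x) = if g x = 1 then 1 else 0 := by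
  rw [evC_atom _ _ (Or.inr (by rw [h.tag]; norm_num)), h.at_p]

theorem PiOk.ev_np (h : PiOk p) (g : ℕ → ℕ) (x : ℕ) :
    evC (atG p g) (Nat.pair 2 (p x)) = if g x = 1 then 0 else 1 := by
  rw [evC]
  simp only [Nat.unpair_pair, dite_true, h.ev_p]
  split_ifs <;> simp [vneg]

theorem Ps.mono {s s' x : ℕ} (h : s ≤ s') (hx : Ps D s x) : Ps D s' x := by
  obtain ⟨h1, k, h2, h3⟩ := hx
  exact ⟨by omega, k, by omega, h3⟩

theorem Ps_ex {x : ℕ} (h : ∃ k, D k x) : ∃ s, Ps D s x := by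
  obtain ⟨k, h⟩ := h
  exact ⟨max k x + 1, by omega, k, by omega, h⟩

theorem Ps.toD {s x : ℕ} (h : Ps D s x) : ∃ k, D k x := by
  obtain ⟨h1, k, h2, h3⟩ := h
  exact ⟨k, h3⟩

theorem Cl.restrict {s s' Y : ℕ} (hs : s ≤ s') (h : Cl p D m n s' Y) :
    ∃ Y' < 2 ^ (s + 1), Cl p D m n s Y' ∧ ∀ x, bit Y' x = 1 ↔ (x < s + 1 ∧ bit Y x = 1) := by
  obtain ⟨Y', hY', hb⟩ := exists_bits (fun x => bit Y x = 1) (s + 1)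
  refine ⟨Y', hY', ⟨?_, ?_⟩, hb⟩
  · intro x hx h1
    exact (hb x).2 ⟨by omega, h.1 x (by omega) (h1.mono hs)⟩
  · intro a ha b hb' hR h1
    exact (hb b).2 ⟨by omega, h.2 a (by omega) b (by omega) hR ((hb a).1 h1).2⟩

theorem Fst.unique {s Y s' Y' : ℕ} (h : Fst p D m n s Y) (h' : Fst p D m n s' Y') :
    s = s' ∧ Y = Y' := by
  have hs : s = s' := by
    rcases lt_trichotomy s s' with h1 | h1 | h1
    · exact absurd h.2.1 (h'.2.2.1 s h1 Y h.1)
    · exact h1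
    · exact absurd h'.2.1 (h.2.2.1 s' h1 Y' h'.1)
  subst hs
  refine ⟨rfl, ?_⟩
  rcases lt_trichotomy Y Y' with h1 | h1 | h1
  · exact absurd h.2.1 (h'.2.2.2 Y h1)
  · exact h1
  · exact absurd h'.2.1 (h.2.2.2 Y' h1)

theorem ND.le_of_Fst {s Y s' : ℕ} (h : Fst p D m n s Y) (h' : ND p D m n s') : s' ≤ s := by
  by_contra hc
  exact h' s (by omega) Y h.1 h.2.1

theorem exists_Fst {s Y : ℕ} (hY : Y < 2 ^ (s + 1)) (h : Dis p D m n s Y) :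
    ∃ s Y, Fst p D m n s Y := by
  classical
  have h1 : ∃ s, ∃ Y, Y < 2 ^ (s + 1) ∧ Dis p D m n s Y := ⟨s, Y, hY, h⟩
  have h2 := Nat.find_spec h1
  refine ⟨Nat.find h1, Nat.find h2, (Nat.find_spec h2).1, (Nat.find_spec h2).2, ?_, ?_⟩
  · intro s' hs' Y' hY' hd
    exact Nat.find_min h1 hs' ⟨Y', hY', hd⟩
  · intro Y' hY' hd
    exact Nat.find_min h2 hY' ⟨hY'.trans (Nat.find_spec h2).1, hd⟩

/-- If a disaster happens, then `UU` is given by the bits of `Y`. -/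
theorem UU_of_Fst {s Y : ℕ} (h : Fst p D m n s Y) (x : ℕ) :
    UU p D m n x ↔ bit Y x = 1 := by
  constructor
  · rintro (⟨s', h1, h2⟩ | ⟨s', Y', h1, h2⟩)
    · obtain ⟨Y', hY', hc, hb⟩ := h.2.1.1.1.restrict (h1.le_of_Fst h)
      exact ((hb x).1 (h2.2 Y' hY' hc)).2
    · obtain ⟨_, rfl⟩ := h.unique h1
      exact h2
  · intro h1
    exact Or.inr ⟨s, Y, h, h1⟩

theorem KK_of_Fst {s Y : ℕ} (h : Fst p D m n s Y) (a b : ℕ) (hK : KK p D m n a b)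
    (ha : UU p D m n a) : UU p D m n b := by
  rw [UU_of_Fst h] at ha ⊢
  obtain ⟨hR, s', h1, h2, h3⟩ := hK
  have := h1.le_of_Fst h
  exact h.2.1.1.1.2 a (by omega) b (by omega) hR ha

theorem EE_of_Fst {s Y : ℕ} (h : Fst p D m n s Y) (a : ℕ) (hE : EE p D m n a) :
    ¬ UU p D m n a := by
  rw [UU_of_Fst h]
  rcases hE with ⟨s', h1, x, hx, rfl, h2⟩ | ⟨s', Y', h1, h2⟩
  · have h3 := h1.le_of_Fst h
    exact h.2.1.1.2 x (by omega) (h2.mono h3)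
  · obtain ⟨_, rfl⟩ := h.unique h1
    exact h2

theorem EE_of_Fst' {s Y : ℕ} (h : Fst p D m n s Y) (a : ℕ) (ha : ¬ bit Y a = 1) :
    EE p D m n a := Or.inr ⟨s, Y, h, ha⟩

/-! After excluding disasters. -/

variable (hp : PiOk p) (hcon : ∀ x, (∃ k, D k (p x)) → ¬ ∃ k, D k (Nat.pair 2 (p x)))
  (hN : ∀ s, ND p D m n s)
include hp hcon hN

/-- The main tool: an admissible set cannot refute a theorem. -/
theorem no_ref (s : ℕ) (G : Set ℕ) (h1 : ∀ x, Ps D s x → x ∈ G)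
    (h2 : ∀ a b, Rr p m n a b → a ∈ G → b ∈ G)
    (h3 : ∀ x, Ps D s (Nat.pair 2 (p x)) → p x ∉ G) (z : ℕ) (hz : Ps D (s + 1) z) :
    evC (atG p (ind G)) z ≠ 0 := by
  intro h0
  obtain ⟨Y, hY, hb⟩ := exists_bits (fun x => x ∈ G) (s + 1)
  refine hN (s + 1) s (by omega) Y hY ⟨⟨⟨?_, ?_⟩, ?_⟩, z, hz.1, hz, ?_⟩
  · intro x hx hx'
    exact (hb x).2 ⟨by omega, h1 x hx'⟩
  · intro a ha b hb' hR hbit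
    exact (hb b).2 ⟨hb', h2 a b hR ((hb a).1 hbit).2⟩
  · intro x _ hx hbit
    exact h3 x hx ((hb _).1 hbit).2
  · rw [← h0]
    apply ev_congr
    intro x hx
    rw [hb, ind_one]
    have := hz.1
    exact ⟨fun h => h.2, fun h => ⟨by omega, h⟩⟩

theorem down_closed (hm : 1 ≤ m) (hmn : m < n) (s x : ℕ) (h : Ps D s (p x)) : Ps D s x := by
  induction s generalizing x with
  | zero => exact absurd h.1 (by omega)
  | succ s ih =>
    have := no_ref hp hcon hN s {x | Ps D s x} (fun x hx => hx) ?_ ?_ (p x) h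
    · rw [hp.ev_p] at this
      by_cases hx : ind {x | Ps D s x} x = 1
      · rw [ind_one] at hx
        exact Ps.mono (Nat.le_succ s) hx
      · simp [hx] at this
    · rintro a b ⟨i, _, rfl, rfl⟩ ha
      have : ∀ k y, Ps D s (p^[k] y) → Ps D s y := by
        intro k
        induction k with
        | zero => intro y h; exact h
        | succ k ihk =>
          intro y h
          rw [Function.iterate_succ_apply'] at h
          exact ihk y (ih _ h)
      apply this (n - m)
      rw [← Function.iterate_add_apply]
      have e : n - m + (m - 1) = n - 1 := by omega
      rw [e]; exact ha
    · intro x hx hx'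
      exact hcon x (Ps.toD hx') (Ps.toD hx)

theorem good (𝒢 : Set (Set ℕ)) (g1 : ∀ G ∈ 𝒢, ∀ x, (∃ k, D k x) → x ∈ G)
    (g2 : ∀ G ∈ 𝒢, ∀ a b, Rr p m n a b → a ∈ G → b ∈ G)
    (g3 : ∀ G ∈ 𝒢, ∀ x, p x ∈ G → (∃ k, D k (p x)) ∨ ∃ G' ∈ 𝒢, x ∈ G')
    (G : Set ℕ) (hG : G ∈ 𝒢) (z : ℕ) (hz : ∃ k, D k z) :
    evC (atG p (ind G)) z ≠ 0 := by
  obtain ⟨s, hs⟩ := Ps_ex hz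
  clear hz
  induction s generalizing z G with
  | zero => exact absurd hs.1 (by omega)
  | succ s ih =>
    refine no_ref hp hcon hN s G (fun x hx => g1 G hG x (Ps.toD hx)) (g2 G hG) ?_ z hs
    intro x hx hx'
    rcases g3 G hG x hx' with h | ⟨G', hG', h⟩
    · exact hcon x h (Ps.toD hx)
    · refine ih G' hG' _ hx ?_
      rw [hp.ev_np, if_pos ((ind_one _ _).2 h)]

/-- The closure of the set of theorems under `p`. -/
def Sst (p : ℕ → ℕ) (D : ℕ → ℕ → Prop) : Set ℕ := {y | ∃ j x, (∃ k, D k x) ∧ y = p^[j] x}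

omit hcon hN in
theorem Sst_p (y : ℕ) (h : p y ∈ Sst p D) : (∃ k, D k (p y)) ∨ y ∈ Sst p D := by
  obtain ⟨j, x, hx, h⟩ := h
  cases j with
  | zero => left; rw [h]; exact hx
  | succ j =>
    right
    rw [Function.iterate_succ_apply'] at h
    exact ⟨j, x, hx, hp.inj h⟩

theorem Sst_R (hm : 1 ≤ m) (hn : 1 ≤ n) (hmn : m ≠ n) (a b : ℕ) (hR : Rr p m n a b)
    (ha : a ∈ Sst p D) : b ∈ Sst p D := by
  obtain ⟨i, _, rfl, rfl⟩ := hR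
  rcases Nat.lt_or_gt_of_ne hmn with h | h
  · have : ∀ k y, p^[k] y ∈ Sst p D → y ∈ Sst p D := by
      intro k
      induction k with
      | zero => intro y h; exact h
      | succ k ihk =>
        intro y hy
        rw [Function.iterate_succ_apply'] at hy
        apply ihk y
        rcases Sst_p hp _ hy with h1 | h1
        · obtain ⟨s, hs⟩ := Ps_ex h1
          exact ⟨0, _, Ps.toD (down_closed hp hcon hN hm h s _ hs), rfl⟩
        · exact h1
    apply this (n - m)
    rw [← Function.iterate_add_apply]
    have e : n - m + (m - 1) = n - 1 := by omega
    rw [e]; exact ha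
  · obtain ⟨j, x, hx, h1⟩ := ha
    refine ⟨m - n + j, x, hx, ?_⟩
    rw [Function.iterate_add_apply, ← h1, ← Function.iterate_add_apply]
    congr 2
    omega

theorem UU_sub (hm : 1 ≤ m) (hn : 1 ≤ n) (hmn : m ≠ n) (x : ℕ) (h : UU p D m n x) :
    x ∈ Sst p D := by
  rcases h with ⟨s, _, h1, h2⟩ | ⟨s, Y, h1, _⟩
  · obtain ⟨Y, hY, hb⟩ := exists_bits (fun x => x ∈ Sst p D) (s + 1)
    refine ((hb x).1 (h2 Y hY ⟨?_, ?_⟩)).2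
    · intro x hx h
      exact (hb x).2 ⟨by omega, 0, x, Ps.toD h, rfl⟩
    · intro a ha b hb' hR h
      exact (hb b).2 ⟨hb', Sst_R hp hcon hN hm hn hmn a b hR ((hb a).1 h).2⟩
  · exact absurd h1.2.1 (hN (s + 1) s (by omega) Y h1.1)

omit hp hcon in
theorem UU_sup (x : ℕ) (h : ∃ k, D k x) : UU p D m n x := by
  obtain ⟨s, hs⟩ := Ps_ex h
  have := hs.1
  exact Or.inl ⟨s, hN s, by omega, fun Y hY hc => hc.1 x hs.1 hs⟩

omit hp hcon in
theorem UU_KK (a b : ℕ) (hK : KK p D m n a b) (ha : UU p D m n a) : UU p D m n b := by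
  obtain ⟨hR, -⟩ := hK
  rcases ha with ⟨s, _, h1, h2⟩ | ⟨s, Y, h1, _⟩
  · refine Or.inl ⟨max s (max a b), hN _, by omega, fun Y hY hc => ?_⟩
    refine hc.2 a (by omega) b (by omega) hR ?_
    obtain ⟨Y', hY', hc', hb⟩ := hc.restrict (le_max_left _ _)
    exact ((hb a).1 (h2 Y' hY' hc')).2
  · exact absurd h1.2.1 (hN (s + 1) s (by omega) Y h1.1)

theorem UU_EE (hm : 1 ≤ m) (hn : 1 ≤ n) (hmn : m ≠ n) (a : ℕ) (hE : EE p D m n a) :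
    ¬ UU p D m n a := by
  intro h
  have h1 := UU_sub hp hcon hN hm hn hmn a h
  rcases hE with ⟨s, _, x, _, rfl, h2⟩ | ⟨s, Y, h2, _⟩
  · rcases Sst_p hp x h1 with h3 | h3
    · exact hcon x h3 (Ps.toD h2)
    · refine good hp hcon hN {Sst p D} ?_ ?_ ?_ (Sst p D) rfl _ (Ps.toD h2) ?_
      · rintro G rfl x hx; exact ⟨0, x, hx, rfl⟩
      · rintro G rfl; exact Sst_R hp hcon hN hm hn hmn
      · rintro G rfl x hx
        rcases Sst_p hp x hx with h4 | h4
        · exact Or.inl h4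
        · exact Or.inr ⟨_, rfl, h4⟩
      · rw [hp.ev_np, if_pos ((ind_one _ _).2 h3)]
  · exact absurd h2.2.1 (hN (s + 1) s (by omega) Y h2.1)

omit hcon in
theorem KK_of (i : ℕ) : KK p D m n (p^[n-1] i) (p^[m-1] i) := by
  have : ∀ k, i ≤ p^[k] i := by
    intro k
    induction k with
    | zero => exact le_rfl
    | succ k ih =>
      rw [Function.iterate_succ_apply']
      exact ih.trans (hp.gt _).le
  exact ⟨⟨i, by have := this (n-1); omega, rfl, rfl⟩, max (p^[n-1] i) (p^[m-1] i), hN _,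
    by omega, by omega⟩

omit hcon in
theorem EE_of (x : ℕ) (h : ∃ k, D k (Nat.pair 2 (p x))) : EE p D m n (p x) := by
  obtain ⟨s, hs⟩ := Ps_ex h
  exact Or.inl ⟨max s x, hN _, x, by omega, rfl, hs.mono (le_max_left _ _)⟩

end comb

/-! ### The provability predicate -/

def numC : ℕ → ℕ
  | 0 => Nat.pair 1 0
  | k + 1 => Nat.pair 2 (numC k)

theorem numC_eq (k : ℕ) : (numeral k).code = numC k := by
  induction k with
  | zero => rfl
  | succ k ih => simp [numeral, ATerm.code, numC, ih]

theorem pr_numC : Primrec numC := by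
  have h : Primrec (Nat.rec (motive := fun _ => ℕ) (Nat.pair 1 0) (fun _ r => Nat.pair 2 r)) := by
    apply Primrec.nat_rec₁
    change Primrec fun r : ℕ × ℕ => Nat.pair 2 r.2
    fun_prop
  refine h.of_eq ?_
  intro k
  induction k with
  | zero => rfl
  | succ k ih => simp only [numC, ← ih]

/-- The formula `P`. -/
def PF (Q : AFml) (q : ℕ) : AFml :=
  .ex (.ex (.and (.eq (.var 1) (numeral q)) (.and (.eq (.var 0) (.var 2)) Q)))

def PX (Q : AFml) (q x : ℕ) : AFml :=
  .ex (.ex (.and (.eq (.var 1) (numeral q)) (.and (.eq (.var 0) (numeral x)) Q)))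

theorem PF_subst {Q : AFml} (hQ : Q.FreeLt 2) (q x : ℕ) :
    (PF Q q).subst0 (numeral x) = PX Q q x := by
  have h : Q.substAll (liftSub (liftSub (subst0Env (numeral x)))) = Q := by
    conv_rhs => rw [← AFml.substAll_var Q]
    apply AFml.substAll_congr hQ
    intro k hk
    interval_cases k <;> rfl
  simp only [PF, PX, AFml.subst0, AFml.substAll, h, ATerm.substAll, numeral_substAll]
  simp [liftSub, subst0Env, numeral_lift, ATerm.lift]

theorem PF_freeLt {Q : AFml} (hQ : Q.FreeLt 2) (q : ℕ) : (PF Q q).FreeLt 1 := by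
  have h3 : Q.FreeLt 3 := hQ.mono (by norm_num)
  simp only [PF, AFml.FreeLt, ATerm.FreeLt]
  exact ⟨⟨by norm_num, numeral_freeLt _ _⟩, ⟨by norm_num, by norm_num⟩, h3⟩

def piC (q x : ℕ) : ℕ :=
  Nat.pair 7 (Nat.pair 7 (Nat.pair 3 (Nat.pair
    (Nat.pair 0 (Nat.pair (Nat.pair 0 1) (numC q)))
    (Nat.pair 3 (Nat.pair (Nat.pair 0 (Nat.pair (Nat.pair 0 0) (numC x))) q)))))

theorem PX_code (Q : AFml) (x : ℕ) : (PX Q Q.code x).code = piC Q.code x := by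
  simp [PX, piC, AFml.code, ATerm.code, numC_eq]

theorem pr_piC : Primrec fun r : ℕ × ℕ => piC r.1 r.2 := by
  have h1 : Primrec fun r : ℕ × ℕ => numC r.1 := pr_numC.comp Primrec.fst
  have h2 : Primrec fun r : ℕ × ℕ => numC r.2 := pr_numC.comp Primrec.snd
  unfold piC
  fun_prop

theorem le_numC (k : ℕ) : k ≤ numC k := by
  induction k with
  | zero => exact Nat.zero_le _
  | succ k ih =>
    have := Nat.add_le_pair 2 (numC k)
    simp only [numC]; omega

theorem numC_inj : Function.Injective numC := by
  intro a
  induction a with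
  | zero =>
    intro b h
    cases b with
    | zero => rfl
    | succ b => simp [numC, Nat.pair_eq_pair] at h
  | succ a ih =>
    intro b h
    cases b with
    | zero => simp [numC, Nat.pair_eq_pair] at h
    | succ b =>
      simp only [numC, Nat.pair_eq_pair, true_and] at h
      rw [ih h]

theorem piC_ok (q : ℕ) : PiOk (piC q) where
  inj := by
    intro a b h
    simp only [piC, Nat.pair_eq_pair, true_and, and_true] at h
    exact numC_inj h
  gt := by
    intro x
    have h0 := le_numC x
    unfold piC
    have hl := Nat.left_le_pair
    have hr := Nat.right_le_pair
    have h1 := hr (Nat.pair 0 0) (numC x)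
    have h2 := hr 0 (Nat.pair (Nat.pair 0 0) (numC x))
    have h3 := hl (Nat.pair 0 (Nat.pair (Nat.pair 0 0) (numC x))) q
    have h4 := hr 3 (Nat.pair (Nat.pair 0 (Nat.pair (Nat.pair 0 0) (numC x))) q)
    have h5 := hr (Nat.pair 0 (Nat.pair (Nat.pair 0 1) (numC q)))
      (Nat.pair 3 (Nat.pair (Nat.pair 0 (Nat.pair (Nat.pair 0 0) (numC x))) q))
    have h6 := hr 3 (Nat.pair (Nat.pair 0 (Nat.pair (Nat.pair 0 1) (numC q)))
      (Nat.pair 3 (Nat.pair (Nat.pair 0 (Nat.pair (Nat.pair 0 0) (numC x))) q)))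
    have h7 := hr 7 (Nat.pair 3 (Nat.pair (Nat.pair 0 (Nat.pair (Nat.pair 0 1) (numC q)))
      (Nat.pair 3 (Nat.pair (Nat.pair 0 (Nat.pair (Nat.pair 0 0) (numC x))) q))))
    have h8 := Nat.add_le_pair 7 (Nat.pair 7 (Nat.pair 3 (Nat.pair
      (Nat.pair 0 (Nat.pair (Nat.pair 0 1) (numC q)))
      (Nat.pair 3 (Nat.pair (Nat.pair 0 (Nat.pair (Nat.pair 0 0) (numC x))) q)))))
    omega
  tag := by intro x; simp [piC]

theorem sat_PX {M : Type} (S : Str M) (ρ : ℕ → M) (Q : AFml) (q x : ℕ) :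
    S.sat ρ (PX Q q x) ↔ S.sat (scons (S.num x) (scons (S.num q) ρ)) Q := by
  simp only [PX, Str.sat, Str.tval_numeral, Str.tval, scons_zero]
  constructor
  · rintro ⟨a, b, h1, h2, h3⟩
    have h1' : a = S.num q := h1
    rw [h1', h2] at h3
    exact h3
  · intro h
    exact ⟨_, _, rfl, rfl, h⟩

theorem not_sat_bot {M : Type} (S : Str M) (hS : S.IsPA) (ρ : ℕ → M) : ¬ S.sat ρ botFml := by
  intro h
  have h' : S.num 0 = S.num 1 := h
  exact absurd (hS.num_inj h') (by norm_num)

theorem decide_ev {M : Type} (S : Str M) (hS : S.IsPA) (ρ : ℕ → M) {p : ℕ → ℕ}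
    (F : ℕ → AFml) (hF : ∀ x, (F x).code = p x) (g : ℕ → ℕ)
    (h1 : ∀ x, g x = 1 → S.sat ρ (F x)) (h0 : ∀ x, ¬ g x = 1 → ¬ S.sat ρ (F x)) (φ : AFml) :
    (evC (atG p g) φ.code = 1 ∧ S.sat ρ φ) ∨ (evC (atG p g) φ.code = 0 ∧ ¬ S.sat ρ φ) ∨
      evC (atG p g) φ.code = 2 := by
  have atom : ∀ φ : AFml, (φ.code.unpair.1 < 2 ∨ 5 < φ.code.unpair.1) →
      (evC (atG p g) φ.code = 1 ∧ S.sat ρ φ) ∨ (evC (atG p g) φ.code = 0 ∧ ¬ S.sat ρ φ) ∨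
      evC (atG p g) φ.code = 2 := by
    intro φ h
    rw [evC_atom _ _ h]
    unfold atG
    split_ifs with a b c
    · right; left
      refine ⟨rfl, ?_⟩
      rw [AFml.code_injective a]; exact not_sat_bot S hS ρ
    · left
      obtain ⟨x, _, hx, hg⟩ := b
      rw [← hF] at hx
      rw [AFml.code_injective hx]
      exact ⟨rfl, h1 x hg⟩
    · right; left
      obtain ⟨x, hl, hx⟩ := c
      have : ¬ g x = 1 := fun hg => b ⟨x, hl, hx, hg⟩
      rw [← hF] at hx
      rw [AFml.code_injective hx]
      exact ⟨rfl, h0 x this⟩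
    · right; right; rfl
  induction φ with
  | eq t s => exact atom _ (by simp [AFml.code])
  | le t s => exact atom _ (by simp [AFml.code])
  | all φ => exact atom _ (by simp [AFml.code])
  | ex φ => exact atom _ (by simp [AFml.code])
  | neg φ ih =>
    rw [evC_neg]
    simp only [Str.sat]
    rcases ih with ⟨a, b⟩ | ⟨a, b⟩ | a <;> simp [a, vneg] <;> tauto
  | and φ ψ ih1 ih2 =>
    rw [evC_and]
    simp only [Str.sat]
    rcases ih1 with ⟨a, b⟩ | ⟨a, b⟩ | a <;> rcases ih2 with ⟨a', b'⟩ | ⟨a', b'⟩ | a' <;>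
      simp [a, a', vop] <;> tauto
  | or φ ψ ih1 ih2 =>
    rw [evC_or]
    simp only [Str.sat]
    rcases ih1 with ⟨a, b⟩ | ⟨a, b⟩ | a <;> rcases ih2 with ⟨a', b'⟩ | ⟨a', b'⟩ | a' <;>
      simp [a, a', vop] <;> tauto
  | imp φ ψ ih1 ih2 =>
    rw [evC_imp]
    simp only [Str.sat]
    rcases ih1 with ⟨a, b⟩ | ⟨a, b⟩ | a <;> rcases ih2 with ⟨a', b'⟩ | ⟨a', b'⟩ | a' <;>
      simp [a, a', vop] <;> tauto

theorem exists_P (Tax : Set AFml) (hext : PA ⊆ Tax)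
    (hcons : ¬ Proves Tax botFml) (hpr : PrAxiomatized Tax)
    (m n : ℕ) (hmn : m ≠ n) (hm : 1 ≤ m) (hn : 1 ≤ n) :
    ∃ (P : AFml) (p : ℕ → ℕ) (D : ℕ → ℕ → Prop), IsSigma1 P ∧ P.FreeLt 1 ∧ PiOk p ∧
      (∀ x, (P.subst0 (numeral x)).code = p x) ∧
      (∀ x, (∃ k, D k x) ↔ ∃ φ : AFml, x = φ.code ∧ Proves Tax φ) ∧
      (∀ x, (∃ k, D k (p x)) → ¬ ∃ k, D k (Nat.pair 2 (p x))) ∧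
      (∀ s, ND p D m n s) ∧ (∀ y ∈ Sst p D, ∃ k, D k y) ∧
      (∀ φ, Proves Tax φ ↔ Proves PA (P.appNum φ)) ∧
      (∀ φ, Proves PA (.imp (iterPred P n φ) (iterPred P m φ))) ∧
      (∀ ψ, Proves Tax (.neg (P.appNum ψ)) → Proves PA (.neg (P.appNum (P.appNum ψ)))) := by
  obtain ⟨D, hD, hS⟩ := re_theorems hpr
  obtain ⟨υ, u1, u2, u3⟩ := RE.delta2 (R := fun a q => UU (piC q) D m n a) (re_UU pr_piC hD m n)
  obtain ⟨κ, k1, k2, k3⟩ := RE.delta3 (R := fun a b q => KK (piC q) D m n a b)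
    (re_KK pr_piC hD m n)
  obtain ⟨η, e1, e2, e3⟩ := RE.delta2 (R := fun a q => EE (piC q) D m n a) (re_EE pr_piC hD m n)
  set Q := coreF υ κ η with hQdef
  have hQ2 : Q.FreeLt 2 := bodyF_freeLt υ κ η u2 k2 e2
  have hQs : IsSigma1 Q := .ex (.ex (.delta0 (bodyF_delta0 υ κ η u1 k1 e1)))
  set q := Q.code with hq
  have hp := piC_ok q
  have core := core_lemma υ κ η u1 k1 e1 u2 k2 e2 q (UU (piC q) D m n) (fun a => u3 a q)
    (KK (piC q) D m n) (fun a b => k3 a b q) (EE (piC q) D m n) (fun a => e3 a q)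
  have hcode : ∀ x, ((PF Q q).subst0 (numeral x)).code = piC q x := fun x => by
    rw [PF_subst hQ2, hq, PX_code]
  have hSat : ∀ {M : Type} (S : Str M) (ρ : ℕ → M) (x : ℕ),
      S.sat ρ ((PF Q q).subst0 (numeral x)) ↔ S.sat (scons (S.num x) (scons (S.num q) ρ)) Q :=
    fun S ρ x => by rw [PF_subst hQ2, sat_PX]
  have hS' : ∀ x, (∃ k, D k x) ↔ ∃ φ : AFml, x = φ.code ∧ Proves Tax φ := fun x => (hS x).symm
  have hcon : ∀ x, (∃ k, D k (piC q x)) → ¬ ∃ k, D k (Nat.pair 2 (piC q x)) := by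
    intro x h1 h2
    rw [hS'] at h1 h2
    obtain ⟨φ, h1, h1'⟩ := h1
    obtain ⟨ψ, h2, h2'⟩ := h2
    have : ψ = .neg φ := AFml.code_injective (by rw [← h2, h1]; rfl)
    subst this
    exact hcons (h1'.tc2 h2' fun v a b => absurd a b)
  -- no disaster
  have hN : ∀ s, ND (piC q) D m n s := by
    intro s s' _ Y hY hd
    obtain ⟨s, Y, hf⟩ := exists_Fst hY hd
    obtain ⟨-, hc⟩ := core (KK_of_Fst hf) (EE_of_Fst hf)
    obtain ⟨z, -, hz, h0⟩ := hf.2.1.2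
    obtain ⟨ζ, rfl, hζ⟩ := (hS' z).1 (Ps.toD hz)
    have : Proves PA (.neg ζ) := by
      apply proves_PA_of
      intro M S hS ρ
      obtain ⟨c1, -, c3⟩ := hc M S hS ρ
      rcases decide_ev S hS ρ (fun x => (PF Q q).subst0 (numeral x)) hcode (bit Y)
        (fun x hx => (hSat S ρ x).2 (c1 x ((UU_of_Fst hf x).2 hx)))
        (fun x hx h => c3 x (EE_of_Fst' hf x hx) ((hSat S ρ x).1 h)) ζ with h | h | h
      · omega
      · exact h.2
      · omega
    exact hcons (hζ.tc2 (this.mono hext) fun v a b => absurd a b)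
  obtain ⟨hsound, hc⟩ := core (UU_KK hN) (UU_EE hp hcon hN hm hn hmn)
  have hnec : ∀ φ, Proves Tax φ → Proves PA ((PF Q q).appNum φ) := by
    intro φ h
    apply proves_PA_of
    intro M S hSM ρ
    exact (hSat S ρ _).2 ((hc M S hSM ρ).1 _ (UU_sup hN _ ((hS' _).2 ⟨φ, rfl, h⟩)))
  have hSst : ∀ y ∈ Sst (piC q) D, ∃ k, D k y := by
    rintro y ⟨j, x, hx, rfl⟩
    induction j with
    | zero => exact hx
    | succ j ih =>
      rw [Function.iterate_succ_apply']
      rw [hS'] at ih ⊢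
      obtain ⟨φ, h, h'⟩ := ih
      refine ⟨(PF Q q).appNum φ, ?_, (hnec φ h').mono hext⟩
      rw [h, AFml.appNum, gnum, hcode]
  have hiter : ∀ k φ, (iterPred (PF Q q) k φ).code = (piC q)^[k] φ.code := by
    intro k φ
    induction k with
    | zero => rfl
    | succ k ih =>
      rw [Function.iterate_succ_apply', iterPred, AFml.appNum, gnum, hcode, ih]
  refine ⟨PF Q q, piC q, D, ?_, ?_, hp, hcode, hS', hcon, hN, hSst, fun φ => ⟨hnec φ, ?_⟩, ?_, ?_⟩
  · exact .ex (.ex (.and (.delta0 (.eq _ _)) (.and (.delta0 (.eq _ _)) hQs)))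
  · exact PF_freeLt hQ2 q
  · intro h
    have h1 := h.sound strN strN_isPA (fun _ => 0)
    have h2 := (hSat strN _ _).1 h1
    rw [strN_num, strN_num] at h2
    have h3 := hSst _ (UU_sub hp hcon hN hm hn hmn _ (hsound _ _ h2))
    obtain ⟨ψ, h4, h5⟩ := (hS' _).1 h3
    rw [AFml.code_injective h4]; exact h5
  · intro φ
    apply proves_PA_of
    intro M S hSM ρ h
    obtain ⟨n, rfl⟩ := Nat.exists_eq_add_of_le' hn
    obtain ⟨m, rfl⟩ := Nat.exists_eq_add_of_le' hm
    have h1 := (hSat S ρ (iterPred (PF Q q) n φ).code).1 h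
    refine (hSat S ρ (iterPred (PF Q q) m φ).code).2 ((hc M S hSM ρ).2.1 _ _ ?_ h1)
    rw [hiter, hiter]
    exact KK_of hp hN φ.code
  · intro ψ h
    apply proves_PA_of
    intro M S hSM ρ h1
    have h1 := (hSat S ρ _).1 h1
    have e : ((PF Q q).appNum ψ).code = piC q ψ.code := hcode _
    rw [e] at h1
    refine (hc M S hSM ρ).2.2 _ (EE_of hp hN _ ?_) h1
    rw [hS']
    exact ⟨.neg ((PF Q q).appNum ψ), by rw [← e]; rfl, h⟩


/-! ### Modal completeness with respect to propositional worlds -/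

theorem NAProves.of_list {m n : ℕ} (L : List MFml) (hL : ∀ B ∈ L, NAProves m n B) (A : MFml)
    (h : ∀ v, (∀ B ∈ L, B.evalTC v) → A.evalTC v) : NAProves m n A := by
  induction L generalizing A with
  | nil => exact .taut fun v => h v (by simp)
  | cons B L ih =>
    have h1 : NAProves m n (.imp B A) := by
      apply ih (fun C hC => hL C (by simp [hC]))
      intro v hv hB
      apply h v
      intro C hC
      rcases List.mem_cons.1 hC with rfl | hC
      · exact hB
      · exact hv C hC
    exact .mp h1 (hL B (by simp))

theorem isClopen_eval (A : MFml) :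
    IsClopen {v : MFml → Bool | A.evalTC fun C => v C = true} := by
  have atom : ∀ C : MFml, IsClopen {v : MFml → Bool | v C = true} := fun C =>
    (isClopen_discrete ({true} : Set Bool)).preimage (continuous_apply C)
  induction A with
  | var i => exact atom _
  | box A _ => exact atom _
  | bot => exact isClopen_empty
  | neg A ih => exact ih.compl
  | and A B ih1 ih2 => exact ih1.inter ih2
  | or A B ih1 ih2 => exact ih1.union ih2
  | imp A B ih1 ih2 =>
    convert ih1.compl.union ih2 using 1
    ext v
    simp only [MFml.evalTC, Set.mem_setOf_eq, Set.mem_union, Set.mem_compl_iff]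
    tauto

def World (m n : ℕ) (v : MFml → Prop) : Prop := ∀ B, NAProves m n B → B.evalTC v

theorem exists_world {m n : ℕ} {A : MFml} (hA : ¬ NAProves m n A) :
    ∃ v, World m n v ∧ ¬ A.evalTC v := by
  classical
  let t : {B // NAProves m n B} → Set (MFml → Bool) :=
    fun B => {v | B.1.evalTC fun C => v C = true}
  let s : Set (MFml → Bool) := {v | A.evalTC fun C => v C = true}ᶜ
  have hs : IsCompact s := (isClopen_eval A).compl.isClosed.isCompact
  have := hs.inter_iInter_nonempty t (fun B => (isClopen_eval B.1).isClosed) ?_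
  · obtain ⟨v, h1, h2⟩ := this
    refine ⟨fun C => v C = true, fun B hB => ?_, h1⟩
    exact Set.mem_iInter.1 h2 ⟨B, hB⟩
  · intro u
    by_contra hc
    apply hA
    apply NAProves.of_list (u.toList.map Subtype.val)
    · intro B hB
      simp only [List.mem_map] at hB
      obtain ⟨B, _, rfl⟩ := hB
      exact B.2
    · intro v hv
      by_contra hAv
      apply hc
      have e : (fun C => decide (v C) = true) = v := by ext C; simp
      refine ⟨fun C => decide (v C), ?_, ?_⟩
      · change ¬ A.evalTC (fun C => decide (v C) = true)
        rw [e]; exact hAv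
      · refine Set.mem_iInter₂.2 fun B hB => ?_
        change B.1.evalTC (fun C => decide (v C) = true)
        rw [e]
        exact hv _ (List.mem_map.2 ⟨B, by simpa using hB, rfl⟩)

/-! ### Arithmetical soundness -/

theorem arith_sound {Tax : Set AFml} (hext : PA ⊆ Tax) {P : AFml} {m n : ℕ}
    (h1 : ∀ φ, Proves Tax φ → Proves PA (P.appNum φ))
    (h2 : ∀ φ, Proves PA (.imp (iterPred P n φ) (iterPred P m φ)))
    (h3 : ∀ ψ, Proves Tax (.neg (P.appNum ψ)) → Proves PA (.neg (P.appNum (P.appNum ψ))))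
    {f : MFml → AFml} (hf : IsInterp P f) {A : MFml} (h : NAProves m n A) : Proves Tax (f A) := by
  obtain ⟨-, fbot, fneg, fand, for', fimp, fbox⟩ := hf
  have hiter : ∀ k A, f (boxIter k A) = iterPred P k (f A) := by
    intro k A
    induction k with
    | zero => rfl
    | succ k ih => simp only [boxIter, iterPred, fbox, ih]
  have hb : Proves Tax (.neg botFml) :=
    Proves.mono hext (proves_PA_of fun M S hS ρ => not_sat_bot S hS ρ)
  induction h with
  | @taut A h =>
    refine hb.tc1 fun v hv => ?_
    have key : ∀ B : MFml, (f B).evalProp v ↔ B.evalTC fun C => (f C).evalProp v := by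
      intro B
      induction B with
      | var i => exact Iff.rfl
      | box A _ => exact Iff.rfl
      | bot => rw [fbot]; exact ⟨fun h => hv h, fun h => h.elim⟩
      | neg A ih => rw [fneg]; exact not_congr ih
      | and A B ih1 ih2 => rw [fand]; exact and_congr ih1 ih2
      | or A B ih1 ih2 => rw [for']; exact or_congr ih1 ih2
      | imp A B ih1 ih2 => rw [fimp]; exact imp_congr ih1 ih2
    exact (key A).2 (h _)
  | acc A => rw [fimp, hiter, hiter]; exact (h2 _).mono hext
  | mp _ _ ih1 ih2 => rw [fimp] at ih1; exact .mp ih1 ih2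
  | nec _ ih => rw [fbox]; exact (h1 _ ih).mono hext
  | ros _ ih =>
    rw [fneg, fbox] at ih
    rw [fneg, fbox, fbox]
    exact (h3 _ ih).mono hext

/-! ### Arithmetical completeness -/

def cI (i : ℕ) : AFml := .eq (numeral (i + 1)) .zero

/-- The uniform arithmetical interpretation. -/
def fs (P : AFml) : MFml → AFml
  | .var i => .and (P.appNum (cI i)) (P.appNum (cI i))
  | .bot => botFml
  | .neg A => .neg (fs P A)
  | .and A B => .and (fs P A) (fs P B)
  | .or A B => .or (fs P A) (fs P B)
  | .imp A B => .imp (fs P A) (fs P B)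
  | .box A => P.appNum (fs P A)

theorem fs_interp {P : AFml} (hP : P.FreeLt 1) : IsInterp P (fs P) := by
  refine ⟨fun i => ?_, rfl, fun _ => rfl, fun _ _ => rfl, fun _ _ => rfl, fun _ _ => rfl,
    fun _ => rfl⟩
  have : (P.appNum (cI i)).FreeLt 0 := by
    apply AFml.FreeLt.substAll hP
    intro k hk
    obtain rfl : k = 0 := by omega
    exact numeral_freeLt _ _
  exact ⟨this, this⟩

section compl
variable {P : AFml} {p : ℕ → ℕ} (hp : PiOk p) (hcode : ∀ x, (P.subst0 (numeral x)).code = p x)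
include hp hcode

theorem app_code (φ : AFml) : (P.appNum φ).code = p φ.code := hcode _

theorem app_inj {φ ψ : AFml} (h : P.appNum φ = P.appNum ψ) : φ = ψ := by
  have h1 := congrArg AFml.code h
  rw [app_code hp hcode, app_code hp hcode] at h1
  exact AFml.code_injective (hp.inj h1)

theorem app_ex (φ : AFml) : ∃ χ, P.appNum φ = .ex χ := by
  have h1 := hp.tag φ.code
  rw [← app_code hp hcode] at h1
  cases h : P.appNum φ with
  | ex χ => exact ⟨χ, rfl⟩
  | _ => rw [h] at h1; simp [AFml.code] at h1

omit hp hcode in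
theorem cI_inj {i j : ℕ} (h : cI i = cI j) : i = j := by
  simp only [cI, AFml.eq.injEq, and_true] at h
  have h1 := congrArg ATerm.code h
  rw [numC_eq, numC_eq] at h1
  have := numC_inj h1
  omega

/-- `cI i` is not in the range of `p`. -/
theorem cI_ne_p (i x : ℕ) : (cI i).code ≠ p x := by
  intro h
  have := hp.tag x
  rw [← h] at this
  simp [cI, AFml.code] at this

theorem fs_ne_cI (A : MFml) (i : ℕ) : fs P A ≠ cI i := by
  intro h
  cases A with
  | box A =>
    obtain ⟨χ, hχ⟩ := app_ex hp hcode (fs P A)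
    rw [fs, hχ] at h
    simp [cI] at h
  | _ => simp [fs, cI, botFml, numeral] at h

theorem fs_p (A : MFml) (x : ℕ) (h : (fs P A).code = p x) :
    ∃ E, A = .box E ∧ (fs P E).code = x := by
  cases A with
  | box A =>
    rw [fs, app_code hp hcode] at h
    exact ⟨A, rfl, hp.inj h⟩
  | _ =>
    have h1 := hp.tag x
    rw [← h] at h1
    simp [fs, AFml.code, botFml] at h1

theorem fs_inj : Function.Injective (fs P) := by
  intro A
  have e := app_ex hp hcode
  have key : ∀ B i, fs P B ≠ P.appNum (cI i) := by
    intro B i h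
    obtain ⟨E, rfl, hE⟩ := fs_p hp hcode B (cI i).code
      (by rw [h, app_code hp hcode])
    exact fs_ne_cI hp hcode E i (AFml.code_injective hE)
  induction A with
  | var i =>
    intro B h
    cases B with
    | var j =>
      simp only [fs, AFml.and.injEq, and_self] at h
      rw [cI_inj (app_inj hp hcode h)]
    | and B C =>
      simp only [fs, AFml.and.injEq] at h
      exact absurd h.1.symm (key _ _)
    | box B => obtain ⟨χ, hχ⟩ := e (fs P B); simp [fs, hχ] at h
    | _ => simp [fs, botFml] at h
  | and A A' ih1 ih2 =>
    intro B h
    cases B with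
    | var j =>
      simp only [fs, AFml.and.injEq] at h
      exact absurd h.1 (key _ _)
    | and B C =>
      simp only [fs, AFml.and.injEq] at h
      rw [ih1 h.1, ih2 h.2]
    | box B => obtain ⟨χ, hχ⟩ := e (fs P B); simp [fs, hχ] at h
    | _ => simp [fs, botFml] at h
  | or A A' ih1 ih2 =>
    intro B h
    cases B with
    | or B C =>
      simp only [fs, AFml.or.injEq] at h
      rw [ih1 h.1, ih2 h.2]
    | box B => obtain ⟨χ, hχ⟩ := e (fs P B); simp [fs, hχ] at h
    | _ => simp [fs, botFml] at h
  | imp A A' ih1 ih2 =>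
    intro B h
    cases B with
    | imp B C =>
      simp only [fs, AFml.imp.injEq] at h
      rw [ih1 h.1, ih2 h.2]
    | box B => obtain ⟨χ, hχ⟩ := e (fs P B); simp [fs, hχ] at h
    | _ => simp [fs, botFml] at h
  | neg A ih1 =>
    intro B h
    cases B with
    | neg B =>
      simp only [fs, AFml.neg.injEq] at h
      rw [ih1 h]
    | box B => obtain ⟨χ, hχ⟩ := e (fs P B); simp [fs, hχ] at h
    | _ => simp [fs, botFml] at h
  | bot =>
    intro B h
    cases B with
    | bot => rfl
    | box B => obtain ⟨χ, hχ⟩ := e (fs P B); simp [fs, botFml, hχ] at h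
    | _ => simp [fs, botFml] at h
  | box A ih =>
    intro B h
    obtain ⟨E, rfl, hE⟩ := fs_p hp hcode B (fs P A).code (by rw [← h, fs, app_code hp hcode])
    rw [ih (AFml.code_injective hE).symm]

theorem fs_iter (k : ℕ) (C : MFml) (x : ℕ) (h : (fs P C).code = p^[k] x) :
    ∃ E, C = boxIter k E ∧ (fs P E).code = x := by
  induction k generalizing C with
  | zero => exact ⟨C, rfl, h⟩
  | succ k ih =>
    rw [Function.iterate_succ_apply'] at h
    obtain ⟨E, rfl, hE⟩ := fs_p hp hcode C _ h
    obtain ⟨F, rfl, hF⟩ := ih E hE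
    exact ⟨F, rfl, hF⟩

theorem fs_boxIter (k : ℕ) (E : MFml) : (fs P (boxIter k E)).code = p^[k] (fs P E).code := by
  induction k with
  | zero => rfl
  | succ k ih => rw [Function.iterate_succ_apply', boxIter, fs, app_code hp hcode, ih]

theorem iter_cI (k j x i : ℕ) (h : p^[k] x = p^[j] (cI i).code) :
    ∃ l, x = p^[l] (cI i).code := by
  induction k generalizing j with
  | zero => exact ⟨j, h⟩
  | succ k ih =>
    rw [Function.iterate_succ_apply'] at h
    cases j with
    | zero => exact absurd h.symm (cI_ne_p hp hcode i _)
    | succ j =>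
      rw [Function.iterate_succ_apply'] at h
      exact ih j (hp.inj h)

/-- The set of numbers attached to a world. -/
def Gw (P : AFml) (p : ℕ → ℕ) (D : ℕ → ℕ → Prop) (v : MFml → Prop) : Set ℕ :=
  {x | (∃ k, D k x) ∨ (∃ C, v (.box C) ∧ x = (fs P C).code) ∨
    ∃ i j, v (.var i) ∧ x = p^[j] (cI i).code}

variable {Tax : Set AFml} {D : ℕ → ℕ → Prop} {m n : ℕ} (hm : 1 ≤ m) (hn : 1 ≤ n) (hmn : m ≠ n)
  (hD : ∀ x, (∃ k, D k x) ↔ ∃ φ : AFml, x = φ.code ∧ Proves Tax φ)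
  (hcon : ∀ x, (∃ k, D k (p x)) → ¬ ∃ k, D k (Nat.pair 2 (p x)))
  (hN : ∀ s, ND p D m n s) (hSst : ∀ y ∈ Sst p D, ∃ k, D k y)
include hm hn hmn hcon hN hSst

theorem good_w (v : MFml → Prop) (hv : World m n v) (z : ℕ) (hz : ∃ k, D k z) :
    evC (atG p (ind (Gw P p D v))) z ≠ 0 := by
  refine good hp hcon hN {G | ∃ v, World m n v ∧ G = Gw P p D v} ?_ ?_ ?_ _ ⟨v, hv, rfl⟩ z hz
  · rintro G ⟨v, hv, rfl⟩ x hx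
    exact Or.inl hx
  · rintro G ⟨v, hv, rfl⟩ a b hR ha
    rcases ha with ha | ⟨C, hC, rfl⟩ | ⟨i, j, hi, rfl⟩
    · exact Or.inl (hSst _ (Sst_R hp hcon hN hm hn hmn a b hR ⟨0, a, ha, rfl⟩))
    · obtain ⟨i, _, h1, rfl⟩ := hR
      obtain ⟨E, rfl, rfl⟩ := fs_iter hp hcode _ _ _ h1.symm
      refine Or.inr (Or.inl ⟨boxIter (m - 1) E, ?_, (fs_boxIter hp hcode _ _).symm⟩)
      have h2 := hv _ (NAProves.acc E)
      obtain ⟨n, rfl⟩ := Nat.exists_eq_add_of_le' hn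
      obtain ⟨m, rfl⟩ := Nat.exists_eq_add_of_le' hm
      exact h2 hC
    · obtain ⟨x, _, h1, rfl⟩ := hR
      obtain ⟨l, rfl⟩ := iter_cI hp hcode _ _ _ _ h1
      exact Or.inr (Or.inr ⟨i, m - 1 + l, hi, by rw [Function.iterate_add_apply]⟩)
  · rintro G ⟨v, hv, rfl⟩ x hx
    rcases hx with hx | ⟨C, hC, hx⟩ | ⟨i, j, hi, hx⟩
    · exact Or.inl hx
    · obtain ⟨E, rfl, rfl⟩ := fs_p hp hcode C x hx.symm
      right
      have h1 : ¬ NAProves m n (.neg (.box E)) := fun h => hv _ h.ros hC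
      obtain ⟨w, hw, h2⟩ := exists_world h1
      have h3 : w (.box E) := not_not.1 h2
      exact ⟨_, ⟨w, hw, rfl⟩, Or.inr (Or.inl ⟨E, h3, rfl⟩)⟩
    · right
      obtain ⟨l, rfl⟩ := iter_cI hp hcode 1 j x i hx
      exact ⟨_, ⟨v, hv, rfl⟩, Or.inr (Or.inr ⟨i, l, hi, rfl⟩)⟩

include hD in
open Classical in
theorem truth (hext : PA ⊆ Tax) (hcons : ¬ Proves Tax botFml)
    (A : MFml) (v : MFml → Prop) (hv : World m n v) :
    evC (atG p (ind (Gw P p D v))) (fs P A).code = if A.evalTC v then 1 else 0 := by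
  induction A generalizing v with
  | bot =>
    rw [evC_atom _ _ (by simp [fs, botFml, AFml.code])]
    simp [atG, fs, botC, MFml.evalTC]
  | neg A ih =>
    rw [fs, evC_neg, ih v hv]
    by_cases h : A.evalTC v <;> simp [MFml.evalTC, h, vneg]
  | and A B ih1 ih2 =>
    rw [fs, evC_and, ih1 v hv, ih2 v hv]
    by_cases h : A.evalTC v <;> by_cases h' : B.evalTC v <;> simp [MFml.evalTC, h, h', vop]
  | or A B ih1 ih2 =>
    rw [fs, evC_or, ih1 v hv, ih2 v hv]
    by_cases h : A.evalTC v <;> by_cases h' : B.evalTC v <;> simp [MFml.evalTC, h, h', vop]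
  | imp A B ih1 ih2 =>
    rw [fs, evC_imp, ih1 v hv, ih2 v hv]
    by_cases h : A.evalTC v <;> by_cases h' : B.evalTC v <;> simp [MFml.evalTC, h, h', vop]
  | var i =>
    have key : (cI i).code ∈ Gw P p D v ↔ v (.var i) := by
      constructor
      · rintro (h | ⟨C, _, h⟩ | ⟨k, j, hk, h⟩)
        · exfalso
          obtain ⟨φ, h1, h2⟩ := (hD _).1 h
          rw [← AFml.code_injective h1] at h2
          have h3 : Proves PA (.neg (cI i)) := by
            apply proves_PA_of
            intro M S hS ρ h4
            simp only [cI, Str.sat, Str.tval_numeral] at h4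
            have h5 : S.num (i + 1) = S.num 0 := h4
            exact absurd (hS.num_inj h5) (by omega)
          exact hcons (h2.tc2 (h3.mono hext) fun v a b => absurd a b)
        · exact absurd (AFml.code_injective h).symm (fs_ne_cI hp hcode C i)
        · cases j with
          | zero =>
            rw [cI_inj (AFml.code_injective h)]; exact hk
          | succ j =>
            rw [Function.iterate_succ_apply'] at h
            exact absurd h (cI_ne_p hp hcode i _)
      · intro h
        exact Or.inr (Or.inr ⟨i, 0, h, rfl⟩)
    rw [fs, evC_and, app_code hp hcode, hp.ev_p]
    simp only [ind_one, key]
    by_cases h : v (.var i) <;> simp [MFml.evalTC, h, vop]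
  | box B ih =>
    have key : (fs P B).code ∈ Gw P p D v ↔ v (.box B) := by
      constructor
      · rintro (h | ⟨C, h1, h⟩ | ⟨k, j, hk, h⟩)
        · have h1 : NAProves m n B := by
            by_contra hB
            obtain ⟨w, hw, h2⟩ := exists_world hB
            refine good_w hp hcode hm hn hmn hcon hN hSst w hw _ h ?_
            rw [ih w hw, if_neg h2]
          exact hv _ h1.nec
        · rw [fs_inj hp hcode (AFml.code_injective h)]; exact h1
        · obtain ⟨E, _, hE⟩ := fs_iter hp hcode _ _ _ h
          exact absurd (AFml.code_injective hE) (fs_ne_cI hp hcode E k)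
      · intro h
        exact Or.inr (Or.inl ⟨B, h, rfl⟩)
    rw [fs, app_code hp hcode, hp.ev_p]
    simp only [ind_one, key]
    rfl

end compl

theorem statement_1 (Tax : Set AFml) (hext : PA ⊆ Tax)
    (hcons : ¬ Proves Tax botFml) (hpr : PrAxiomatized Tax)
    (m n : ℕ) (hmn : m ≠ n) (hm : 1 ≤ m) (hn : 1 ≤ n) :
    ∃ P : AFml, IsSigma1 P ∧ IsProvPred Tax P ∧ PL Tax P = {A : MFml | NAProves m n A} := by
  obtain ⟨P, p, D, h1, h2, hp, hcode, hD, hcon, hN, hSst, hPr, hAcc, hRos⟩ :=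
    exists_P Tax hext hcons hpr m n hmn hm hn
  refine ⟨P, h1, ⟨h2, hPr⟩, ?_⟩
  ext A
  constructor
  · intro hA
    by_contra hc
    obtain ⟨v, hv, hAv⟩ := exists_world hc
    refine good_w hp hcode hm hn hmn hcon hN hSst v hv _
      ((hD _).2 ⟨_, rfl, hA (fs P) (fs_interp h2)⟩) ?_
    rw [truth hp hcode hm hn hmn hD hcon hN hSst hext hcons A v hv, if_neg hAv]
  · intro hA f hf
    exact arith_sound hext (fun φ => (hPr φ).1) hAcc hRos hf hA


/-- Suppose `m ≠ n` and `m, n ≥ 1`. Then there exists a `Σ₁` provability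
predicate `PR_T(x)` of `T` such that `PL(PR_T) = N⁺A_{m,n}`. -/
theorem statement_0 (Tax : Set AFml) (hext : PA ⊆ Tax)
    (hcons : ¬ Proves Tax botFml) (hpr : PrAxiomatized Tax)
    (m n : ℕ) (hmn : m ≠ n) (hm : 1 ≤ m) (hn : 1 ≤ n) :
    ∃ P : AFml, IsSigma1 P ∧ IsProvPred Tax P ∧
      PL Tax P = {A : MFml | NAProves m n A} := by
  exact statement_1 Tax hext hcons hpr m n hmn hm hn

end PLN
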